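/- Suppose that 1 < c < 82/79 and set γ = 1/c. For a positive integer N put P = 10⁻⁹ N^γ and Γ = Σ_{P < p ≤ 2P, m ∈ ℕ, [p^c]+[m^c]=N} μ²(m) log p, where p runs over primes. Then there exist a constant C > 0 and N₀ such that Γ ≥ C · N^{2γ−1} for all integers N ≥ N₀. -/

import Mathlib

/-- `P = 10⁻⁹ N^γ` where `γ = 1/c`. -/
noncomputable def PP (c : ℝ) (N : ℕ) : ℝ := ((10 : ℝ) ^ 9)⁻¹ * (N : ℝ) ^ (1 / c)

/-- The primes `P < p ≤ 2P`.  (Any such prime satisfies `p ≤ N`, so the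
range `Finset.range (N+1)` captures all of them.) -/
noncomputable def primesIn (c : ℝ) (N : ℕ) : Finset ℕ :=
  (Finset.range (N + 1)).filter
    (fun p => p.Prime ∧ PP c N < (p : ℝ) ∧ (p : ℝ) ≤ 2 * PP c N)

/-- `Γ = Σ_{P < p ≤ 2P, m ∈ ℕ, [p^c]+[m^c]=N} μ²(m) log p`. -/
noncomputable def Γ (c : ℝ) (N : ℕ) : ℝ :=
  ∑ p ∈ primesIn c N,
    ∑' m : ℕ,
      if ⌊(p : ℝ) ^ c⌋ + ⌊(m : ℝ) ^ c⌋ = (N : ℤ) then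
        ((ArithmeticFunction.moebius m : ℤ) : ℝ) ^ 2 * Real.log p
      else 0

namespace PrimeSquarefree

open Finset

/-- The additive character `t ↦ exp (2πit)`. -/
noncomputable def ex (t : ℝ) : ℂ := Complex.exp ((2 * Real.pi * t : ℝ) * Complex.I)

theorem norm_ex (t : ℝ) : ‖ex t‖ = 1 := Complex.norm_exp_ofReal_mul_I _

theorem ex_add (s t : ℝ) : ex (s + t) = ex s * ex t := by
  unfold ex
  rw [← Complex.exp_add]
  congr 1
  push_cast
  ring

theorem ex_neg (t : ℝ) : ex (-t) = starRingEnd ℂ (ex t) := by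
  unfold ex
  rw [← Complex.exp_conj, map_mul, Complex.conj_ofReal, Complex.conj_I]
  congr 1
  push_cast
  ring

theorem ex_int (k : ℤ) : ex k = 1 := by
  unfold ex
  rw [Complex.exp_eq_one_iff]
  exact ⟨k, by push_cast; ring⟩

theorem ex_sub (s t : ℝ) : ex (s - t) = ex s * starRingEnd ℂ (ex t) := by
  rw [sub_eq_add_neg, ex_add, ex_neg]

theorem ex_re (t : ℝ) : (ex t).re = Real.cos (2 * Real.pi * t) := by
  unfold ex
  exact Complex.exp_ofReal_mul_I_re _

theorem ex_eq (t : ℝ) :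
    ex t = (Real.cos (Real.pi * t) + Real.sin (Real.pi * t) * Complex.I) ^ 2 := by
  unfold ex
  have h : ((2 * Real.pi * t : ℝ) : ℂ) * Complex.I
      = ((2 : ℕ) : ℂ) * (((Real.pi * t : ℝ) : ℂ) * Complex.I) := by
    push_cast; ring
  rw [h, Complex.exp_nat_mul, Complex.exp_mul_I, Complex.ofReal_cos, Complex.ofReal_sin]

/-- The multiplier in the Kusmin–Landau summation by parts. -/
theorem ex_sub_one_mul (t : ℝ) (hs : Real.sin (Real.pi * t) ≠ 0) :
    (ex t - 1) * (-(1 / 2 : ℂ) -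
      ((Real.cos (Real.pi * t) / Real.sin (Real.pi * t) / 2 : ℝ) : ℂ) * Complex.I) = 1 := by
  rw [ex_eq]
  set s := Real.sin (Real.pi * t)
  set co := Real.cos (Real.pi * t)
  have h1 : (co : ℂ) ^ 2 + (s : ℂ) ^ 2 = 1 := by
    exact_mod_cast (by rw [add_comm]; exact Real.sin_sq_add_cos_sq _ : co ^ 2 + s ^ 2 = 1)
  have hs' : (s : ℂ) ≠ 0 := by exact_mod_cast hs
  have hI : Complex.I ^ 2 = -1 := Complex.I_sq
  push_cast
  field_simp
  have hco : (co : ℂ) ^ 2 = 1 - (s : ℂ) ^ 2 := by rw [← h1]; ring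
  ring_nf
  have h3 : (co : ℂ) ^ 3 = co * (1 - (s : ℂ) ^ 2) := by rw [← hco]; ring
  have hI3 : Complex.I ^ 3 = - Complex.I := by rw [pow_succ, hI]; ring
  simp only [hI, h3, hco, hI3]
  ring

theorem cot_sub_cot (a b : ℝ) (ha : Real.sin a ≠ 0) (hb : Real.sin b ≠ 0) :
    Real.cos a / Real.sin a - Real.cos b / Real.sin b
      = Real.sin (b - a) / (Real.sin a * Real.sin b) := by
  rw [Real.sin_sub]
  field_simp

theorem two_mul_le_sin_pi {Δ t : ℝ} (hΔ : 0 < Δ) (h1 : Δ ≤ t) (h2 : t ≤ 1 - Δ) :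
    2 * Δ ≤ Real.sin (Real.pi * t) := by
  have hpi := Real.pi_pos
  rcases le_total t (1 / 2) with h | h
  · have := Real.mul_le_sin (x := Real.pi * t) (by nlinarith) (by nlinarith)
    have e : 2 / Real.pi * (Real.pi * t) = 2 * t := by field_simp
    linarith
  · have := Real.mul_le_sin (x := Real.pi * (1 - t)) (by nlinarith) (by nlinarith)
    have e : 2 / Real.pi * (Real.pi * (1 - t)) = 2 * (1 - t) := by field_simp
    have e2 : Real.sin (Real.pi * (1 - t)) = Real.sin (Real.pi * t) := by
      rw [mul_sub, mul_one, Real.sin_pi_sub]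
    linarith

/-- **Kusmin–Landau inequality**, discrete form. -/
theorem kusmin_landau (f : ℕ → ℝ) (k : ℤ) {Δ : ℝ} (hΔ : 0 < Δ) (a b : ℕ)
    (h1 : ∀ n, a ≤ n → n < b → k + Δ ≤ f (n + 1) - f n)
    (h2 : ∀ n, a ≤ n → n < b → f (n + 1) - f n ≤ k + 1 - Δ)
    (hm : ∀ n, a ≤ n → n + 1 < b → f (n + 1) - f n ≤ f (n + 2) - f (n + 1)) :
    ‖∑ n ∈ Ico a b, ex (f n)‖ ≤ 2 / Δ := by
  rcases Nat.lt_or_ge a b with hab | hab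
  swap
  · rw [Ico_eq_empty_of_le hab]; simp; positivity
  set g : ℕ → ℝ := fun n => f (n + 1) - f n - k with hg
  set ct : ℕ → ℝ := fun n => Real.cos (Real.pi * g n) / Real.sin (Real.pi * g n) with hct
  set cc : ℕ → ℂ := fun n => -(1 / 2 : ℂ) - ((ct n / 2 : ℝ) : ℂ) * Complex.I with hcc
  have hsin : ∀ n, a ≤ n → n < b → 2 * Δ ≤ Real.sin (Real.pi * g n) := fun n ha hb =>
    two_mul_le_sin_pi hΔ (by have := h1 n ha hb; simp only [hg]; linarith)
      (by have := h2 n ha hb; simp only [hg]; linarith)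
  have hct_le : ∀ n, a ≤ n → n < b → |ct n| ≤ 1 / (2 * Δ) := by
    intro n ha hb
    have h := hsin n ha hb
    rw [hct]; simp only
    rw [abs_div, abs_of_pos (by linarith : 0 < Real.sin (Real.pi * g n))]
    exact div_le_div₀ (by norm_num) (Real.abs_cos_le_one _) (by linarith) h
  have hstep : ∀ n, a ≤ n → n < b → ex (f n) = (ex (f (n + 1)) - ex (f n)) * cc n := by
    intro n ha hb
    have h := hsin n ha hb
    have e : ex (f (n + 1)) = ex (f n) * ex (g n) := by
      rw [← ex_add]
      have : f (n + 1) = f n + g n + k := by simp only [hg]; ring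
      rw [this, ex_add, ex_int, mul_one]
    have := ex_sub_one_mul (g n) (by linarith)
    rw [e]
    calc ex (f n) = ex (f n) * 1 := by ring
      _ = _ := by rw [← this]; simp only [hcc, hct]; ring
  have hmono : ∀ n, a ≤ n → n + 1 < b → ct (n + 1) ≤ ct n := by
    intro n ha hb
    have hs1 := hsin n ha (by omega)
    have hs2 := hsin (n + 1) (by omega) hb
    have := cot_sub_cot (Real.pi * g n) (Real.pi * g (n + 1)) (by linarith) (by linarith)
    have h0 : 0 ≤ Real.sin (Real.pi * g (n + 1) - Real.pi * g n) := by
      have e1 := h1 n ha (by omega)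
      have e2 := h2 (n + 1) (by omega) hb
      have e3 := hm n ha hb
      rw [← mul_sub]
      apply Real.sin_nonneg_of_nonneg_of_le_pi
      · apply mul_nonneg Real.pi_pos.le
        simp only [hg]; linarith
      · have : g (n + 1) - g n ≤ 1 := by simp only [hg]; linarith
        nlinarith [Real.pi_pos]
    have : 0 ≤ ct n - ct (n + 1) := by
      simp only [hct]; rw [this]; apply div_nonneg h0; apply mul_nonneg <;> linarith
    linarith
  have hccn : ∀ n, ‖cc n‖ ≤ 1 / 2 + |ct n| / 2 := by
    intro n
    simp only [hcc]
    refine (norm_sub_le _ _).trans ?_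
    rw [norm_mul, Complex.norm_I, mul_one, Complex.norm_real, Real.norm_eq_abs, abs_div]
    norm_num
  have hind : ∀ m, a + 1 + m ≤ b → ‖∑ n ∈ Ico a (a + 1 + m), ex (f n)
      - ex (f (a + 1 + m)) * cc (a + m)‖ ≤ 1 / 2 + |ct a| / 2 + (ct a - ct (a + m)) / 2 := by
    intro m
    induction m with
    | zero =>
      intro hb
      have := hstep a le_rfl (by omega)
      have e : ∑ n ∈ Ico a (a + 1 + 0), ex (f n) = ex (f a) := by simp
      rw [e]
      have e2 : ex (f a) - ex (f (a + 1 + 0)) * cc (a + 0) = - (ex (f a) * cc a) := by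
        simp only [add_zero]
        linear_combination this
      rw [e2, norm_neg, norm_mul, norm_ex, one_mul]
      simpa using hccn a
    | succ m ih =>
      intro hb
      have hi := ih (by omega)
      have hs := hstep (a + 1 + m) (by omega) (by omega)
      have e : ∑ n ∈ Ico a (a + 1 + (m + 1)), ex (f n)
          = ∑ n ∈ Ico a (a + 1 + m), ex (f n) + ex (f (a + 1 + m)) := by
        rw [← add_assoc, Finset.sum_Ico_succ_top (by omega)]
      have e3 : a + (m + 1) = a + 1 + m := by ring
      rw [e, e3, ← add_assoc]
      have e2 : ∑ n ∈ Ico a (a + 1 + m), ex (f n) + ex (f (a + 1 + m))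
          - ex (f (a + 1 + m + 1)) * cc (a + 1 + m)
          = (∑ n ∈ Ico a (a + 1 + m), ex (f n) - ex (f (a + 1 + m)) * cc (a + m))
            + ex (f (a + 1 + m)) * (cc (a + m) - cc (a + 1 + m)) := by
        linear_combination hs
      rw [e2]
      refine (norm_add_le _ _).trans ?_
      rw [norm_mul, norm_ex, one_mul]
      have hd : ‖cc (a + m) - cc (a + 1 + m)‖ = (ct (a + m) - ct (a + 1 + m)) / 2 := by
        have : cc (a + m) - cc (a + 1 + m)
            = -((((ct (a + m) - ct (a + 1 + m)) / 2 : ℝ) : ℂ) * Complex.I) := by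
          simp only [hcc]; push_cast; ring
        rw [this, norm_neg, norm_mul, Complex.norm_I, mul_one, Complex.norm_real,
          Real.norm_eq_abs, abs_of_nonneg]
        have := hmono (a + m) (by omega) (by omega)
        rw [show a + 1 + m = a + m + 1 by ring]
        linarith
      rw [hd]
      linarith
  obtain ⟨m, rfl⟩ : ∃ m, b = a + 1 + m := ⟨b - a - 1, by omega⟩
  have h := hind m le_rfl
  have hΔ2 : Δ ≤ 1 / 2 := by
    have := h1 a le_rfl hab; have := h2 a le_rfl hab; linarith
  have hb1 := hct_le a le_rfl hab
  have hb2 := hct_le (a + m) (by omega) (by omega)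
  have hb3 := hccn (a + m)
  have htri : ‖∑ n ∈ Ico a (a + 1 + m), ex (f n)‖ ≤ ‖∑ n ∈ Ico a (a + 1 + m), ex (f n)
      - ex (f (a + 1 + m)) * cc (a + m)‖ + ‖ex (f (a + 1 + m)) * cc (a + m)‖ := by
    have := norm_add_le (∑ n ∈ Ico a (a + 1 + m), ex (f n)
      - ex (f (a + 1 + m)) * cc (a + m)) (ex (f (a + 1 + m)) * cc (a + m))
    simpa using this
  rw [norm_mul, norm_ex, one_mul] at htri
  have l1 := neg_abs_le (ct (a + m))
  have l2 := le_abs_self (ct a)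
  have e : 1 / (2 * Δ) = (1 / Δ) / 2 := by field_simp
  have e' : 2 / Δ = 2 * (1 / Δ) := by field_simp
  have h1Δ : 2 ≤ 1 / Δ := by rw [le_div_iff₀ hΔ]; linarith
  rw [e] at hb1 hb2
  rw [e']
  linarith

end PrimeSquarefree

namespace PrimeSquarefree

open Finset

theorem exists_eq_Ico_of_convex (T : Finset ℕ)
    (hT : ∀ x ∈ T, ∀ z ∈ T, ∀ y, x ≤ y → y ≤ z → y ∈ T) : ∃ a b, T = Ico a b := by
  rcases T.eq_empty_or_nonempty with rfl | hne
  · exact ⟨0, 0, by simp⟩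
  · refine ⟨T.min' hne, T.max' hne + 1, ?_⟩
    ext y
    simp only [mem_Ico, Nat.lt_add_one_iff]
    exact ⟨fun hy => ⟨T.min'_le _ hy, T.le_max' _ hy⟩,
      fun hy => hT _ (T.min'_mem hne) _ (T.max'_mem hne) _ hy.1 hy.2⟩

theorem card_le_of_spacing (T : Finset ℕ) {lam D : ℝ} (hl : 0 < lam) (hD : 0 ≤ D)
    (h : ∀ n ∈ T, ∀ n' ∈ T, n ≤ n' → lam * ((n' : ℝ) - n) ≤ D) : (T.card : ℝ) ≤ D / lam + 1 := by
  rcases T.eq_empty_or_nonempty with rfl | hne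
  · simp; positivity
  · have hsub : T ⊆ Icc (T.min' hne) (T.max' hne) := fun y hy =>
      mem_Icc.2 ⟨T.min'_le _ hy, T.le_max' _ hy⟩
    have hc := card_le_card hsub
    rw [Nat.card_Icc] at hc
    have hle : T.min' hne ≤ T.max' hne := T.min'_le _ (T.max'_mem hne)
    have h1 := h _ (T.min'_mem hne) _ (T.max'_mem hne) hle
    have h2 : (T.card : ℝ) ≤ (T.max' hne : ℝ) - T.min' hne + 1 := by
      have : T.card + T.min' hne ≤ T.max' hne + 1 := by omega
      have : (T.card : ℝ) + T.min' hne ≤ T.max' hne + 1 := by exact_mod_cast this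
      linarith
    have h3 : (T.max' hne : ℝ) - T.min' hne ≤ D / lam := by
      rw [le_div_iff₀ hl]; linarith
    linarith

/-- Naturals in a real interval of length `D`. -/
theorem card_le_of_diam (T : Finset ℕ) {D : ℝ} (hD : 0 ≤ D)
    (h : ∀ n ∈ T, ∀ n' ∈ T, n ≤ n' → ((n' : ℝ) - n) ≤ D) : (T.card : ℝ) ≤ D + 1 := by
  have := card_le_of_spacing T one_pos hD (by simpa using h)
  simpa using this

/-- **van der Corput's second derivative test**, discrete form. -/
theorem vdc_discrete (f : ℕ → ℝ) (a b : ℕ) {lam Lam : ℝ} (hl : 0 < lam) (hlL : lam ≤ Lam)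
    (h1 : ∀ n, a ≤ n → n + 2 < b → lam ≤ (f (n + 2) - f (n + 1)) - (f (n + 1) - f n))
    (h2 : ∀ n, a ≤ n → n + 2 < b → (f (n + 2) - f (n + 1)) - (f (n + 1) - f n) ≤ Lam) :
    ‖∑ n ∈ Ico a b, ex (f n)‖ ≤ 12 * ((b - a : ℕ) * Lam + 1) * (1 / √lam + 1) := by
  have hsq : 0 < √lam := Real.sqrt_pos.2 hl
  have hLL : 0 ≤ ((b - a : ℕ) : ℝ) * Lam := mul_nonneg (Nat.cast_nonneg _) (hl.le.trans hlL)
  rcases Nat.lt_or_ge a b with hab | hab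
  swap
  · rw [Ico_eq_empty_of_le hab]; simp only [sum_empty, norm_zero]; positivity
  rcases lt_or_ge (1 / 2) (√lam) with hbig | hsmall
  · have hlam : 1 / 4 ≤ lam := by
      have := Real.sq_sqrt hl.le; nlinarith
    have : ‖∑ n ∈ Ico a b, ex (f n)‖ ≤ ((b - a : ℕ) : ℝ) := by
      refine (norm_sum_le _ _).trans ?_
      simp [norm_ex]
    have h3 : ((b - a : ℕ) : ℝ) * (1 / 4) ≤ ((b - a : ℕ) : ℝ) * Lam := by
      gcongr; linarith
    have h4 : 0 ≤ 1 / √lam := by positivity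
    nlinarith
  set Δ := √lam with hΔ
  have hΔsq : Δ * Δ = lam := Real.mul_self_sqrt hl.le
  set g : ℕ → ℝ := fun n => f (n + 1) - f n with hg
  obtain ⟨B, rfl⟩ : ∃ B, b = B + 1 := ⟨b - 1, by omega⟩
  have haB : a ≤ B := by omega
  have hinc : ∀ m n, a ≤ n → n + m < B →
      lam * m ≤ g (n + m) - g n ∧ g (n + m) - g n ≤ Lam * m := by
    intro m
    induction m with
    | zero => intro n _ _; simp
    | succ m ih =>
      intro n hn hm
      have i1 := ih n hn (by omega)
      have i2 := h1 (n + m) (by omega) (by omega)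
      have i3 := h2 (n + m) (by omega) (by omega)
      have e : g (n + (m + 1)) = f (n + m + 2) - f (n + m + 1) := by
        simp only [hg]; ring_nf
      have e2 : g (n + m) = f (n + m + 1) - f (n + m) := rfl
      rw [e]; rw [e2] at i1
      push_cast
      constructor <;> linarith [i1.1, i1.2]
  have hinc' : ∀ n n', a ≤ n → n ≤ n' → n' < B →
      lam * ((n' : ℝ) - n) ≤ g n' - g n ∧ g n' - g n ≤ Lam * ((n' : ℝ) - n) := by
    intro n n' hn hnn' hB
    obtain ⟨m, rfl⟩ := Nat.exists_eq_add_of_le hnn'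
    have := hinc m n hn hB
    push_cast
    simpa using this
  have hgmono : ∀ n n', a ≤ n → n ≤ n' → n' < B → g n ≤ g n' := by
    intro n n' hn hnn' hB
    have h := (hinc' n n' hn hnn' hB).1
    have : (0 : ℝ) ≤ (n' : ℝ) - n := by
      have : (n : ℝ) ≤ n' := by exact_mod_cast hnn'
      linarith
    nlinarith
  rw [Finset.sum_Ico_succ_top haB]
  set S := Ico a B with hS
  have hfib : ∀ k : ℤ, ‖∑ n ∈ S with ⌊g n⌋ = k, ex (f n)‖ ≤ 4 / Δ + 2 := by
    intro k
    set T := S.filter (fun n => ⌊g n⌋ = k) with hT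
    have hTm : ∀ n, n ∈ T ↔ (a ≤ n ∧ n < B) ∧ (k : ℝ) ≤ g n ∧ g n < k + 1 := by
      intro n
      simp only [hT, hS, mem_filter, mem_Ico, Int.floor_eq_iff]
    rw [← Finset.sum_filter_add_sum_filter_not T (fun n => g n < k + Δ)]
    rw [← Finset.sum_filter_add_sum_filter_not (T.filter (fun n => ¬ g n < k + Δ))
      (fun n => k + 1 - Δ < g n)]
    have c1 : ‖∑ n ∈ T with g n < k + Δ, ex (f n)‖ ≤ Δ / lam + 1 := by
      refine (norm_sum_le _ _).trans ?_
      simp only [norm_ex, sum_const, nsmul_eq_mul, mul_one]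
      apply card_le_of_spacing _ hl hsq.le
      intro n hn n' hn' hnn'
      rw [mem_filter, hTm] at hn hn'
      have := (hinc' n n' hn.1.1.1 hnn' hn'.1.1.2).1
      linarith [hn.1.2.1, hn'.2]
    have c2 : ‖∑ n ∈ (T.filter (fun n => ¬ g n < k + Δ)) with k + 1 - Δ < g n, ex (f n)‖
        ≤ Δ / lam + 1 := by
      refine (norm_sum_le _ _).trans ?_
      simp only [norm_ex, sum_const, nsmul_eq_mul, mul_one]
      apply card_le_of_spacing _ hl hsq.le
      intro n hn n' hn' hnn'
      rw [mem_filter, mem_filter, hTm] at hn hn'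
      have := (hinc' n n' hn.1.1.1.1 hnn' hn'.1.1.1.2).1
      linarith [hn.2, hn'.1.1.2.2]
    have c3 : ‖∑ n ∈ (T.filter (fun n => ¬ g n < k + Δ)) with ¬ k + 1 - Δ < g n, ex (f n)‖
        ≤ 2 / Δ := by
      set T' := (T.filter (fun n => ¬ g n < k + Δ)).filter (fun n => ¬ k + 1 - Δ < g n) with hT'
      have hT'm : ∀ n, n ∈ T' ↔ (a ≤ n ∧ n < B) ∧ (k + Δ ≤ g n ∧ g n ≤ k + 1 - Δ) := by
        intro n
        rw [hT', mem_filter, mem_filter, hTm, not_lt, not_lt]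
        constructor
        · rintro ⟨⟨⟨h, _⟩, h3⟩, h4⟩; exact ⟨h, h3, h4⟩
        · rintro ⟨h, h3, h4⟩; exact ⟨⟨⟨h, by linarith, by linarith⟩, h3⟩, h4⟩
      obtain ⟨a', b', hab'⟩ := exists_eq_Ico_of_convex T' (by
        intro x hx z hz y hxy hyz
        rw [hT'm] at hx hz ⊢
        refine ⟨⟨by omega, by omega⟩, ?_, ?_⟩
        · exact hx.2.1.trans (hgmono _ _ hx.1.1 hxy (by omega))
        · exact (hgmono _ _ (by omega) hyz hz.1.2).trans hz.2.2)
      have hin : ∀ n, a' ≤ n → n < b' → (a ≤ n ∧ n < B) ∧ (k + Δ ≤ g n ∧ g n ≤ k + 1 - Δ) := by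
        intro n h h'
        rw [← hT'm, hab', mem_Ico]; exact ⟨h, h'⟩
      rw [hab']
      apply kusmin_landau f k hsq
      · intro n h h'; exact (hin n h h').2.1
      · intro n h h'; exact (hin n h h').2.2
      · intro n h h'
        exact hgmono n (n + 1) (hin n h (by omega)).1.1 (by omega) (hin (n + 1) (by omega) h').1.2
    have hd : Δ / lam = 1 / Δ := by rw [← hΔsq]; field_simp
    rw [hd] at c1 c2
    have e4 : 4 / Δ = 4 * (1 / Δ) := by ring
    have e2 : 2 / Δ = 2 * (1 / Δ) := by ring
    rw [e2] at c3
    rw [e4]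
    refine (norm_add_le _ _).trans ?_
    have := norm_add_le
      (∑ n ∈ (T.filter (fun n => ¬ g n < k + Δ)) with k + 1 - Δ < g n, ex (f n))
      (∑ n ∈ (T.filter (fun n => ¬ g n < k + Δ)) with ¬ k + 1 - Δ < g n, ex (f n))
    linarith
  have hmain : ‖∑ n ∈ S, ex (f n)‖ ≤ (((B + 1 - a : ℕ) : ℝ) * Lam + 2) * (4 / Δ + 2) := by
    rw [← Finset.sum_fiberwise_of_maps_to (s := S) (t := S.image (fun n => ⌊g n⌋))
      (g := fun n => ⌊g n⌋) (fun n hn => mem_image_of_mem _ hn)]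
    refine (norm_sum_le _ _).trans ?_
    refine (sum_le_sum (fun k _ => hfib k)).trans ?_
    rw [sum_const, nsmul_eq_mul]
    apply mul_le_mul_of_nonneg_right _ (by positivity)
    rcases Nat.lt_or_ge a B with haB' | haB'
    · have hsub : S.image (fun n => ⌊g n⌋) ⊆ Icc ⌊g a⌋ ⌊g (B - 1)⌋ := by
        intro k hk
        rw [mem_image] at hk
        obtain ⟨n, hn, rfl⟩ := hk
        rw [hS, mem_Ico] at hn
        rw [mem_Icc]
        exact ⟨Int.floor_le_floor (hgmono _ _ le_rfl hn.1 hn.2),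
          Int.floor_le_floor (hgmono _ _ hn.1 (by omega) (by omega))⟩
      have hc := card_le_card hsub
      rw [Int.card_Icc] at hc
      have hc' : ((S.image (fun n => ⌊g n⌋)).card : ℝ)
          ≤ ((⌊g (B - 1)⌋ + 1 - ⌊g a⌋).toNat : ℝ) := by exact_mod_cast hc
      refine hc'.trans ?_
      have hge : ⌊g a⌋ ≤ ⌊g (B - 1)⌋ :=
        Int.floor_le_floor (hgmono _ _ le_rfl (by omega) (by omega))
      have e : ((⌊g (B - 1)⌋ + 1 - ⌊g a⌋).toNat : ℝ) = (⌊g (B - 1)⌋ : ℝ) + 1 - ⌊g a⌋ := by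
        have : ((⌊g (B - 1)⌋ + 1 - ⌊g a⌋).toNat : ℤ) = ⌊g (B - 1)⌋ + 1 - ⌊g a⌋ :=
          Int.toNat_of_nonneg (by omega)
        exact_mod_cast this
      rw [e]
      have i1 := Int.floor_le (g (B - 1))
      have i2 := Int.lt_floor_add_one (g a)
      have i3 := (hinc' a (B - 1) le_rfl (by omega) (by omega)).2
      have i4 : Lam * (((B - 1 : ℕ) : ℝ) - a) ≤ ((B + 1 - a : ℕ) : ℝ) * Lam := by
        rw [mul_comm]
        apply mul_le_mul_of_nonneg_right _ (by linarith)
        rw [Nat.cast_sub (by omega), Nat.cast_sub (by omega)]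
        push_cast
        linarith
      linarith
    · rw [hS, Ico_eq_empty_of_le haB']
      simp only [image_empty, card_empty, Nat.cast_zero]
      linarith
  refine (norm_add_le _ _).trans ?_
  rw [norm_ex]
  have e4 : 4 / Δ = 4 * (1 / Δ) := by ring
  rw [e4] at hmain
  have h0 : 0 ≤ 1 / Δ := by positivity
  nlinarith [mul_nonneg hLL h0]

/-- **van der Corput's second derivative test** for a phase with second derivative in
`[lam, Lam]`. -/
theorem vdc_of_pos {J : Set ℝ} (hJ : J.OrdConnected) (φ φ₁ φ₂ : ℝ → ℝ)
    (h1 : ∀ y ∈ J, HasDerivAt φ (φ₁ y) y) (h2 : ∀ y ∈ J, HasDerivAt φ₁ (φ₂ y) y)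
    {lam Lam : ℝ} (hl : 0 < lam) (hlL : lam ≤ Lam)
    (hlo : ∀ y ∈ J, lam ≤ φ₂ y) (hhi : ∀ y ∈ J, φ₂ y ≤ Lam)
    (S : Finset ℕ) (hS : ∀ n : ℕ, n ∈ S ↔ (n : ℝ) ∈ J) :
    ‖∑ n ∈ S, ex (φ n)‖ ≤ 12 * (S.card * Lam + 1) * (1 / √lam + 1) := by
  obtain ⟨a, b, rfl⟩ := exists_eq_Ico_of_convex S (by
    intro x hx z hz y hxy hyz
    rw [hS] at hx hz ⊢
    exact hJ.out hx hz ⟨by exact_mod_cast hxy, by exact_mod_cast hyz⟩)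
  rw [Nat.card_Ico]
  have key : ∀ n : ℕ, a ≤ n → n + 2 < b → ∃ z ∈ J,
      (φ ((n + 2 : ℕ) : ℝ) - φ ((n + 1 : ℕ) : ℝ)) - (φ ((n + 1 : ℕ) : ℝ) - φ n) = φ₂ z := by
    intro n hn hb
    have m0 : (n : ℝ) ∈ J := by rw [← hS, mem_Ico]; omega
    have m2 : ((n + 2 : ℕ) : ℝ) ∈ J := by rw [← hS, mem_Ico]; omega
    push_cast at m2 ⊢
    have hsub : Set.Icc (n : ℝ) (n + 2) ⊆ J := hJ.out m0 m2
    have hd : ∀ y ∈ Set.Icc (n : ℝ) (n + 1),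
        HasDerivAt (fun y => φ (y + 1) - φ y) (φ₁ (y + 1) - φ₁ y) y := by
      intro y hy
      have := (h1 (y + 1) (hsub ⟨by linarith [hy.1], by linarith [hy.2]⟩)).comp_add_const y 1
      exact this.sub (h1 y (hsub ⟨by linarith [hy.1], by linarith [hy.2]⟩))
    obtain ⟨ξ, hξ, he⟩ := exists_hasDerivAt_eq_slope (fun y => φ (y + 1) - φ y)
      (fun y => φ₁ (y + 1) - φ₁ y) (by linarith : (n : ℝ) < n + 1)
      (fun y hy => (hd y hy).continuousAt.continuousWithinAt)
      (fun y hy => hd y (Set.Ioo_subset_Icc_self hy))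
    obtain ⟨ζ, hζ, he2⟩ := exists_hasDerivAt_eq_slope φ₁ φ₂ (by linarith : ξ < ξ + 1)
      (fun y hy => (h2 y (hsub ⟨by linarith [hy.1, hξ.1],
        by linarith [hy.2, hξ.2]⟩)).continuousAt.continuousWithinAt)
      (fun y hy => h2 y (hsub ⟨by linarith [hy.1, hξ.1], by linarith [hy.2, hξ.2]⟩))
    refine ⟨ζ, hsub ⟨by linarith [hζ.1, hξ.1], by linarith [hζ.2, hξ.2]⟩, ?_⟩
    have e3 : ξ + 1 - ξ = 1 := by ring
    have e4 : (n : ℝ) + 1 - n = 1 := by ring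
    rw [e3, div_one] at he2
    rw [e4, div_one] at he
    rw [he2, he, show (n : ℝ) + 1 + 1 = n + 2 by ring]
  apply vdc_discrete (fun n : ℕ => φ n) a b hl hlL
  · intro n hn hb
    obtain ⟨z, hz, he⟩ := key n hn hb
    rw [he]; exact hlo z hz
  · intro n hn hb
    obtain ⟨z, hz, he⟩ := key n hn hb
    rw [he]; exact hhi z hz

theorem norm_sum_ex_neg (S : Finset ℕ) (φ : ℕ → ℝ) :
    ‖∑ n ∈ S, ex (-φ n)‖ = ‖∑ n ∈ S, ex (φ n)‖ := by
  simp_rw [ex_neg]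
  rw [← map_sum, RCLike.norm_conj]

/-- Second derivative test with either sign `s = ±1` of the second derivative. -/
theorem vdc {J : Set ℝ} (hJ : J.OrdConnected) (φ φ₁ φ₂ : ℝ → ℝ)
    (h1 : ∀ y ∈ J, HasDerivAt φ (φ₁ y) y) (h2 : ∀ y ∈ J, HasDerivAt φ₁ (φ₂ y) y)
    {lam Lam s : ℝ} (hs : s = 1 ∨ s = -1) (hl : 0 < lam) (hlL : lam ≤ Lam)
    (hlo : ∀ y ∈ J, lam ≤ s * φ₂ y) (hhi : ∀ y ∈ J, s * φ₂ y ≤ Lam)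
    (S : Finset ℕ) (hS : ∀ n : ℕ, n ∈ S ↔ (n : ℝ) ∈ J) :
    ‖∑ n ∈ S, ex (φ n)‖ ≤ 12 * (S.card * Lam + 1) * (1 / √lam + 1) := by
  rcases hs with rfl | rfl
  · exact vdc_of_pos hJ φ φ₁ φ₂ h1 h2 hl hlL (by simpa using hlo) (by simpa using hhi) S hS
  · rw [← norm_sum_ex_neg]
    exact vdc_of_pos hJ (fun y => -φ y) (fun y => -φ₁ y) (fun y => -φ₂ y)
      (fun y hy => (h1 y hy).neg) (fun y hy => (h2 y hy).neg) hl hlL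
      (by simpa using hlo) (by simpa using hhi) S hS

end PrimeSquarefree

namespace PrimeSquarefree

open Finset

/-- A phase `F` on an interval `J ⊆ (P, 2P]` such that both `H y`, which is `y ^ 2` times the second
derivative of `F`, and `y` times the derivative of `H` have constant sign and absolute value in
`[lo, hi]`. -/
structure PhaseOn (J : Set ℝ) (F F1 F2 H1 : ℝ → ℝ) (P lo hi : ℝ) : Prop where
  ord : J.OrdConnected
  one_le : 1 ≤ P
  sub : J ⊆ Set.Ioc P (2 * P)
  lo_pos : 0 < lo
  lo_le : lo ≤ hi
  deriv1 : ∀ y ∈ J, HasDerivAt F (F1 y) y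
  deriv2 : ∀ y ∈ J, HasDerivAt F1 (F2 y) y
  deriv3 : ∀ y ∈ J, HasDerivAt (fun y => y ^ 2 * F2 y) (H1 y) y
  sign2 : ∃ s : ℝ, (s = 1 ∨ s = -1) ∧
    ∀ y ∈ J, lo ≤ s * (y ^ 2 * F2 y) ∧ s * (y ^ 2 * F2 y) ≤ hi
  sign3 : ∃ s : ℝ, (s = 1 ∨ s = -1) ∧ ∀ y ∈ J, lo ≤ s * (y * H1 y) ∧ s * (y * H1 y) ≤ hi

theorem PhaseOn.mono {J J' : Set ℝ} {F F1 F2 H1 : ℝ → ℝ} {P lo hi : ℝ}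
    (h : PhaseOn J F F1 F2 H1 P lo hi) (hJ' : J'.OrdConnected) (hs : J' ⊆ J) :
    PhaseOn J' F F1 F2 H1 P lo hi where
  ord := hJ'
  one_le := h.one_le
  sub := hs.trans h.sub
  lo_pos := h.lo_pos
  lo_le := h.lo_le
  deriv1 := fun y hy => h.deriv1 y (hs hy)
  deriv2 := fun y hy => h.deriv2 y (hs hy)
  deriv3 := fun y hy => h.deriv3 y (hs hy)
  sign2 := by
    obtain ⟨s, hs1, hs2⟩ := h.sign2
    exact ⟨s, hs1, fun y hy => hs2 y (hs hy)⟩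
  sign3 := by
    obtain ⟨s, hs1, hs2⟩ := h.sign3
    exact ⟨s, hs1, fun y hy => hs2 y (hs hy)⟩

theorem ordConnected_mul_preimage {J : Set ℝ} (hJ : J.OrdConnected) {d : ℝ} (hd : 0 ≤ d) :
    {t : ℝ | d * t ∈ J}.OrdConnected :=
  ⟨fun _ hx _ hz _ hy => hJ.out hx hz
    ⟨mul_le_mul_of_nonneg_left hy.1 hd, mul_le_mul_of_nonneg_left hy.2 hd⟩⟩

theorem PhaseOn.inner_sum {J : Set ℝ} {F F1 F2 H1 : ℝ → ℝ} {P lo hi : ℝ}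
    (h : PhaseOn J F F1 F2 H1 P lo hi) {d : ℕ} (hd : 1 ≤ d) {D : ℝ} (hdD : (d : ℝ) ≤ D)
    (hDP : D ≤ P) (T : Finset ℕ) (hT : ∀ l : ℕ, l ∈ T ↔ (d : ℝ) * l ∈ J) :
    ‖∑ l ∈ T, ex (F (d * l))‖ ≤ 48 * (hi / √lo + hi * D / P + P / √lo + 1) := by
  have hd0 : (1 : ℝ) ≤ d := by exact_mod_cast hd
  have hdpos : (0 : ℝ) < d := by linarith
  have hP := h.one_le
  have hP0 : 0 < P := by linarith
  have hlo := h.lo_pos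
  have hhi : 0 < hi := hlo.trans_le h.lo_le
  have hslo : 0 < √lo := Real.sqrt_pos.2 hlo
  obtain ⟨s, hs, hb⟩ := h.sign2
  have hlP : ∀ y : ℝ, (d : ℝ) * y ∈ J → P / d < y ∧ y ≤ 2 * P / d := by
    intro y hy
    have := h.sub hy
    constructor
    · rw [div_lt_iff₀ hdpos]; linarith [this.1]
    · rw [le_div_iff₀ hdpos]; linarith [this.2]
  have hcard : (T.card : ℝ) ≤ 2 * P / d := by
    have h1 : (T.card : ℝ) ≤ P / d + 1 := by
      apply card_le_of_diam _ (by positivity)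
      intro n hn n' hn' _
      have a1 := hlP n ((hT n).1 hn)
      have a2 := hlP n' ((hT n').1 hn')
      have : 2 * P / d = P / d + P / d := by ring
      linarith [a1.1, a2.2]
    have h2 : 1 ≤ P / d := by rw [le_div_iff₀ hdpos]; linarith
    have : 2 * P / d = P / d + P / d := by ring
    linarith
  have hv := vdc (ordConnected_mul_preimage h.ord hdpos.le)
    (fun t => F (d * t)) (fun t => F1 (d * t) * d) (fun t => F2 (d * t) * d * d)
    (by
      intro y hy
      have h0 : HasDerivAt (fun t : ℝ => (d : ℝ) * t) d y := by
        simpa using (hasDerivAt_id y).const_mul (d : ℝ)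
      exact (h.deriv1 _ hy).comp y h0)
    (by
      intro y hy
      have h0 : HasDerivAt (fun t : ℝ => (d : ℝ) * t) d y := by
        simpa using (hasDerivAt_id y).const_mul (d : ℝ)
      exact ((h.deriv2 _ hy).comp y h0).mul_const (d : ℝ))
    (lam := lo * d ^ 2 / (4 * P ^ 2)) (Lam := hi * d ^ 2 / P ^ 2) hs (by positivity)
    (by
      have := h.lo_le
      rw [div_le_div_iff₀ (by positivity) (by positivity)]
      have : lo * (d : ℝ) ^ 2 * P ^ 2 ≤ hi * d ^ 2 * P ^ 2 := by gcongr
      have h3 : 0 ≤ hi * d ^ 2 * P ^ 2 := by positivity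
      linarith)
    (by
      intro y hy
      have hy' := hlP y hy
      have hy0 : 0 < y := lt_trans (by positivity) hy'.1
      have hbb := (hb _ hy).1
      have hle : (d * y) ^ 2 ≤ (2 * P) ^ 2 := by
        have := (h.sub hy).2
        gcongr
      rw [div_le_iff₀ (by positivity)]
      have hpos : 0 ≤ s * F2 (d * y) := by
        by_contra hneg
        push Not at hneg
        have : 0 < (d * y) ^ 2 := by positivity
        nlinarith
      have : lo ≤ s * F2 (d * y) * (2 * P) ^ 2 := by
        calc lo ≤ s * F2 (d * y) * (d * y) ^ 2 := by linarith
          _ ≤ _ := by gcongr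
      have h3 : lo * (d : ℝ) ^ 2 ≤ s * F2 (d * y) * (2 * P) ^ 2 * d ^ 2 := by gcongr
      linarith)
    (by
      intro y hy
      have hy' := hlP y hy
      have hy0 : 0 < y := lt_trans (by positivity) hy'.1
      have hbb := (hb _ hy)
      have hle : P ^ 2 ≤ (d * y) ^ 2 := by
        have := (h.sub hy).1.le
        gcongr
      rw [le_div_iff₀ (by positivity)]
      have hpos : 0 ≤ s * F2 (d * y) := by
        by_contra hneg
        push Not at hneg
        have : 0 < (d * y) ^ 2 := by positivity
        nlinarith [hbb.1]
      have : s * F2 (d * y) * P ^ 2 ≤ hi := by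
        calc s * F2 (d * y) * P ^ 2 ≤ s * F2 (d * y) * (d * y) ^ 2 := by gcongr
          _ ≤ hi := by linarith [hbb.2]
      have h3 : s * F2 (d * y) * P ^ 2 * d ^ 2 ≤ hi * (d : ℝ) ^ 2 := by gcongr
      linarith)
    T hT
  refine hv.trans ?_
  have e1 : √(lo * d ^ 2 / (4 * P ^ 2)) = √lo * d / (2 * P) := by
    rw [show lo * d ^ 2 / (4 * P ^ 2) = lo * (d / (2 * P)) ^ 2 by ring,
      Real.sqrt_mul hlo.le, Real.sqrt_sq (by positivity)]
    ring
  rw [e1]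
  have e2 : 1 / (√lo * d / (2 * P)) = 2 * P / (d * √lo) := by field_simp
  rw [e2]
  calc 12 * (T.card * (hi * d ^ 2 / P ^ 2) + 1) * (2 * P / (d * √lo) + 1)
      ≤ 12 * (2 * P / d * (hi * d ^ 2 / P ^ 2) + 1) * (2 * P / (d * √lo) + 1) := by gcongr
    _ = 12 * (4 * (hi / √lo) + 2 * (hi * d / P) + 2 * (P / √lo) * (1 / d) + 1) := by
      field_simp
      ring
    _ ≤ 12 * (4 * (hi / √lo) + 2 * (hi * D / P) + 2 * (P / √lo) * 1 + 1) := by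
      have : 1 / (d : ℝ) ≤ 1 := by rw [div_le_one hdpos]; exact hd0
      gcongr
    _ ≤ _ := by
      have : 0 ≤ hi * D / P := by
        have : 0 ≤ D := by linarith
        positivity
      have : 0 ≤ P / √lo := by positivity
      linarith

/-- Removing a monotone weight by partial summation. -/
theorem norm_sum_mul_le_of_tails (T : Finset ℕ) (M : ℕ) (hT : ∀ l ∈ T, l ≤ M) (v : ℕ → ℝ)
    (hv : Monotone v) (hv0 : 0 ≤ v 0) (z : ℕ → ℂ) {B : ℝ}
    (hB : ∀ j : ℕ, ‖∑ l ∈ T with j ≤ l, z l‖ ≤ B) :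
    ‖∑ l ∈ T, (v l : ℂ) * z l‖ ≤ v M * B := by
  have e : ∑ l ∈ T, (v l : ℂ) * z l = (v 0 : ℂ) * ∑ l ∈ T with 0 ≤ l, z l
      + ∑ j ∈ range M, ((v (j + 1) - v j : ℝ) : ℂ) * ∑ l ∈ T with j + 1 ≤ l, z l := by
    simp_rw [sum_filter, mul_sum]
    rw [sum_comm, ← sum_add_distrib]
    apply sum_congr rfl
    intro l hl
    have h1 : ∑ j ∈ range M, ((v (j + 1) - v j : ℝ) : ℂ) * (if j + 1 ≤ l then z l else 0)
        = ∑ j ∈ range l, ((v (j + 1) - v j : ℝ) : ℂ) * z l := by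
      rw [← sum_filter_add_sum_filter_not (range M) (fun j => j + 1 ≤ l)]
      rw [sum_congr rfl (g := fun j => ((v (j + 1) - v j : ℝ) : ℂ) * z l)
        (fun j hj => by rw [if_pos (mem_filter.1 hj).2])]
      rw [sum_eq_zero (s := (range M).filter (fun j => ¬ j + 1 ≤ l))
        (fun j hj => by rw [if_neg (mem_filter.1 hj).2, mul_zero]), add_zero]
      congr 1
      ext j
      have := hT l hl
      simp only [mem_filter, mem_range]
      omega
    rw [h1, ← sum_mul, ← Complex.ofReal_sum, sum_range_sub]
    simp only [zero_le, if_true]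
    push_cast
    ring
  have hB0 : 0 ≤ B := (norm_nonneg _).trans (hB 0)
  rw [e]
  refine (norm_add_le _ _).trans ?_
  have h1 : ‖(v 0 : ℂ) * ∑ l ∈ T with 0 ≤ l, z l‖ ≤ v 0 * B := by
    rw [norm_mul, Complex.norm_real, Real.norm_eq_abs, abs_of_nonneg hv0]
    exact mul_le_mul_of_nonneg_left (hB 0) hv0
  have h2 : ‖∑ j ∈ range M, ((v (j + 1) - v j : ℝ) : ℂ) * ∑ l ∈ T with j + 1 ≤ l, z l‖
      ≤ ∑ j ∈ range M, (v (j + 1) - v j) * B := by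
    refine (norm_sum_le _ _).trans (sum_le_sum fun j _ => ?_)
    have hj : 0 ≤ v (j + 1) - v j := by linarith [hv (Nat.le_succ j)]
    rw [norm_mul, Complex.norm_real, Real.norm_eq_abs, abs_of_nonneg hj]
    exact mul_le_mul_of_nonneg_left (hB _) hj
  rw [← sum_mul, sum_range_sub] at h2
  linarith

theorem PhaseOn.typeI {J : Set ℝ} {F F1 F2 H1 : ℝ → ℝ} {P lo hi : ℝ}
    (h : PhaseOn J F F1 F2 H1 P lo hi) (S : Finset ℕ) (hS : ∀ n : ℕ, n ∈ S ↔ (n : ℝ) ∈ J)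
    (M : ℕ) (hM : ∀ n ∈ S, n ≤ M) {D A : ℝ} (hD : 0 ≤ D) (hDP : D ≤ P) (hA : 0 ≤ A) (u v : ℕ → ℝ)
    (hu : ∀ d ∈ Icc 1 M, |u d| ≤ A) (hu0 : ∀ d : ℕ, D < d → u d = 0)
    (hv : Monotone v) (hv0 : 0 ≤ v 0) :
    ‖∑ d ∈ Icc 1 M, ∑ l ∈ Icc 1 M with d * l ∈ S, ((u d * v l : ℝ) : ℂ) * ex (F (d * l))‖
      ≤ D * A * v M * (48 * (hi / √lo + hi * D / P + P / √lo + 1)) := by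
  set B := 48 * (hi / √lo + hi * D / P + P / √lo + 1) with hB
  have hP0 : 0 < P := by linarith [h.one_le]
  have hhi : 0 < hi := h.lo_pos.trans_le h.lo_le
  have hB0 : 0 ≤ B := by positivity
  have hvM : 0 ≤ v M := hv0.trans (hv (Nat.zero_le _))
  have hterm : ∀ d ∈ Icc 1 M,
      ‖∑ l ∈ Icc 1 M with d * l ∈ S, ((u d * v l : ℝ) : ℂ) * ex (F (d * l))‖
        ≤ if (d : ℝ) ≤ D then A * (v M * B) else 0 := by
    intro d hd
    split_ifs with hdD
    · have e : ∑ l ∈ Icc 1 M with d * l ∈ S, ((u d * v l : ℝ) : ℂ) * ex (F (d * l))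
          = (u d : ℂ) * ∑ l ∈ Icc 1 M with d * l ∈ S, (v l : ℂ) * ex (F (d * l)) := by
        rw [mul_sum]
        apply sum_congr rfl
        intro l _
        push_cast; ring
      rw [e, norm_mul, Complex.norm_real, Real.norm_eq_abs]
      apply mul_le_mul (hu d hd) _ (norm_nonneg _) hA
      have hd1 : 1 ≤ d := (mem_Icc.1 hd).1
      apply norm_sum_mul_le_of_tails _ M
        (fun l hl => (mem_Icc.1 (mem_filter.1 hl).1).2) v hv hv0
      intro j
      have hJ' : (J ∩ Set.Ici ((d : ℝ) * j)).OrdConnected := h.ord.inter Set.ordConnected_Ici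
      apply (h.mono hJ' Set.inter_subset_left).inner_sum hd1 hdD hDP
      intro l
      have hdpos : (0 : ℝ) < d := by exact_mod_cast hd1
      simp only [mem_filter, mem_Icc, Set.mem_inter_iff, Set.mem_Ici]
      rw [mul_le_mul_iff_of_pos_left hdpos]
      constructor
      · rintro ⟨⟨_, h2⟩, h3⟩
        rw [hS] at h2
        push_cast at h2
        exact ⟨h2, by exact_mod_cast h3⟩
      · rintro ⟨h2, h3⟩
        have h4 : d * l ∈ S := by rw [hS]; push_cast; exact h2
        have h5 : d * l ≤ M := hM _ h4
        have h6 : 0 < d * l := by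
          have := (h.sub h2).1
          have : (0 : ℝ) < ((d * l : ℕ) : ℝ) := by push_cast; linarith
          exact_mod_cast this
        have h7 : 0 < l := Nat.pos_of_mul_pos_left h6
        refine ⟨⟨⟨h7, ?_⟩, h4⟩, by exact_mod_cast h3⟩
        nlinarith
    · rw [hu0 d (by linarith)]
      simp
  refine (norm_sum_le _ _).trans ((sum_le_sum hterm).trans ?_)
  rw [← sum_filter, sum_const, nsmul_eq_mul]
  have hc : (((Icc 1 M).filter (fun d : ℕ => (d : ℝ) ≤ D)).card : ℝ) ≤ D := by
    have : (Icc 1 M).filter (fun d : ℕ => (d : ℝ) ≤ D) ⊆ Icc 1 ⌊D⌋₊ := by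
      intro d hd
      rw [mem_filter, mem_Icc] at hd
      rw [mem_Icc]
      exact ⟨hd.1.1, Nat.le_floor hd.2⟩
    have := card_le_card this
    rw [Nat.card_Icc, Nat.add_sub_cancel] at this
    exact (by exact_mod_cast this : _ ≤ (⌊D⌋₊ : ℝ)).trans (Nat.floor_le hD)
  calc _ ≤ D * (A * (v M * B)) := by gcongr
    _ = _ := by ring

end PrimeSquarefree

namespace PrimeSquarefree

open Finset

theorem PhaseOn.diff_sum {J : Set ℝ} {F F1 F2 H1 : ℝ → ℝ} {P lo hi : ℝ}
    (h : PhaseOn J F F1 F2 H1 P lo hi) {k k' : ℕ} (hk : 1 ≤ k) (hkk : k < k') (hk2 : k' ≤ 2 * k)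
    {R : ℝ} (hR : (k' : ℝ) - k ≤ R) (hkP : (k : ℝ) ≤ P) (T : Finset ℕ)
    (hT : ∀ m : ℕ, m ∈ T ↔ (k : ℝ) * m ∈ J ∧ (k' : ℝ) * m ∈ J) :
    ‖∑ m ∈ T, ex (F (k' * m) - F (k * m))‖
      ≤ 72 * ((hi * √R + P) / √lo * (1 / √k) + hi * R / P + 1) := by
  have hk1 : (1 : ℝ) ≤ k := by exact_mod_cast hk
  have hkpos : (0 : ℝ) < k := by linarith
  have hkk1 : (k : ℝ) + 1 ≤ k' := by exact_mod_cast hkk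
  have hk'pos : (0 : ℝ) < k' := by linarith
  have hk2' : (k' : ℝ) ≤ 2 * k := by exact_mod_cast hk2
  have hP := h.one_le
  have hP0 : 0 < P := by linarith
  have hlo := h.lo_pos
  have hhi : 0 < hi := hlo.trans_le h.lo_le
  have hslo : 0 < √lo := Real.sqrt_pos.2 hlo
  have hsk : 0 < √(k : ℝ) := Real.sqrt_pos.2 hkpos
  set r : ℝ := (k' : ℝ) - k with hr
  have hr1 : 1 ≤ r := by linarith
  obtain ⟨s, hs, hb⟩ := h.sign3
  set J' : Set ℝ := {y | (k : ℝ) * y ∈ J} ∩ {y | (k' : ℝ) * y ∈ J} with hJ'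
  have hord : J'.OrdConnected := (ordConnected_mul_preimage h.ord hkpos.le).inter
    (ordConnected_mul_preimage h.ord hk'pos.le)
  have hy_lo : ∀ y ∈ J', P / k < y := by
    intro y hy
    rw [div_lt_iff₀ hkpos]
    have := (h.sub hy.1).1
    linarith
  have hy_hi : ∀ y ∈ J', y ≤ 2 * P / k := by
    intro y hy
    rw [le_div_iff₀ hkpos]
    have := (h.sub hy.1).2
    linarith
  have hcard : (T.card : ℝ) ≤ 2 * P / k := by
    have h1 : (T.card : ℝ) ≤ P / k + 1 := by
      apply card_le_of_diam _ (by positivity)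
      intro n hn n' hn' _
      have a1 := hy_lo n ((hT n).1 hn)
      have a2 := hy_hi n' ((hT n').1 hn')
      have : 2 * P / k = P / k + P / k := by ring
      linarith
    have h2 : 1 ≤ P / k := by rw [le_div_iff₀ hkpos]; linarith
    have : 2 * P / k = P / k + P / k := by ring
    linarith
  have hder : ∀ a : ℝ, ∀ y : ℝ, HasDerivAt (fun t : ℝ => a * t) a y := fun a y => by
    simpa using (hasDerivAt_id y).const_mul a
  -- the second derivative of the difference, via the mean value theorem
  have key : ∀ y ∈ J', ∃ ξ : ℝ, ξ ∈ J ∧ k * y ≤ ξ ∧ ξ ≤ k' * y ∧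
      y ^ 2 * (F2 (k' * y) * k' * k' - F2 (k * y) * k * k) * ξ = ξ * H1 ξ * (r * y) := by
    intro y hy
    have hy0 : 0 < y := lt_trans (by positivity) (hy_lo y hy)
    have hlt : k * y < k' * y := by nlinarith
    have hin : ∀ z ∈ Set.Icc (k * y) (k' * y), z ∈ J := fun z hz => h.ord.out hy.1 hy.2 hz
    obtain ⟨ξ, hξ, e⟩ := exists_hasDerivAt_eq_slope (fun y => y ^ 2 * F2 y) H1 hlt
      (fun z hz => (h.deriv3 z (hin z hz)).continuousAt.continuousWithinAt)
      (fun z hz => h.deriv3 z (hin z ⟨hz.1.le, hz.2.le⟩))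
    refine ⟨ξ, hin ξ ⟨hξ.1.le, hξ.2.le⟩, hξ.1.le, hξ.2.le, ?_⟩
    rw [eq_div_iff (by linarith)] at e
    have : r * y = k' * y - k * y := by rw [hr]; ring
    rw [this]
    linear_combination (-ξ) * e
  have hv := vdc hord
    (fun t => F (k' * t) - F (k * t)) (fun t => F1 (k' * t) * k' - F1 (k * t) * k)
    (fun t => F2 (k' * t) * k' * k' - F2 (k * t) * k * k)
    (fun y hy => ((h.deriv1 _ hy.2).comp y (hder k' y)).sub ((h.deriv1 _ hy.1).comp y (hder k y)))
    (fun y hy => (((h.deriv2 _ hy.2).comp y (hder k' y)).mul_const _).sub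
      (((h.deriv2 _ hy.1).comp y (hder k y)).mul_const _))
    (lam := lo * r * k / (8 * P ^ 2)) (Lam := hi * r * k / P ^ 2) hs (by positivity)
    (by
      have := h.lo_le
      rw [div_le_div_iff₀ (by positivity) (by positivity)]
      have : lo * r * k * P ^ 2 ≤ hi * r * k * P ^ 2 := by gcongr
      have h3 : 0 ≤ hi * r * k * P ^ 2 := by positivity
      linarith)
    (by
      intro y hy
      have hy0 : 0 < y := lt_trans (by positivity) (hy_lo y hy)
      obtain ⟨ξ, hξJ, hξ1, hξ2, e⟩ := key y hy
      set W := F2 (k' * y) * k' * k' - F2 (k * y) * k * k with hW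
      have hξ0 : 0 < ξ := lt_of_lt_of_le (by positivity) hξ1
      have hbb := (hb ξ hξJ).1
      have e2 : s * W * (y * ξ) = s * (ξ * H1 ξ) * r := by
        have : y * (s * W * (y * ξ)) = y * (s * (ξ * H1 ξ) * r) := by
          linear_combination s * e
        exact mul_left_cancel₀ hy0.ne' this
      have h1 : lo * r ≤ s * W * (y * ξ) := by rw [e2]; gcongr
      have hsW : 0 ≤ s * W := by
        by_contra hneg
        push Not at hneg
        have : 0 < y * ξ := by positivity
        have : 0 < lo * r := by positivity
        nlinarith
      have h2 : ξ * k ≤ 2 * (k * y) * k := by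
        have : ξ ≤ 2 * k * y := hξ2.trans (by gcongr)
        nlinarith
      have h3 : k * y ≤ 2 * P := (h.sub hy.1).2
      have h4 : y * ξ * k ≤ 8 * P ^ 2 := by
        calc y * ξ * k = y * (ξ * k) := by ring
          _ ≤ y * (2 * (k * y) * k) := by gcongr
          _ = 2 * (k * y) ^ 2 := by ring
          _ ≤ 2 * (2 * P) ^ 2 := by gcongr
          _ = _ := by ring
      rw [div_le_iff₀ (by positivity)]
      calc lo * r * k ≤ s * W * (y * ξ) * k := by gcongr
        _ = s * W * (y * ξ * k) := by ring
        _ ≤ _ := by gcongr)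
    (by
      intro y hy
      have hy0 : 0 < y := lt_trans (by positivity) (hy_lo y hy)
      obtain ⟨ξ, hξJ, hξ1, hξ2, e⟩ := key y hy
      set W := F2 (k' * y) * k' * k' - F2 (k * y) * k * k with hW
      have hξ0 : 0 < ξ := lt_of_lt_of_le (by positivity) hξ1
      have hbb := (hb ξ hξJ)
      have e2 : s * W * (y * ξ) = s * (ξ * H1 ξ) * r := by
        have : y * (s * W * (y * ξ)) = y * (s * (ξ * H1 ξ) * r) := by
          linear_combination s * e
        exact mul_left_cancel₀ hy0.ne' this
      have h1 : s * W * (y * ξ) ≤ hi * r := by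
        rw [e2]; exact mul_le_mul_of_nonneg_right hbb.2 (by linarith)
      have hsW : 0 ≤ s * W := by
        by_contra hneg
        push Not at hneg
        have : 0 < y * ξ := by positivity
        have : 0 < lo * r := by positivity
        have : lo * r ≤ s * (ξ * H1 ξ) * r := by have := hbb.1; gcongr
        nlinarith
      have h3 : P ≤ k * y := (h.sub hy.1).1.le
      have h4 : P ^ 2 ≤ y * ξ * k := by
        calc P ^ 2 ≤ (k * y) ^ 2 := by gcongr
          _ = y * (k * y) * k := by ring
          _ ≤ y * ξ * k := by gcongr
      rw [le_div_iff₀ (by positivity)]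
      calc s * W * P ^ 2 ≤ s * W * (y * ξ * k) := by gcongr
        _ = s * W * (y * ξ) * k := by ring
        _ ≤ hi * r * k := by gcongr)
    T hT
  refine hv.trans ?_
  have e1 : 1 / √(lo * r * k / (8 * P ^ 2)) = √8 * (P / (√lo * √r * √k)) := by
    rw [Real.sqrt_div (by positivity), Real.sqrt_mul (by positivity), Real.sqrt_mul hlo.le,
      Real.sqrt_mul (by norm_num), Real.sqrt_sq hP0.le]
    field_simp
  have h8 : √8 ≤ 3 := by rw [Real.sqrt_le_left (by norm_num)]; norm_num
  have hsr : 1 ≤ √r := by rw [Real.one_le_sqrt]; exact hr1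
  have hsr0 : 0 < √r := by linarith
  have hrr : √r * √r = r := Real.mul_self_sqrt (by linarith)
  rw [e1]
  have hq : 0 ≤ P / (√lo * √r * √k) := by positivity
  calc 12 * (T.card * (hi * r * k / P ^ 2) + 1) * (√8 * (P / (√lo * √r * √k)) + 1)
      ≤ 12 * (2 * P / k * (hi * r * k / P ^ 2) + 1) * (3 * (P / (√lo * √r * √k)) + 1) := by gcongr
    _ = 12 * (6 * (hi * √r / √lo * (1 / √k)) + 2 * (hi * r / P)
          + 3 * (P / (√lo * √k) * (1 / √r)) + 1) := by
      have : hi * √r / √lo * (1 / √k) = hi * r / √r / √lo * (1 / √k) := by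
        have hh : √r = r / √r := by rw [eq_div_iff hsr0.ne', hrr]
        conv_lhs => rw [hh]
        ring
      rw [this]
      field_simp
      ring
    _ ≤ 12 * (6 * (hi * √R / √lo * (1 / √k)) + 2 * (hi * R / P)
          + 3 * (P / (√lo * √k) * 1) + 1) := by
      have : 1 / √r ≤ 1 := by rw [div_le_one hsr0]; exact hsr
      gcongr
    _ ≤ 72 * ((hi * √R / √lo * (1 / √k)) + (hi * R / P) + (P / (√lo * √k) * 1) + 1) := by
      have : 0 ≤ hi * R / P := by
        have : 0 ≤ R := by linarith
        positivity
      have : 0 ≤ P / (√lo * √k) * 1 := by positivity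
      have : 0 ≤ hi * √R / √lo * (1 / √k) := by positivity
      linarith
    _ = _ := by
      field_simp
      ring

theorem PhaseOn.diff_sum_symm {J : Set ℝ} {F F1 F2 H1 : ℝ → ℝ} {P lo hi : ℝ}
    (h : PhaseOn J F F1 F2 H1 P lo hi) {k k' R : ℕ} (hk : R ≤ k) (hk' : R ≤ k') (hne : k ≠ k')
    (hb : k / R = k' / R) (hR : 0 < R)
    (hkP : (k : ℝ) ≤ P) (hkP' : (k' : ℝ) ≤ P) (T : Finset ℕ)
    (hT : ∀ m : ℕ, m ∈ T ↔ (k : ℝ) * m ∈ J ∧ (k' : ℝ) * m ∈ J) :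
    ‖∑ m ∈ T, ex (F (k * m) - F (k' * m))‖
      ≤ 144 * ((hi * √R + P) / √lo * (1 / √k) + hi * R / P + 1) := by
  have hP0 : 0 < P := by linarith [h.one_le]
  have hhi : 0 < hi := h.lo_pos.trans_le h.lo_le
  have hkpos : (0 : ℝ) < k := by exact_mod_cast hR.trans_le hk
  have hkpos' : (0 : ℝ) < k' := by exact_mod_cast hR.trans_le hk'
  have hlt : ∀ a b : ℕ, a / R = b / R → b < a + R := by
    intro a b hab
    have h1 := Nat.div_add_mod a R
    have h2 := Nat.div_add_mod b R
    have h3 := Nat.mod_lt b hR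
    rw [← hab] at h2
    omega
  have h1 := hlt k k' hb
  have h2 := hlt k' k hb.symm
  have hX : 0 ≤ (hi * √R + P) / √lo := by positivity
  have hY : 0 ≤ hi * R / P := by positivity
  rcases lt_or_gt_of_ne hne with hlt' | hlt'
  · have := h.diff_sum (R := R) (by omega) hlt' (by omega)
      (by have : (k' : ℝ) ≤ k + R := by exact_mod_cast h1.le
          linarith) hkP T hT
    have e : ‖∑ m ∈ T, ex (F (k * m) - F (k' * m))‖ = ‖∑ m ∈ T, ex (F (k' * m) - F (k * m))‖ := by
      rw [← norm_sum_ex_neg]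
      simp only [neg_sub]
    rw [e]
    have : 0 ≤ (hi * √R + P) / √lo * (1 / √k) := by positivity
    linarith
  · have := h.diff_sum (R := R) (by omega) hlt' (by omega)
      (by have : (k : ℝ) ≤ k' + R := by exact_mod_cast h2.le
          linarith) hkP' T (by intro m; rw [hT]; exact and_comm)
    refine this.trans ?_
    have hs : 1 / √k' ≤ 2 * (1 / √k) := by
      have : √(k : ℝ) ≤ 2 * √k' := by
        rw [Real.sqrt_le_left (by positivity), mul_pow, Real.sq_sqrt hkpos'.le]
        have : (k : ℝ) ≤ 4 * k' := by exact_mod_cast (by omega : k ≤ 4 * k')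
        linarith
      rw [mul_one_div, div_le_div_iff₀ (Real.sqrt_pos.2 hkpos') (Real.sqrt_pos.2 hkpos)]
      linarith
    have := mul_le_mul_of_nonneg_left hs hX
    linarith

end PrimeSquarefree

namespace PrimeSquarefree

open Finset

theorem sum_one_div_sqrt_le (K : ℕ) : ∑ k ∈ Icc 1 K, 1 / √(k : ℝ) ≤ 2 * √K := by
  induction K with
  | zero => simp
  | succ n ih =>
    rw [sum_Icc_succ_top (by omega)]
    have h1 : 0 < √((n + 1 : ℕ) : ℝ) := Real.sqrt_pos.2 (by positivity)
    have h2 : √((n + 1 : ℕ) : ℝ) ^ 2 = n + 1 := by rw [Real.sq_sqrt (by positivity)]; push_cast; ring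
    have h3 : √(n : ℝ) ^ 2 = n := Real.sq_sqrt (by positivity)
    have h4 : 1 / √((n + 1 : ℕ) : ℝ) ≤ 2 * √((n + 1 : ℕ) : ℝ) - 2 * √n := by
      rw [div_le_iff₀ h1]
      nlinarith [sq_nonneg (√((n + 1 : ℕ) : ℝ) - √n)]
    linarith

theorem sum_one_div_le (K : ℕ) : ∑ k ∈ Icc 1 K, 1 / (k : ℝ) ≤ 1 + Real.log K := by
  have := harmonic_le_one_add_log K
  rw [harmonic_eq_sum_Icc] at this
  push_cast at this
  simpa [one_div] using this

theorem norm_sum_sq_le {ι : Type*} (E : Finset ι) (a : ι → ℝ) (z : ι → ℂ) {A : ℝ}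
    (ha : ∀ i ∈ E, |a i| ≤ A) :
    ‖∑ i ∈ E, (a i : ℂ) * z i‖ ^ 2 ≤ A ^ 2 * (E.card * ∑ i ∈ E, ‖z i‖ ^ 2) := by
  have h1 : ‖∑ i ∈ E, (a i : ℂ) * z i‖ ≤ ∑ i ∈ E, A * ‖z i‖ := by
    refine (norm_sum_le _ _).trans (sum_le_sum fun i hi => ?_)
    rw [norm_mul, Complex.norm_real, Real.norm_eq_abs]
    exact mul_le_mul_of_nonneg_right (ha i hi) (norm_nonneg _)
  calc _ ≤ (∑ i ∈ E, A * ‖z i‖) ^ 2 := by gcongr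
    _ = A ^ 2 * (∑ i ∈ E, ‖z i‖) ^ 2 := by rw [← mul_sum, mul_pow]
    _ ≤ _ := by
      gcongr
      exact sq_sum_le_card_mul_sum_sq

/-- Number of pairs `(m, k / R)` with `m * k ∈ S`. -/
theorem card_pairs_le {J : Set ℝ} {P : ℝ} (hP : 1 ≤ P) (hJ : J ⊆ Set.Ioc P (2 * P)) (S : Finset ℕ)
    (hS : ∀ n : ℕ, n ∈ S ↔ (n : ℝ) ∈ J) (M R K : ℕ) (hR : 1 ≤ R) (hRP : (R : ℝ) ≤ P) :
    ((((Icc 1 M) ×ˢ (range (M + 1))).filter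
      (fun p => ∃ k ∈ Icc R K, p.1 * k ∈ S ∧ k / R = p.2)).card : ℝ)
      ≤ P / R * (Real.log (2 * P) + 6) := by
  have hR0 : (0 : ℝ) < R := by exact_mod_cast hR
  have hR1 : (1 : ℝ) ≤ R := by exact_mod_cast hR
  set E := ((Icc 1 M) ×ˢ (range (M + 1))).filter
      (fun p => ∃ k ∈ Icc R K, p.1 * k ∈ S ∧ k / R = p.2) with hE
  set L := ⌊2 * P / R⌋₊ with hL
  have hmem : ∀ p ∈ E, ∃ k : ℕ, R ≤ k ∧ P < p.1 * k ∧ (p.1 : ℝ) * k ≤ 2 * P ∧ k / R = p.2 ∧ 1 ≤ p.1 := by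
    intro p hp
    rw [hE, mem_filter, mem_product] at hp
    obtain ⟨⟨h1, _⟩, k, hk, h2, h3⟩ := hp
    rw [hS] at h2
    have := hJ h2
    push_cast at this
    exact ⟨k, (mem_Icc.1 hk).1, this.1, this.2, h3, (mem_Icc.1 h1).1⟩
  have hmaps : ∀ p ∈ E, p.1 ∈ Icc 1 L := by
    intro p hp
    obtain ⟨k, h1, h2, h3, h4, h5⟩ := hmem p hp
    rw [mem_Icc]
    refine ⟨h5, Nat.le_floor ?_⟩
    rw [le_div_iff₀ hR0]
    have : (R : ℝ) ≤ k := by exact_mod_cast h1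
    have : (p.1 : ℝ) * R ≤ p.1 * k := by gcongr
    linarith
  rw [card_eq_sum_card_fiberwise (t := Icc 1 L) (f := Prod.fst) hmaps]
  push_cast
  have hfib : ∀ m ∈ Icc 1 L, ((E.filter (fun p => p.1 = m)).card : ℝ) ≤ P / R * (1 / m) + 2 := by
    intro m hm
    have hm0 : (0 : ℝ) < m := by exact_mod_cast (mem_Icc.1 hm).1
    have hinj : ((E.filter (fun p => p.1 = m)).image Prod.snd).card
        = (E.filter (fun p => p.1 = m)).card := by
      apply card_image_of_injOn
      intro p hp q hq hpq
      have h1 := (mem_filter.1 hp).2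
      have h2 := (mem_filter.1 hq).2
      exact Prod.ext (h1.trans h2.symm) hpq
    rw [← hinj]
    have : P / R * (1 / m) + 2 = (P / R * (1 / m) + 1) + 1 := by ring
    rw [this]
    apply card_le_of_diam _ (by positivity)
    intro r hr r' hr' _
    obtain ⟨p, hp, rfl⟩ := mem_image.1 hr
    obtain ⟨q, hq, rfl⟩ := mem_image.1 hr'
    rw [mem_filter] at hp hq
    obtain ⟨k, h1, h2, h3, h4, h5⟩ := hmem p hp.1
    obtain ⟨k', h1', h2', h3', h4', h5'⟩ := hmem q hq.1
    rw [hp.2] at h2 h3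
    rw [hq.2] at h2' h3'
    rw [← h4, ← h4']
    have a1 : (((k' / R : ℕ) : ℝ)) * R ≤ k' := by exact_mod_cast Nat.div_mul_le_self k' R
    have a2 : (k : ℝ) ≤ ((k / R : ℕ) : ℝ) * R + R := by
      have h1 := Nat.div_add_mod k R
      have h3 := Nat.mod_lt k hR
      have : k ≤ (k / R) * R + R := by rw [mul_comm (k / R) R]; omega
      exact_mod_cast this
    have a3 : m * ((k' : ℝ) - k) ≤ P := by linarith
    have a4 : (((k' / R : ℕ) : ℝ) - ((k / R : ℕ) : ℝ)) * R ≤ (k' : ℝ) - k + R := by linarith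
    have a5 : (k' : ℝ) - k ≤ P / m := by rw [le_div_iff₀ hm0]; linarith
    have : P / R * (1 / m) + 1 = (P / m + R) / R := by field_simp
    rw [this, le_div_iff₀ hR0]
    linarith
  refine (sum_le_sum hfib).trans ?_
  rw [sum_add_distrib, ← mul_sum, sum_const, Nat.card_Icc, Nat.add_sub_cancel, nsmul_eq_mul]
  have hq : 1 ≤ 2 * P / R := by rw [le_div_iff₀ hR0]; linarith
  have hLle : (L : ℝ) ≤ 2 * P / R := Nat.floor_le (by positivity)
  have hL1 : 1 ≤ L := Nat.le_floor (by exact_mod_cast hq)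
  have hlog : Real.log L ≤ Real.log (2 * P) := by
    apply Real.log_le_log (by exact_mod_cast hL1)
    refine hLle.trans ?_
    rw [div_le_iff₀ hR0]
    nlinarith
  have h1 := sum_one_div_le L
  have hPR : 0 ≤ P / R := by positivity
  calc P / R * ∑ i ∈ Icc 1 L, 1 / (i : ℝ) + L * 2
      ≤ P / R * (1 + Real.log (2 * P)) + (2 * P / R) * 2 := by gcongr; linarith
    _ = P / R * (Real.log (2 * P) + 5) := by ring
    _ ≤ _ := by gcongr; norm_num

theorem PhaseOn.typeII {J : Set ℝ} {F F1 F2 H1 : ℝ → ℝ} {P lo hi : ℝ}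
    (h : PhaseOn J F F1 F2 H1 P lo hi) (S : Finset ℕ) (hS : ∀ n : ℕ, n ∈ S ↔ (n : ℝ) ∈ J)
    (M : ℕ) (hM : ∀ n ∈ S, n ≤ M) {A B : ℝ} (hB : 0 ≤ B) (a b : ℕ → ℝ)
    (ha : ∀ m ∈ Icc 1 M, |a m| ≤ A) (hb : ∀ k ∈ Icc 1 M, |b k| ≤ B)
    (R K : ℕ) (hR : 1 ≤ R) (hRK : R ≤ K) (hKP : (K : ℝ) ≤ P)
    (hbs : ∀ k ∈ Icc 1 M, b k ≠ 0 → R ≤ k) (hbs2 : ∀ m ∈ Icc 1 M, ∀ k ∈ Icc 1 M,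
      a m ≠ 0 → b k ≠ 0 → m * k ∈ S → k ≤ K) :
    ‖∑ m ∈ Icc 1 M, ∑ k ∈ Icc 1 M with m * k ∈ S, ((a m * b k : ℝ) : ℂ) * ex (F (m * k))‖ ^ 2
      ≤ A ^ 2 * (P / R * (Real.log (2 * P) + 6)) * (B ^ 2 * (2 * P * (1 + Real.log K)
        + R * (144 * ((hi * √R + P) / √lo * (2 * √K) + K * (hi * R / P + 1))))) := by
  have hP := h.one_le
  have hP0 : 0 < P := by linarith
  have hhi : 0 < hi := h.lo_pos.trans_le h.lo_le
  have hR0 : (0 : ℝ) < R := by exact_mod_cast hR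
  set KK := (Icc 1 M).filter (fun k => R ≤ k ∧ k ≤ K) with hKK
  have hKKI : KK ⊆ Icc 1 K := by
    intro k hk
    rw [hKK, mem_filter, mem_Icc] at hk
    exact mem_Icc.2 ⟨hk.1.1, hk.2.2⟩
  set w : ℕ → ℕ → ℂ := fun m k => if m * k ∈ S then (b k : ℂ) * ex (F (m * k)) else 0 with hw
  set Q : ℕ × ℕ → ℂ := fun p => ∑ k ∈ KK, if k / R = p.2 then w p.1 k else 0 with hQ
  set E := ((Icc 1 M) ×ˢ (range (M + 1))).filter
      (fun p => ∃ k ∈ Icc R K, p.1 * k ∈ S ∧ k / R = p.2) with hE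
  have step1 : ∑ m ∈ Icc 1 M, ∑ k ∈ Icc 1 M with m * k ∈ S, ((a m * b k : ℝ) : ℂ) * ex (F (m * k))
      = ∑ p ∈ E, (a p.1 : ℂ) * Q p := by
    have e1 : ∑ p ∈ E, (a p.1 : ℂ) * Q p
        = ∑ p ∈ (Icc 1 M) ×ˢ (range (M + 1)), (a p.1 : ℂ) * Q p := by
      apply sum_subset (filter_subset _ _)
      intro p hp hpE
      have : Q p = 0 := by
        apply sum_eq_zero
        intro k hk
        split_ifs with h1
        · simp only [hw]
          split_ifs with h2
          · exfalso
            apply hpE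
            rw [mem_filter]
            rw [hKK, mem_filter] at hk
            exact ⟨hp, k, mem_Icc.2 hk.2, h2, h1⟩
          · rfl
        · rfl
      rw [this, mul_zero]
    rw [e1, sum_product]
    apply sum_congr rfl
    intro m hm
    change _ = ∑ r ∈ range (M + 1), (a m : ℂ) * Q (m, r)
    rw [← mul_sum]
    change _ = (a m : ℂ) * ∑ r ∈ range (M + 1), ∑ k ∈ KK, if k / R = r then w m k else 0
    rw [sum_comm]
    have e2 : ∀ k ∈ KK, ∑ r ∈ range (M + 1), (if k / R = r then w m k else 0) = w m k := by
      intro k hk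
      rw [sum_ite_eq, if_pos]
      rw [mem_range]
      have : k ≤ M := (mem_Icc.1 (mem_filter.1 hk).1).2
      have := Nat.div_le_self k R
      omega
    rw [sum_congr rfl e2, hKK, mul_sum, sum_filter, sum_filter]
    refine sum_congr rfl fun k hk => ?_
    by_cases h1 : m * k ∈ S
    · by_cases h2 : R ≤ k ∧ k ≤ K
      · rw [if_pos h1, if_pos h2, if_pos h1]; push_cast; ring
      · rw [if_pos h1, if_neg h2]
        by_cases h3 : a m = 0
        · rw [h3]; simp
        · by_cases h4 : b k = 0
          · rw [h4]; simp
          · exact absurd ⟨hbs k hk h4, hbs2 m hm k hk h3 h4 h1⟩ h2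
    · simp [h1]
  rw [step1]
  have hcardE : (E.card : ℝ) ≤ P / R * (Real.log (2 * P) + 6) := by
    apply card_pairs_le hP h.sub S hS M R K hR
    have : (R : ℝ) ≤ K := by exact_mod_cast hRK
    linarith
  refine (norm_sum_sq_le E (fun p => a p.1) Q (A := A) ?_).trans ?_
  · intro p hp
    exact ha _ (mem_product.1 (mem_filter.1 hp).1).1
  rw [mul_assoc (A ^ 2)]
  have hEn : 0 ≤ ∑ p ∈ E, ‖Q p‖ ^ 2 := sum_nonneg fun _ _ => by positivity
  refine mul_le_mul_of_nonneg_left ?_ (sq_nonneg A)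
  refine mul_le_mul hcardE ?_ hEn ((Nat.cast_nonneg _).trans hcardE)
  -- expand the square
  have step2 : ∑ p ∈ E, ‖Q p‖ ^ 2 ≤ ∑ p ∈ (Icc 1 M) ×ˢ (range (M + 1)), ‖Q p‖ ^ 2 :=
    sum_le_sum_of_subset_of_nonneg (filter_subset _ _) fun _ _ _ => by positivity
  refine step2.trans ?_
  have step3 : ((∑ p ∈ (Icc 1 M) ×ˢ (range (M + 1)), ‖Q p‖ ^ 2 : ℝ) : ℂ)
      = ∑ k ∈ KK, ∑ k' ∈ KK, if k / R = k' / R then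
          ∑ m ∈ Icc 1 M, w m k * starRingEnd ℂ (w m k') else 0 := by
    push_cast
    rw [sum_product]
    have e1 : ∀ m ∈ Icc 1 M, ∑ r ∈ range (M + 1), (‖Q (m, r)‖ : ℂ) ^ 2
        = ∑ k ∈ KK, ∑ k' ∈ KK, if k / R = k' / R then w m k * starRingEnd ℂ (w m k') else 0 := by
      intro m hm
      have e2 : ∀ r ∈ range (M + 1), (‖Q (m, r)‖ : ℂ) ^ 2 = ∑ k ∈ KK, ∑ k' ∈ KK,
          if k / R = r then (if k / R = k' / R then w m k * starRingEnd ℂ (w m k') else 0) else 0 := by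
        intro r _
        rw [← Complex.mul_conj']
        simp only [hQ]
        rw [map_sum, sum_mul_sum]
        refine sum_congr rfl fun k _ => sum_congr rfl fun k' _ => ?_
        by_cases h1 : k / R = r
        · by_cases h2 : k' / R = r
          · simp [h1, h2]
          · have : ¬ r = k' / R := fun h => h2 h.symm
            simp [h1, h2, this]
        · simp [h1]
      rw [sum_congr rfl e2, sum_comm]
      refine sum_congr rfl fun k hk => ?_
      rw [sum_comm]
      refine sum_congr rfl fun k' _ => ?_
      rw [sum_ite_eq, if_pos]
      rw [mem_range]
      have : k ≤ M := (mem_Icc.1 (mem_filter.1 hk).1).2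
      have := Nat.div_le_self k R
      omega
    rw [sum_congr rfl e1, sum_comm]
    refine sum_congr rfl fun k hk => ?_
    rw [sum_comm]
    refine sum_congr rfl fun k' _ => ?_
    split_ifs with h1
    · rfl
    · simp
  set X := (hi * √R + P) / √lo with hX
  set Y := hi * R / P + 1 with hY
  have hX0 : 0 ≤ X := by positivity
  have hY0 : 0 ≤ Y := by positivity
  have hcorr : ∀ k ∈ KK, ∀ k' ∈ KK, k / R = k' / R →
      ‖∑ m ∈ Icc 1 M, w m k * starRingEnd ℂ (w m k')‖
        ≤ B ^ 2 * (if k = k' then 2 * P * (1 / k) else 144 * (X * (1 / √k) + Y)) := by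
    intro k hk k' hk' hkk'
    have hkI := mem_filter.1 hk
    have hkI' := mem_filter.1 hk'
    have hk1 : 1 ≤ k := (mem_Icc.1 hkI.1).1
    have hkpos : (0 : ℝ) < k := by exact_mod_cast hk1
    have hkP : (k : ℝ) ≤ P := le_trans (by exact_mod_cast hkI.2.2) hKP
    have hkP' : (k' : ℝ) ≤ P := le_trans (by exact_mod_cast hkI'.2.2) hKP
    set T := (Icc 1 M).filter (fun m => m * k ∈ S ∧ m * k' ∈ S) with hTdef
    have hT : ∀ m : ℕ, m ∈ T ↔ (k : ℝ) * m ∈ J ∧ (k' : ℝ) * m ∈ J := by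
      intro m
      rw [hTdef, mem_filter, hS, hS]
      push_cast
      rw [mul_comm (m : ℝ) k, mul_comm (m : ℝ) k']
      refine ⟨fun h => h.2, fun h2 => ⟨?_, h2⟩⟩
      have h4 : k * m ∈ S := by rw [hS]; push_cast; exact h2.1
      have h5 : k * m ≤ M := hM _ h4
      have h6 : 0 < k * m := by
        have := (h.sub h2.1).1
        have : (0 : ℝ) < ((k * m : ℕ) : ℝ) := by push_cast; linarith
        exact_mod_cast this
      have h7 : 0 < m := Nat.pos_of_mul_pos_left h6
      rw [mem_Icc]
      exact ⟨h7, by nlinarith⟩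
    have e : ∑ m ∈ Icc 1 M, w m k * starRingEnd ℂ (w m k')
        = ((b k * b k' : ℝ) : ℂ) * ∑ m ∈ T, ex (F (k * m) - F (k' * m)) := by
      rw [mul_sum, hTdef, sum_filter]
      refine sum_congr rfl fun m _ => ?_
      simp only [hw]
      by_cases h1 : m * k ∈ S
      · by_cases h2 : m * k' ∈ S
        · rw [if_pos h1, if_pos h2, if_pos ⟨h1, h2⟩, ex_sub, map_mul, Complex.conj_ofReal,
            mul_comm (k : ℝ) m, mul_comm (k' : ℝ) m]
          push_cast
          ring
        · simp [h2]
      · simp [h1]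
    rw [e, norm_mul, Complex.norm_real, Real.norm_eq_abs, abs_mul]
    have hbb : |b k| * |b k'| ≤ B ^ 2 := by
      rw [sq]
      exact mul_le_mul (hb k hkI.1) (hb k' hkI'.1) (abs_nonneg _) hB
    refine mul_le_mul hbb ?_ (norm_nonneg _) (sq_nonneg _)
    split_ifs with hkk
    · subst hkk
      have h1 : ‖∑ m ∈ T, ex (F (k * m) - F (k * m))‖ ≤ T.card := by
        refine (norm_sum_le _ _).trans ?_
        simp [norm_ex]
      have h2 : (T.card : ℝ) ≤ P / k + 1 := by
        apply card_le_of_diam _ (by positivity)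
        intro n hn n' hn' _
        have a1 := (h.sub ((hT n).1 hn).1).1
        have a2 := (h.sub ((hT n').1 hn').1).2
        rw [le_div_iff₀ hkpos]
        linarith
      have h3 : 1 ≤ P / k := by rw [le_div_iff₀ hkpos]; linarith
      have h4 : 2 * P * (1 / (k : ℝ)) = P / k + P / k := by ring
      linarith
    · have := h.diff_sum_symm hkI.2.1 hkI'.2.1 hkk hkk' hR hkP hkP' T hT
      rw [add_assoc] at this
      exact this
  have hKcard : ∀ k ∈ KK, (((KK.filter (fun k' => k / R = k' / R)).card : ℕ) : ℝ) ≤ R := by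
    intro k _
    have : KK.filter (fun k' => k / R = k' / R) ⊆ Ico (k / R * R) (k / R * R + R) := by
      intro k' hk'
      rw [mem_filter] at hk'
      rw [hk'.2, mem_Ico]
      have h1 := Nat.div_add_mod k' R
      have h3 := Nat.mod_lt k' hR
      rw [mul_comm] at h1
      omega
    have := card_le_card this
    rw [Nat.card_Ico, Nat.add_sub_cancel_left] at this
    exact_mod_cast this
  have step4 : ∑ p ∈ (Icc 1 M) ×ˢ (range (M + 1)), ‖Q p‖ ^ 2
      ≤ ∑ k ∈ KK, B ^ 2 * (2 * P * (1 / k) + R * (144 * (X * (1 / √k) + Y))) := by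
    have hn : ∑ p ∈ (Icc 1 M) ×ˢ (range (M + 1)), ‖Q p‖ ^ 2
        = ‖((∑ p ∈ (Icc 1 M) ×ˢ (range (M + 1)), ‖Q p‖ ^ 2 : ℝ) : ℂ)‖ := by
      rw [Complex.norm_real, Real.norm_eq_abs, abs_of_nonneg]
      exact sum_nonneg fun _ _ => by positivity
    rw [hn, step3]
    refine (norm_sum_le _ _).trans (sum_le_sum fun k hk => ?_)
    refine (norm_sum_le _ _).trans ?_
    have hk1 : 1 ≤ k := (mem_Icc.1 (mem_filter.1 hk).1).1
    have hkpos : (0 : ℝ) < k := by exact_mod_cast hk1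
    calc ∑ k' ∈ KK, ‖if k / R = k' / R then
          ∑ m ∈ Icc 1 M, w m k * starRingEnd ℂ (w m k') else 0‖
        ≤ ∑ k' ∈ KK, ((if k = k' then B ^ 2 * (2 * P * (1 / k)) else 0)
          + if k / R = k' / R then B ^ 2 * (144 * (X * (1 / √k) + Y)) else 0) := by
          refine sum_le_sum fun k' hk' => ?_
          by_cases h1 : k / R = k' / R
          · rw [if_pos h1, if_pos h1]
            refine (hcorr k hk k' hk' h1).trans ?_
            split_ifs
            · have : 0 ≤ B ^ 2 * (144 * (X * (1 / √k) + Y)) := by positivity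
              linarith
            · linarith
          · rw [if_neg h1, if_neg h1, norm_zero]
            split_ifs
            · positivity
            · simp
      _ = B ^ 2 * (2 * P * (1 / k)) + ((KK.filter (fun k' => k / R = k' / R)).card : ℕ)
            * (B ^ 2 * (144 * (X * (1 / √k) + Y))) := by
          rw [sum_add_distrib, sum_ite_eq, if_pos hk, ← sum_filter, sum_const, nsmul_eq_mul]
      _ ≤ B ^ 2 * (2 * P * (1 / k)) + R * (B ^ 2 * (144 * (X * (1 / √k) + Y))) := by
          have := hKcard k hk
          gcongr
      _ = _ := by ring
  refine step4.trans ?_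
  rw [← mul_sum]
  refine mul_le_mul_of_nonneg_left ?_ (sq_nonneg B)
  calc ∑ k ∈ KK, (2 * P * (1 / (k : ℝ)) + R * (144 * (X * (1 / √k) + Y)))
      ≤ ∑ k ∈ Icc 1 K, (2 * P * (1 / (k : ℝ)) + R * (144 * (X * (1 / √k) + Y))) :=
        sum_le_sum_of_subset_of_nonneg hKKI fun _ _ _ => by positivity
    _ = 2 * P * ∑ k ∈ Icc 1 K, 1 / (k : ℝ) + R * (144 * (X * ∑ k ∈ Icc 1 K, 1 / √(k : ℝ) + K * Y)) := by
        rw [sum_add_distrib, ← mul_sum, ← mul_sum, ← mul_sum, sum_add_distrib, ← mul_sum, sum_const,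
          Nat.card_Icc, Nat.add_sub_cancel, nsmul_eq_mul]
    _ ≤ _ := by
        have := sum_one_div_le K
        have := sum_one_div_sqrt_le K
        gcongr

end PrimeSquarefree

namespace PrimeSquarefree

open Finset
open ArithmeticFunction (vonMangoldt)

/-- The restriction of an arithmetic function to `n ≤ U`. -/
noncomputable def trunc (f : ArithmeticFunction ℝ) (U : ℕ) : ArithmeticFunction ℝ :=
  ⟨fun n => if n ≤ U then f n else 0, by simp⟩

theorem trunc_apply (f : ArithmeticFunction ℝ) (U n : ℕ) :
    trunc f U n = if n ≤ U then f n else 0 := rfl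

/-- Möbius function with real values. -/
noncomputable def muR : ArithmeticFunction ℝ :=
  ((ArithmeticFunction.moebius : ArithmeticFunction ℤ) : ArithmeticFunction ℝ)

/-- The constant function one with real values. -/
noncomputable def oneR : ArithmeticFunction ℝ :=
  ((ArithmeticFunction.zeta : ArithmeticFunction ℕ) : ArithmeticFunction ℝ)

theorem muR_mul_oneR : muR * oneR = 1 := ArithmeticFunction.coe_moebius_mul_coe_zeta

theorem oneR_apply {n : ℕ} (hn : n ≠ 0) : oneR n = 1 := by
  simp [oneR, ArithmeticFunction.natCoe_apply, hn]

theorem abs_muR_le (n : ℕ) : |muR n| ≤ 1 := by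
  have : |ArithmeticFunction.moebius n| ≤ 1 := ArithmeticFunction.abs_moebius_le_one
  simp only [muR, ArithmeticFunction.intCoe_apply]
  exact_mod_cast this

/-- **Vaughan's identity**. -/
theorem vaughan (U V : ℕ) :
    vonMangoldt - trunc vonMangoldt U = trunc muR V * ArithmeticFunction.log
      - trunc muR V * trunc vonMangoldt U * oneR
      + (muR - trunc muR V) * ((vonMangoldt - trunc vonMangoldt U) * oneR) := by
  have h1 : vonMangoldt * oneR = ArithmeticFunction.log := ArithmeticFunction.vonMangoldt_mul_zeta
  rw [← h1]
  linear_combination (-(vonMangoldt - trunc vonMangoldt U)) * muR_mul_oneR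

theorem abs_trunc_le (f : ArithmeticFunction ℝ) (U n : ℕ) : |trunc f U n| ≤ |f n| := by
  rw [trunc_apply]
  split_ifs
  · exact le_rfl
  · simp

theorem sub_apply_real (f g : ArithmeticFunction ℝ) (n : ℕ) : (f - g) n = f n - g n := by
  rw [sub_eq_add_neg, ArithmeticFunction.add_apply, sub_eq_add_neg]
  rfl

theorem abs_sub_trunc_le (f : ArithmeticFunction ℝ) (U n : ℕ) : |(f - trunc f U) n| ≤ |f n| := by
  rw [sub_apply_real, trunc_apply]
  split_ifs <;> simp

theorem abs_mul_vonMangoldt_le (f g : ArithmeticFunction ℝ) (hf : ∀ n, |f n| ≤ 1)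
    (hg : ∀ n, |g n| ≤ |vonMangoldt n|) (n : ℕ) : |(f * g) n| ≤ Real.log n := by
  rw [ArithmeticFunction.mul_apply]
  refine (abs_sum_le_sum_abs _ _).trans ?_
  rw [← ArithmeticFunction.vonMangoldt_sum,
    ← Nat.sum_divisorsAntidiagonal' (fun _ b => vonMangoldt b)]
  refine sum_le_sum fun p _ => ?_
  rw [abs_mul]
  have h1 := hg p.2
  rw [abs_of_nonneg ArithmeticFunction.vonMangoldt_nonneg] at h1
  calc |f p.1| * |g p.2| ≤ 1 * vonMangoldt p.2 :=
        mul_le_mul (hf _) h1 (abs_nonneg _) zero_le_one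
    _ = _ := one_mul _

theorem sum_mul_apply_eq (f g : ArithmeticFunction ℝ) (S : Finset ℕ) (M : ℕ)
    (hS : ∀ n ∈ S, 1 ≤ n ∧ n ≤ M) (z : ℕ → ℂ) :
    ∑ n ∈ S, (((f * g) n : ℝ) : ℂ) * z n
      = ∑ d ∈ Icc 1 M, ∑ l ∈ Icc 1 M with d * l ∈ S, ((f d * g l : ℝ) : ℂ) * z (d * l) := by
  have e1 : ∑ d ∈ Icc 1 M, ∑ l ∈ Icc 1 M with d * l ∈ S, ((f d * g l : ℝ) : ℂ) * z (d * l)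
      = ∑ p ∈ (Icc 1 M ×ˢ Icc 1 M).filter (fun p => p.1 * p.2 ∈ S),
          ((f p.1 * g p.2 : ℝ) : ℂ) * z (p.1 * p.2) := by
    rw [sum_filter, sum_product]
    refine sum_congr rfl fun d _ => ?_
    rw [sum_filter]
  rw [e1, ← sum_fiberwise_of_maps_to (t := S) (g := fun p : ℕ × ℕ => p.1 * p.2)
    (fun p hp => (mem_filter.1 hp).2)]
  refine sum_congr rfl fun n hn => ?_
  rw [ArithmeticFunction.mul_apply, Complex.ofReal_sum, sum_mul]
  have hn1 := hS n hn
  refine sum_congr ?_ ?_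
  · ext p
    simp only [Nat.mem_divisorsAntidiagonal, mem_filter, mem_product, mem_Icc]
    constructor
    · rintro ⟨h1, h2⟩
      have h3 : 0 < p.1 * p.2 := by omega
      have h4 : 0 < p.1 := Nat.pos_of_mul_pos_right h3
      have h5 : 0 < p.2 := Nat.pos_of_mul_pos_left h3
      refine ⟨⟨⟨⟨h4, ?_⟩, h5, ?_⟩, h1 ▸ hn⟩, h1⟩ <;> nlinarith
    · rintro ⟨_, h⟩
      exact ⟨h, by omega⟩
  · intro p hp
    rw [(mem_filter.1 hp).2]

theorem PhaseOn.vonMangoldt_sum {J : Set ℝ} {F F1 F2 H1 : ℝ → ℝ} {P lo hi : ℝ}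
    (h : PhaseOn J F F1 F2 H1 P lo hi) (S : Finset ℕ) (hS : ∀ n : ℕ, n ∈ S ↔ (n : ℝ) ∈ J)
    (hP : 2 ≤ P) {U V R : ℕ} {K : ℝ} (hU : 1 ≤ U) (hV : 2 ≤ V) (hUV : (U * V : ℝ) ≤ P) (hR : 1 ≤ R) (hRU : R ≤ U)
    (hK : K = 2 * P / V) (hRK : (R : ℝ) ≤ K) :
    ‖∑ n ∈ S, ((vonMangoldt n : ℝ) : ℂ) * ex (F n)‖
      ≤ 96 * Real.log (2 * P) * (U * V) * (hi / √lo + hi * (U * V) / P + P / √lo + 1)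
        + √(P / R * (Real.log (2 * P) + 6) * (Real.log (2 * P) ^ 2 *
          (2 * P * (1 + Real.log (2 * P))
            + R * (144 * ((hi * √R + P) / √lo * (2 * √K) + K * (hi * R / P + 1)))))) := by
  set L := Real.log (2 * P) with hL
  have hP0 : 0 < P := by linarith
  have hlo := h.lo_pos
  have hhi : 0 < hi := h.lo_pos.trans_le h.lo_le
  have hL1 : 1 ≤ L := by
    rw [hL, Real.le_log_iff_exp_le (by positivity)]
    linarith [Real.exp_one_lt_d9]
  set M := ⌊2 * P⌋₊ with hM
  have hMle : (M : ℝ) ≤ 2 * P := Nat.floor_le (by positivity)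
  have hSM : ∀ n ∈ S, 1 ≤ n ∧ n ≤ M := by
    intro n hn
    have := h.sub ((hS n).1 hn)
    refine ⟨?_, Nat.le_floor this.2⟩
    have : (1 : ℝ) < n := by linarith [this.1]
    exact_mod_cast this.le
  have hlogM : ∀ n ∈ Icc 1 M, Real.log n ≤ L := by
    intro n hn
    rw [mem_Icc] at hn
    apply Real.log_le_log (by exact_mod_cast hn.1)
    exact le_trans (by exact_mod_cast hn.2) hMle
  have hU1 : (1 : ℝ) ≤ U := by exact_mod_cast hU
  have hV2 : (2 : ℝ) ≤ V := by exact_mod_cast hV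
  have hUP : (U : ℝ) ≤ P := by nlinarith
  have hVP : (V : ℝ) ≤ P := by nlinarith
  set f1 := trunc muR V with hf1
  set f2 := f1 * trunc vonMangoldt U with hf2
  set f3 := muR - f1 with hf3
  set g3 := (vonMangoldt - trunc vonMangoldt U) * oneR with hg3
  have key : ∀ n ∈ S, vonMangoldt n = (f1 * ArithmeticFunction.log) n - (f2 * oneR) n + (f3 * g3) n := by
    intro n hn
    have h1 := congrArg (fun f => f n) (vaughan U V)
    simp only [sub_apply_real, ArithmeticFunction.add_apply] at h1
    have h2 : trunc vonMangoldt U n = 0 := by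
      rw [trunc_apply, if_neg]
      have := (h.sub ((hS n).1 hn)).1
      intro hc
      have : (n : ℝ) ≤ U := by exact_mod_cast hc
      linarith
    rw [h2, sub_zero] at h1
    exact h1
  have e : ∑ n ∈ S, ((vonMangoldt n : ℝ) : ℂ) * ex (F n)
      = (∑ n ∈ S, (((f1 * ArithmeticFunction.log) n : ℝ) : ℂ) * ex (F n)
        - ∑ n ∈ S, (((f2 * oneR) n : ℝ) : ℂ) * ex (F n))
        + ∑ n ∈ S, (((f3 * g3) n : ℝ) : ℂ) * ex (F n) := by
    rw [← sum_sub_distrib, ← sum_add_distrib]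
    refine sum_congr rfl fun n hn => ?_
    rw [key n hn]
    push_cast
    ring
  rw [e]
  refine (norm_add_le _ _).trans (add_le_add ((norm_sub_le _ _).trans ?_) ?_)
  · have b1 : ‖∑ n ∈ S, (((f1 * ArithmeticFunction.log) n : ℝ) : ℂ) * ex (F n)‖
        ≤ V * 1 * Real.log M * (48 * (hi / √lo + hi * V / P + P / √lo + 1)) := by
      rw [sum_mul_apply_eq _ _ S M hSM (fun n => ex (F n))]
      simp only [Nat.cast_mul, ArithmeticFunction.log_apply]
      apply h.typeI S hS M (fun n hn => (hSM n hn).2) (by positivity) hVP (by norm_num)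
        (fun d => f1 d) (fun l => Real.log l)
      · intro d _
        exact (abs_trunc_le _ _ _).trans (abs_muR_le d)
      · intro d hd
        rw [hf1, trunc_apply, if_neg]
        have : V < d := by exact_mod_cast hd
        omega
      · intro a b hab
        rcases Nat.eq_zero_or_pos a with rfl | ha
        · simpa using Real.log_natCast_nonneg b
        · exact Real.log_le_log (by exact_mod_cast ha) (by exact_mod_cast hab)
      · simp
    have b2 : ‖∑ n ∈ S, (((f2 * oneR) n : ℝ) : ℂ) * ex (F n)‖
        ≤ (U * V) * L * 1 * (48 * (hi / √lo + hi * (U * V) / P + P / √lo + 1)) := by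
      rw [sum_mul_apply_eq _ _ S M hSM (fun n => ex (F n))]
      have e2 : ∀ d ∈ Icc 1 M, ∑ l ∈ Icc 1 M with d * l ∈ S,
          ((f2 d * oneR l : ℝ) : ℂ) * ex (F ((d * l : ℕ) : ℝ))
          = ∑ l ∈ Icc 1 M with d * l ∈ S, ((f2 d * 1 : ℝ) : ℂ) * ex (F (d * l)) := by
        intro d _
        refine sum_congr rfl fun l hl => ?_
        have : 1 ≤ l := (mem_Icc.1 (mem_filter.1 hl).1).1
        rw [oneR_apply (by omega)]
        push_cast
        rfl
      rw [sum_congr rfl e2]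
      apply h.typeI S hS M (fun n hn => (hSM n hn).2) (by positivity) hUV (by linarith)
        (fun d => f2 d) (fun _ => 1)
      · intro d hd
        refine le_trans ?_ (hlogM d hd)
        exact abs_mul_vonMangoldt_le _ _ (fun n => (abs_trunc_le _ _ _).trans (abs_muR_le n))
          (abs_trunc_le _ _) d
      · intro d hd
        rw [hf2, ArithmeticFunction.mul_apply]
        refine sum_eq_zero fun p hp => ?_
        rw [hf1, trunc_apply, trunc_apply]
        by_cases h1 : p.1 ≤ V
        · by_cases h2 : p.2 ≤ U
          · exfalso
            have h3 : p.1 * p.2 ≤ V * U := Nat.mul_le_mul h1 h2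
            rw [(Nat.mem_divisorsAntidiagonal.1 hp).1] at h3
            have : (d : ℝ) ≤ V * U := by exact_mod_cast h3
            linarith
          · simp [h2]
        · simp [h1]
      · exact monotone_const
      · norm_num
    have hMpos : 1 ≤ M := Nat.le_floor (by push_cast; linarith)
    have b3 : (V : ℝ) * 1 * Real.log M * (48 * (hi / √lo + hi * V / P + P / √lo + 1))
        ≤ (U * V) * L * 1 * (48 * (hi / √lo + hi * (U * V) / P + P / √lo + 1)) := by
      have h1 : Real.log M ≤ L := hlogM M (mem_Icc.2 ⟨hMpos, le_rfl⟩)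
      have h2 : 0 ≤ Real.log M := Real.log_natCast_nonneg M
      have h3 : (V : ℝ) ≤ U * V := by nlinarith
      rw [mul_one, mul_one]
      gcongr
    calc _ ≤ (U * V) * L * 1 * (48 * (hi / √lo + hi * (U * V) / P + P / √lo + 1))
          + (U * V) * L * 1 * (48 * (hi / √lo + hi * (U * V) / P + P / √lo + 1)) :=
          add_le_add (b1.trans b3) b2
      _ = _ := by ring
  · apply Real.le_sqrt_of_sq_le
    rw [sum_mul_apply_eq _ _ S M hSM (fun n => ex (F n))]
    simp only [Nat.cast_mul]
    have hKpos : 0 < K := by rw [hK]; positivity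
    set K' := ⌊K⌋₊ with hK'
    have hK'le : (K' : ℝ) ≤ K := Nat.floor_le hKpos.le
    have hKP : K ≤ P := by
      rw [hK, div_le_iff₀ (by linarith)]
      nlinarith
    have := h.typeII S hS M (fun n hn => (hSM n hn).2) (A := 1) (B := L) (by linarith)
      (fun m => f3 m) (fun k => g3 k)
      (fun m _ => (abs_sub_trunc_le _ _ _).trans (abs_muR_le m))
      (by
        intro k hk
        refine le_trans ?_ (hlogM k hk)
        rw [hg3, mul_comm]
        refine abs_mul_vonMangoldt_le _ _ ?_ (abs_sub_trunc_le _ _) k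
        intro n
        rcases Nat.eq_zero_or_pos n with rfl | hn
        · simp
        · rw [oneR_apply (by omega)]; simp)
      R K' hR (Nat.le_floor hRK) (hK'le.trans hKP)
      (by
        intro k hk hne
        by_contra hlt
        apply hne
        rw [hg3, ArithmeticFunction.mul_apply]
        refine sum_eq_zero fun p hp => ?_
        have h1 : p.1 ≤ k := Nat.divisor_le (Nat.fst_mem_divisors_of_mem_antidiagonal hp)
        rw [sub_apply_real, trunc_apply, if_pos (by omega), sub_self, zero_mul])
      (by
        intro m hm k hk hm0 hk0 hmk
        apply Nat.le_floor
        have hVm : V ≤ m := by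
          by_contra hlt
          apply hm0
          rw [hf3, sub_apply_real, hf1, trunc_apply, if_pos (by omega), sub_self]
        have h1 := (h.sub ((hS _).1 hmk)).2
        push_cast at h1
        rw [hK, le_div_iff₀ (by linarith)]
        have : (V : ℝ) ≤ m := by exact_mod_cast hVm
        have h3 : (k : ℝ) * V ≤ k * m := by gcongr
        linarith)
    refine this.trans ?_
    rw [one_pow, one_mul]
    have hlogK : Real.log K' ≤ L := by
      rcases Nat.eq_zero_or_pos K' with h0 | h0
      · rw [h0]; simp; linarith
      · apply Real.log_le_log (by exact_mod_cast h0)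
        linarith
    have hK1 : 0 ≤ 1 + Real.log (K' : ℝ) := by
      have := Real.log_natCast_nonneg K'
      linarith
    gcongr

end PrimeSquarefree

namespace PrimeSquarefree

open Finset
open ArithmeticFunction (vonMangoldt)

set_option maxHeartbeats 2000000 in
theorem PhaseOn.vonMangoldt_sum_pow {J : Set ℝ} {F F1 F2 H1 : ℝ → ℝ} {P X T s : ℝ}
    (h : PhaseOn J F F1 F2 H1 P (X ^ (-0.0391 : ℝ) * T) T) (S : Finset ℕ)
    (hS : ∀ n : ℕ, n ∈ S ↔ (n : ℝ) ∈ J) (hX : 1 ≤ X) (hη : 10000 ≤ X ^ (0.0001 : ℝ))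
    (hL : Real.log (2 * P) + 6 ≤ X ^ (0.0001 : ℝ)) (hPX : P ≤ X) (hXP : X ^ (0.9999 : ℝ) ≤ P)
    (hT1 : X ^ (0.999 : ℝ) ≤ T) (hT2 : T ≤ X ^ (1.0385 : ℝ) * s ^ 2) (hs : 1 ≤ s)
    (hs2 : s ≤ X ^ (0.05 : ℝ)) :
    ‖∑ n ∈ S, ((vonMangoldt n : ℝ) : ℂ) * ex (F n)‖ ≤ X ^ (0.9614 : ℝ) * s := by
  have hX0 : 0 < X := by linarith
  have hm : ∀ a b : ℝ, X ^ a * X ^ b = X ^ (a + b) := fun a b => (Real.rpow_add hX0 a b).symm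
  have hle : ∀ {a b : ℝ}, a ≤ b → X ^ a ≤ X ^ b := fun hab =>
    Real.rpow_le_rpow_of_exponent_le hX hab
  have hpos : ∀ a : ℝ, 0 < X ^ a := fun a => Real.rpow_pos_of_pos hX0 a
  have hbump : ∀ {a b : ℝ} {C : ℝ}, C ≤ 10000 → a + 0.0001 ≤ b → C * X ^ a ≤ X ^ b := by
    intro a b C hC hab
    calc C * X ^ a ≤ X ^ (0.0001 : ℝ) * X ^ a := by
          have := hpos a
          gcongr
          linarith
      _ = X ^ (0.0001 + a) := hm _ _
      _ ≤ _ := hle (by linarith)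
  have hP2 : 2 ≤ P := by
    refine le_trans ?_ hXP
    refine le_trans ?_ (hle (show (0.0001 : ℝ) ≤ 0.9999 by norm_num))
    linarith
  have hP0 : 0 < P := by linarith
  have hT0 : 0 < T := lt_of_lt_of_le (hpos _) hT1
  have hs0 : 0 < s := by linarith
  set L := Real.log (2 * P) with hLdef
  have hL0 : 0 ≤ L := Real.log_nonneg (by linarith)
  set lo := X ^ (-0.0391 : ℝ) * T with hlo
  have hlo0 : 0 < lo := h.lo_pos
  have hslo : √lo = X ^ (-0.01955 : ℝ) * √T := by
    rw [hlo, Real.sqrt_mul (hpos _).le]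
    congr 1
    rw [Real.sqrt_eq_rpow, ← Real.rpow_mul hX0.le]
    norm_num
  have hsT0 : 0 < √T := Real.sqrt_pos.2 hT0
  have hsT : √T * √T = T := Real.mul_self_sqrt hT0.le
  have hsT1 : √T ≤ X ^ (0.51925 : ℝ) * s := by
    rw [Real.sqrt_le_left (by have := hpos 0.51925; positivity), mul_pow, sq (X ^ (0.51925 : ℝ)),
      hm]
    norm_num at hT2 ⊢
    exact hT2
  have hsT2 : X ^ (0.4995 : ℝ) ≤ √T := by
    apply Real.le_sqrt_of_sq_le
    rw [sq, hm]
    norm_num at hT1 ⊢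
    exact hT1
  have hA : T / √lo ≤ X ^ (0.5388 : ℝ) * s := by
    rw [hslo, div_le_iff₀ (by have := hpos (-0.01955); positivity)]
    calc T = √T * √T := hsT.symm
      _ ≤ (X ^ (0.51925 : ℝ) * s) * √T := by gcongr
      _ = (X ^ (0.5388 : ℝ) * X ^ (-0.01955 : ℝ)) * s * √T := by rw [hm]; norm_num
      _ = _ := by ring
  have hB : P / √lo ≤ X ^ (0.5201 : ℝ) := by
    rw [hslo, div_le_iff₀ (by have := hpos (-0.01955); positivity)]
    calc P ≤ X := hPX
      _ = X ^ (1 : ℝ) := (Real.rpow_one X).symm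
      _ ≤ X ^ (0.5201 : ℝ) * (X ^ (-0.01955 : ℝ) * X ^ (0.4995 : ℝ)) := by
        rw [hm, hm]; exact hle (by norm_num)
      _ ≤ _ := by
        have := hpos 0.5201
        have := hpos (-0.01955)
        gcongr
  -- parameters
  have hfl : ∀ a : ℝ, 0.0001 ≤ a → 2 ≤ X ^ a := fun a ha =>
    le_trans (by linarith) (hle ha)
  set U := ⌊X ^ (0.09 : ℝ)⌋₊ with hU
  set V := ⌈X ^ (0.32 : ℝ)⌉₊ with hV
  set R := ⌊X ^ (0.078 : ℝ)⌋₊ with hR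
  have hU1 : 1 ≤ U := Nat.le_floor (by have := hfl 0.09 (by norm_num); push_cast; linarith)
  have hR1 : 1 ≤ R := Nat.le_floor (by have := hfl 0.078 (by norm_num); push_cast; linarith)
  have hUle : (U : ℝ) ≤ X ^ (0.09 : ℝ) := Nat.floor_le (hpos _).le
  have hRle : (R : ℝ) ≤ X ^ (0.078 : ℝ) := Nat.floor_le (hpos _).le
  have hRge : X ^ (0.078 : ℝ) ≤ 2 * R := by
    have h1 : X ^ (0.078 : ℝ) < R + 1 := Nat.lt_floor_add_one _
    have h2 : (1 : ℝ) ≤ R := by exact_mod_cast hR1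
    linarith
  have hVge : X ^ (0.32 : ℝ) ≤ V := Nat.le_ceil _
  have hVle : (V : ℝ) ≤ 2 * X ^ (0.32 : ℝ) := by
    have h1 : (V : ℝ) < X ^ (0.32 : ℝ) + 1 := Nat.ceil_lt_add_one (hpos 0.32).le
    have h2 := hfl 0.32 (by norm_num)
    linarith
  have hV2 : 2 ≤ V := by
    have : (2 : ℝ) ≤ V := (hfl 0.32 (by norm_num)).trans hVge
    exact_mod_cast this
  have hV0 : (0 : ℝ) < V := by exact_mod_cast (by omega : 0 < V)
  have hR0 : (0 : ℝ) < R := by exact_mod_cast hR1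
  have hUV : (U * V : ℝ) ≤ X ^ (0.4101 : ℝ) := by
    calc (U * V : ℝ) ≤ X ^ (0.09 : ℝ) * (2 * X ^ (0.32 : ℝ)) := by
          gcongr
      _ = 2 * (X ^ (0.09 : ℝ) * X ^ (0.32 : ℝ)) := by ring
      _ ≤ _ := by rw [hm]; exact hbump (by norm_num) (by norm_num)
  set K := 2 * P / V with hK
  have hK0 : 0 < K := by positivity
  have hKle : K ≤ X ^ (0.6801 : ℝ) := by
    rw [hK, div_le_iff₀ hV0]
    calc 2 * P ≤ 2 * X ^ (1 : ℝ) := by rw [Real.rpow_one]; linarith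
      _ ≤ X ^ (0.6801 + 0.32 : ℝ) := hbump (by norm_num) (by norm_num)
      _ = X ^ (0.6801 : ℝ) * X ^ (0.32 : ℝ) := (hm _ _).symm
      _ ≤ _ := by have := hpos 0.6801; gcongr
  have hRK : (R : ℝ) ≤ K := by
    rw [hK, le_div_iff₀ hV0]
    calc (R : ℝ) * V ≤ X ^ (0.078 : ℝ) * (2 * X ^ (0.32 : ℝ)) := by gcongr
      _ = 2 * (X ^ (0.078 : ℝ) * X ^ (0.32 : ℝ)) := by ring
      _ ≤ 2 * X ^ (0.9999 : ℝ) := by rw [hm]; gcongr; norm_num [hX]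
      _ ≤ _ := by linarith
  have hRU : R ≤ U := Nat.floor_le_floor (hle (by norm_num))
  have main := h.vonMangoldt_sum S hS hP2 hU1 hV2
    (hUV.trans ((hle (by norm_num)).trans hXP)) hR1 hRU hK hRK
  refine main.trans ?_
  have hsX : ∀ a : ℝ, X ^ a ≤ X ^ a * s := fun a => le_mul_of_one_le_right (hpos a).le hs
  -- first term
  have hTUV : T * (U * V) / P ≤ X ^ (0.54 : ℝ) * s := by
    rw [div_le_iff₀ hP0]
    calc T * (U * V) ≤ (X ^ (1.0385 : ℝ) * s ^ 2) * X ^ (0.4101 : ℝ) := by gcongr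
      _ = (X ^ (1.0385 : ℝ) * X ^ (0.4101 : ℝ)) * s * s := by ring
      _ ≤ (X ^ (1.0385 : ℝ) * X ^ (0.4101 : ℝ)) * s * X ^ (0.05 : ℝ) := by
        have := hpos 1.0385
        have := hpos 0.4101
        gcongr
      _ = (X ^ (1.0385 : ℝ) * X ^ (0.4101 : ℝ) * X ^ (0.05 : ℝ)) * s := by ring
      _ ≤ (X ^ (0.54 : ℝ) * X ^ (0.9999 : ℝ)) * s := by
        rw [hm, hm, hm]
        exact mul_le_mul_of_nonneg_right (hle (by norm_num)) hs0.le
      _ ≤ (X ^ (0.54 : ℝ) * P) * s := by have := hpos 0.54; gcongr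
      _ = _ := by ring
  have t1 : 96 * L * (U * V) * (T / √lo + T * (U * V) / P + P / √lo + 1)
      ≤ X ^ (0.9605 : ℝ) * s := by
    have a1 : T / √lo ≤ X ^ (0.54 : ℝ) * s :=
      hA.trans (mul_le_mul_of_nonneg_right (hle (by norm_num)) hs0.le)
    have a2 : P / √lo ≤ X ^ (0.54 : ℝ) * s := hB.trans ((hle (by norm_num)).trans (hsX _))
    have a3 : (1 : ℝ) ≤ X ^ (0.54 : ℝ) * s := by
      refine le_trans ?_ (hsX _)
      linarith [hfl 0.54 (by norm_num)]
    calc 96 * L * (U * V) * (T / √lo + T * (U * V) / P + P / √lo + 1)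
        ≤ 96 * X ^ (0.0001 : ℝ) * X ^ (0.4101 : ℝ) * (4 * (X ^ (0.54 : ℝ) * s)) := by
          gcongr
          · linarith only [hL]
          · linarith only [a1, a2, a3, hTUV]
      _ = (384 * (X ^ (0.0001 : ℝ) * X ^ (0.4101 : ℝ) * X ^ (0.54 : ℝ))) * s := by ring
      _ ≤ _ := by
        rw [hm, hm]
        exact mul_le_mul_of_nonneg_right (hbump (by norm_num) (by norm_num)) hs0.le
  -- second term
  have hsR : √(R : ℝ) ≤ X ^ (0.039 : ℝ) := by
    rw [Real.sqrt_le_left (hpos _).le, sq, hm]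
    norm_num at hRle ⊢
    exact hRle
  have hsK : √K ≤ X ^ (0.34005 : ℝ) := by
    rw [Real.sqrt_le_left (hpos _).le, sq, hm]
    norm_num at hKle ⊢
    exact hKle
  have hs1 : s ≤ s ^ 2 := le_self_pow₀ hs two_ne_zero
  have hs21 : 1 ≤ s ^ 2 := one_le_pow₀ hs
  have b1 : (T * √R + P) / √lo * (2 * √K) ≤ 4 * X ^ (0.918 : ℝ) * s ^ 2 := by
    have e : (T * √R + P) / √lo * (2 * √K) = 2 * ((T / √lo) * √R * √K) + 2 * (P / √lo * √K) := by
      ring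
    rw [e]
    have c1 : (T / √lo) * √R * √K ≤ X ^ (0.918 : ℝ) * s ^ 2 := by
      calc (T / √lo) * √R * √K
          ≤ (X ^ (0.5388 : ℝ) * s) * X ^ (0.039 : ℝ) * X ^ (0.34005 : ℝ) := by
            have := hpos 0.5388
            have := hpos 0.039
            gcongr
        _ = (X ^ (0.5388 : ℝ) * X ^ (0.039 : ℝ) * X ^ (0.34005 : ℝ)) * s := by ring
        _ ≤ _ := by
          rw [hm, hm]
          exact mul_le_mul (hle (by norm_num)) hs1 hs0.le (hpos _).le
    have c2 : P / √lo * √K ≤ X ^ (0.918 : ℝ) * s ^ 2 := by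
      calc P / √lo * √K ≤ X ^ (0.5201 : ℝ) * X ^ (0.34005 : ℝ) := by
            have := hpos 0.5201
            gcongr
        _ ≤ X ^ (0.918 : ℝ) := by rw [hm]; exact hle (by norm_num)
        _ ≤ _ := le_mul_of_one_le_right (hpos _).le hs21
    linarith
  have b2 : K * (T * R / P + 1) ≤ 2 * X ^ (0.918 : ℝ) * s ^ 2 := by
    have c1 : K * (T * R / P) ≤ X ^ (0.918 : ℝ) * s ^ 2 := by
      rw [← mul_div_assoc, div_le_iff₀ hP0]
      calc K * (T * R) ≤ X ^ (0.6801 : ℝ) * ((X ^ (1.0385 : ℝ) * s ^ 2) * X ^ (0.078 : ℝ)) := by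
            have := hpos 0.6801
            have := hpos 1.0385
            gcongr
        _ = (X ^ (0.6801 : ℝ) * X ^ (1.0385 : ℝ) * X ^ (0.078 : ℝ)) * s ^ 2 := by ring
        _ ≤ (X ^ (0.918 : ℝ) * X ^ (0.9999 : ℝ)) * s ^ 2 := by
          rw [hm, hm, hm]
          exact mul_le_mul_of_nonneg_right (hle (by norm_num)) (by positivity)
        _ ≤ (X ^ (0.918 : ℝ) * P) * s ^ 2 := by have := hpos 0.918; gcongr
        _ = _ := by ring
    have c2 : K ≤ X ^ (0.918 : ℝ) * s ^ 2 :=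
      hKle.trans ((hle (by norm_num)).trans (le_mul_of_one_le_right (hpos _).le hs21))
    linarith
  have b3 : 2 * P * (1 + L) + R * (144 * ((T * √R + P) / √lo * (2 * √K) + K * (T * R / P + 1)))
      ≤ X ^ (1.0002 : ℝ) * s ^ 2 := by
    have c1 : 2 * P * (1 + L) ≤ 2 * X ^ (1.0001 : ℝ) * s ^ 2 := by
      calc 2 * P * (1 + L) ≤ 2 * X ^ (1 : ℝ) * X ^ (0.0001 : ℝ) := by
            rw [Real.rpow_one]
            gcongr
            linarith
        _ = 2 * X ^ (1.0001 : ℝ) := by rw [mul_assoc, hm]; norm_num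
        _ ≤ _ := le_mul_of_one_le_right (by have := hpos 1.0001; positivity) hs21
    have c2 : R * (144 * ((T * √R + P) / √lo * (2 * √K) + K * (T * R / P + 1)))
        ≤ 864 * X ^ (1.0001 : ℝ) * s ^ 2 := by
      calc _ ≤ X ^ (0.078 : ℝ) * (144 * (4 * X ^ (0.918 : ℝ) * s ^ 2 + 2 * X ^ (0.918 : ℝ) * s ^ 2)) := by
            have := hpos 0.078
            gcongr
        _ = 864 * (X ^ (0.078 : ℝ) * X ^ (0.918 : ℝ)) * s ^ 2 := by ring
        _ ≤ _ := by
          rw [hm]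
          have := hle (show (0.078 + 0.918 : ℝ) ≤ 1.0001 by norm_num)
          gcongr
    calc _ ≤ 866 * X ^ (1.0001 : ℝ) * s ^ 2 := by linarith
      _ ≤ _ := mul_le_mul_of_nonneg_right (hbump (by norm_num) (by norm_num)) (by positivity)
  have t2 : √(P / R * (L + 6) * (L ^ 2 * (2 * P * (1 + L)
      + R * (144 * ((T * √R + P) / √lo * (2 * √K) + K * (T * R / P + 1)))))) ≤ X ^ (0.9613 : ℝ) * s := by
    rw [Real.sqrt_le_left (by have := hpos 0.9613; positivity)]
    have c1 : P / R ≤ X ^ (0.9221 : ℝ) := by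
      rw [div_le_iff₀ hR0]
      have : 2 * X ^ (1 : ℝ) ≤ X ^ (0.9221 : ℝ) * X ^ (0.078 : ℝ) := by
        rw [hm]; exact hbump (by norm_num) (by norm_num)
      rw [Real.rpow_one] at this
      have h2 : X ^ (0.9221 : ℝ) * X ^ (0.078 : ℝ) ≤ X ^ (0.9221 : ℝ) * (2 * R) := by
        have := hpos 0.9221
        gcongr
      linarith
    have c2 : L ^ 2 ≤ X ^ (0.0002 : ℝ) := by
      calc L ^ 2 ≤ (X ^ (0.0001 : ℝ)) ^ 2 := by gcongr; linarith
        _ = _ := by rw [sq, hm]; norm_num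
    calc _ ≤ X ^ (0.9221 : ℝ) * X ^ (0.0001 : ℝ) * (X ^ (0.0002 : ℝ) * (X ^ (1.0002 : ℝ) * s ^ 2)) := by
          have := hpos 0.9221
          have := hpos 0.0002
          gcongr
      _ = (X ^ (0.9221 : ℝ) * X ^ (0.0001 : ℝ) * X ^ (0.0002 : ℝ) * X ^ (1.0002 : ℝ)) * s ^ 2 := by
        ring
      _ ≤ (X ^ (0.9613 : ℝ) * X ^ (0.9613 : ℝ)) * s ^ 2 := by
        rw [hm, hm, hm, hm]
        exact mul_le_mul_of_nonneg_right (hle (by norm_num)) (by positivity)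
      _ = _ := by ring
  calc _ ≤ X ^ (0.9605 : ℝ) * s + X ^ (0.9613 : ℝ) * s := add_le_add t1 t2
    _ ≤ X ^ (0.9613 : ℝ) * s + X ^ (0.9613 : ℝ) * s := by
      have := hle (show (0.9605 : ℝ) ≤ 0.9613 by norm_num)
      gcongr
    _ = (2 * X ^ (0.9613 : ℝ)) * s := by ring
    _ ≤ _ := mul_le_mul_of_nonneg_right (hbump (by norm_num) (by norm_num)) hs0.le

end PrimeSquarefree

namespace PrimeSquarefree

open Finset
open ArithmeticFunction (vonMangoldt)

/-- The curve `w ↦ w ^ (-a)` near `1`, used in the form `(1 - v) ^ (-a)`. -/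
theorem one_sub_rpow_neg_bounds {a v : ℝ} (ha : 0 ≤ a) (ha3 : a ≤ 3) (hv : 0 ≤ v)
    (hv4 : v ≤ 1 / 4) : 1 ≤ (1 - v) ^ (-a) ∧ (1 - v) ^ (-a) ≤ 64 / 27 := by
  have h1 : (0 : ℝ) < 1 - v := by linarith
  refine ⟨Real.one_le_rpow_of_pos_of_le_one_of_nonpos h1 (by linarith) (by linarith), ?_⟩
  calc (1 - v) ^ (-a) ≤ (1 - v) ^ (-3 : ℝ) :=
        Real.rpow_le_rpow_of_exponent_ge h1 (by linarith) (by linarith)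
    _ ≤ (3 / 4 : ℝ) ^ (-3 : ℝ) :=
        Real.rpow_le_rpow_of_nonpos (by norm_num) (by linarith) (by norm_num)
    _ = 64 / 27 := by
        rw [show (-3 : ℝ) = ((-3 : ℤ) : ℝ) by norm_num, Real.rpow_intCast]
        norm_num

theorem sub_le_one_sub_rpow_neg_sub {a v v' : ℝ} (ha : 1 ≤ a) (hv : 0 ≤ v) (hvv : v ≤ v')
    (hv4 : v' ≤ 1 / 4) : v' - v ≤ (1 - v') ^ (-a) - (1 - v) ^ (-a) := by
  have h1 : (0 : ℝ) < 1 - v := by linarith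
  have h2 : (0 : ℝ) < 1 - v' := by linarith
  have e : (1 - v') ^ (-a) = (1 - v) ^ (-a) * ((1 - v) / (1 - v')) ^ a := by
    rw [Real.div_rpow h1.le h2.le, Real.rpow_neg h1.le, Real.rpow_neg h2.le]
    have := (Real.rpow_pos_of_pos h1 a).ne'
    have := (Real.rpow_pos_of_pos h2 a).ne'
    field_simp
  have hq : 1 ≤ (1 - v) / (1 - v') := by rw [one_le_div h2]; linarith
  have hqa : (1 - v) / (1 - v') ≤ ((1 - v) / (1 - v')) ^ a := by
    calc (1 - v) / (1 - v') = ((1 - v) / (1 - v')) ^ (1 : ℝ) := (Real.rpow_one _).symm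
      _ ≤ _ := Real.rpow_le_rpow_of_exponent_le hq ha
  have hx : 1 ≤ (1 - v) ^ (-a) :=
    Real.one_le_rpow_of_pos_of_le_one_of_nonpos h1 (by linarith) (by linarith)
  have hd : v' - v ≤ (1 - v) / (1 - v') - 1 := by
    rw [div_sub_one h2.ne', le_div_iff₀ h2]
    nlinarith
  rw [e]
  nlinarith

/-- The first weight `E₁` (in normalised form) in the second derivative of the phase. -/
noncomputable def eOne (γ v : ℝ) : ℝ := (1 - v) ^ (γ - 2)

/-- The second weight `E₂` (in normalised form), for the derivative of `y ^ 2` times the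
second derivative of the phase. -/
noncomputable def eTwo (γ v : ℝ) : ℝ := (1 - v) ^ (γ - 3) * (1 + (1 - γ) * v)

theorem eOne_bounds {γ v : ℝ} (hγ0 : 0 ≤ γ) (hγ1 : γ ≤ 1) (hv : 0 ≤ v) (hv4 : v ≤ 1 / 4) :
    1 ≤ eOne γ v ∧ eOne γ v ≤ 3 := by
  have h := one_sub_rpow_neg_bounds (a := 2 - γ) (by linarith) (by linarith) hv hv4
  rw [neg_sub] at h
  exact ⟨h.1, h.2.trans (by norm_num)⟩

theorem eTwo_bounds {γ v : ℝ} (hγ0 : 0 ≤ γ) (hγ1 : γ ≤ 1) (hv : 0 ≤ v) (hv4 : v ≤ 1 / 4) :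
    1 ≤ eTwo γ v ∧ eTwo γ v ≤ 3 := by
  have h := one_sub_rpow_neg_bounds (a := 3 - γ) (by linarith) (by linarith) hv hv4
  rw [neg_sub] at h
  have h1 : 0 ≤ (1 - γ) * v := mul_nonneg (by linarith) hv
  have h2 : (1 - γ) * v ≤ 1 / 4 := by nlinarith
  unfold eTwo
  constructor <;> nlinarith

theorem eOne_sub {γ v v' : ℝ} (hγ1 : γ ≤ 1) (hv : 0 ≤ v) (hvv : v ≤ v')
    (hv4 : v' ≤ 1 / 4) : v' - v ≤ eOne γ v' - eOne γ v := by
  have h := sub_le_one_sub_rpow_neg_sub (a := 2 - γ) (by linarith) hv hvv hv4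
  rwa [neg_sub] at h

theorem eTwo_sub {γ v v' : ℝ} (hγ0 : 0 ≤ γ) (hγ1 : γ ≤ 1) (hv : 0 ≤ v) (hvv : v ≤ v')
    (hv4 : v' ≤ 1 / 4) : v' - v ≤ eTwo γ v' - eTwo γ v := by
  have h := sub_le_one_sub_rpow_neg_sub (a := 3 - γ) (by linarith) hv hvv hv4
  have h0 := one_sub_rpow_neg_bounds (a := 3 - γ) (by linarith) (by linarith) (hv.trans hvv) hv4
  rw [neg_sub] at h h0
  have h1 : 0 ≤ (1 - γ) * v := mul_nonneg (by linarith) hv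
  have h2 : (1 - γ) * v ≤ (1 - γ) * v' := by nlinarith
  unfold eTwo
  nlinarith

/-- The phase `j y ^ c + t Z (1 - y ^ c / Z) ^ (1 / c)`. -/
noncomputable def phase (c Z j t y : ℝ) : ℝ := j * y ^ c + t * Z * (1 - y ^ c / Z) ^ (1 / c)

noncomputable def phase1 (c Z j t y : ℝ) : ℝ :=
  y ^ (c - 1) * (j * c - t * (1 - y ^ c / Z) ^ (1 / c - 1))

noncomputable def gOne (c Z j t y : ℝ) : ℝ := j * c - t * eOne (1 / c) (y ^ c / Z)

noncomputable def gTwo (c Z j t y : ℝ) : ℝ := j * c - t * eTwo (1 / c) (y ^ c / Z)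

noncomputable def phase2 (c Z j t y : ℝ) : ℝ := (c - 1) * y ^ (c - 2) * gOne c Z j t y

noncomputable def phaseH (c Z j t y : ℝ) : ℝ := (c - 1) * c * y ^ (c - 1) * gTwo c Z j t y

section Derivatives

variable {c Z y : ℝ}

theorem hasDerivAt_one_sub_rpow (a : ℝ) (hy : 0 < y) (h : 0 < 1 - y ^ c / Z) :
    HasDerivAt (fun x : ℝ => (1 - x ^ c / Z) ^ a)
      (-(c * y ^ (c - 1) / Z) * a * (1 - y ^ c / Z) ^ (a - 1)) y := by
  have h1 : HasDerivAt (fun x : ℝ => 1 - x ^ c / Z) (-(c * y ^ (c - 1) / Z)) y :=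
    ((Real.hasDerivAt_rpow_const (Or.inl hy.ne')).div_const Z).const_sub 1
  exact h1.rpow_const (Or.inl h.ne')

theorem hasDerivAt_phase (j t : ℝ) (hc : 1 < c) (hZ : 0 < Z) (hy : 0 < y)
    (h : 0 < 1 - y ^ c / Z) : HasDerivAt (phase c Z j t) (phase1 c Z j t y) y := by
  have h1 := ((Real.hasDerivAt_rpow_const (p := c) (Or.inl hy.ne')).const_mul j).add
    ((hasDerivAt_one_sub_rpow (1 / c) hy h).const_mul (t * Z))
  refine h1.congr_deriv ?_
  unfold phase1
  have : c ≠ 0 := by linarith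
  field_simp
  ring

theorem hasDerivAt_phase1 (j t : ℝ) (hc : 1 < c) (hZ : 0 < Z) (hy : 0 < y)
    (h : 0 < 1 - y ^ c / Z) : HasDerivAt (phase1 c Z j t) (phase2 c Z j t y) y := by
  have h1 := (Real.hasDerivAt_rpow_const (p := c - 1) (Or.inl hy.ne')).mul
    (((hasDerivAt_one_sub_rpow (1 / c - 1) hy h).const_mul t).const_sub (j * c))
  refine h1.congr_deriv ?_
  unfold phase2 gOne eOne
  have hc0 : c ≠ 0 := by linarith
  have e1 : (1 - y ^ c / Z) ^ (1 / c - 1) = (1 - y ^ c / Z) ^ (1 / c - 2) * (1 - y ^ c / Z) := by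
    rw [← Real.rpow_add_one h.ne']; congr 1; ring
  have e2 : (1 - y ^ c / Z) ^ (1 / c - 1 - 1) = (1 - y ^ c / Z) ^ (1 / c - 2) := by
    congr 1; ring
  have e3 : y ^ (c - 1) = y ^ (c - 2) * y := by
    rw [← Real.rpow_add_one hy.ne']; congr 1; ring
  have e4 : y ^ (c - 1 - 1) = y ^ (c - 2) := by congr 1; ring
  have e5 : y ^ c = y ^ (c - 2) * y * y := by
    rw [← Real.rpow_add_one hy.ne', ← Real.rpow_add_one hy.ne']; congr 1; ring
  rw [e1, e2, e3, e4]
  generalize (1 - y ^ c / Z) ^ (1 / c - 2) = A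
  rw [e5]
  generalize y ^ (c - 2) = B
  field_simp
  ring

theorem sq_mul_phase2 (j t : ℝ) (hy : 0 < y) :
    y ^ 2 * phase2 c Z j t y = (c - 1) * y ^ c * gOne c Z j t y := by
  have e5 : y ^ c = y ^ (c - 2) * y * y := by
    rw [← Real.rpow_add_one hy.ne', ← Real.rpow_add_one hy.ne']; congr 1; ring
  unfold phase2
  rw [e5]
  ring

theorem mul_phaseH (j t : ℝ) (hy : 0 < y) :
    y * phaseH c Z j t y = (c - 1) * c * y ^ c * gTwo c Z j t y := by
  have e5 : y ^ c = y ^ (c - 1) * y := by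
    rw [← Real.rpow_add_one hy.ne']; congr 1; ring
  unfold phaseH
  rw [e5]
  ring

theorem hasDerivAt_sq_mul_phase2 (j t : ℝ) (hc : 1 < c) (hZ : 0 < Z) (hy : 0 < y)
    (h : 0 < 1 - y ^ c / Z) :
    HasDerivAt (fun x => x ^ 2 * phase2 c Z j t x) (phaseH c Z j t y) y := by
  have h1 := ((Real.hasDerivAt_rpow_const (p := c) (Or.inl hy.ne')).const_mul (c - 1)).mul
    (((hasDerivAt_one_sub_rpow (1 / c - 2) hy h).const_mul t).const_sub (j * c))
  have h2 : HasDerivAt (fun x => (c - 1) * x ^ c * gOne c Z j t x) (phaseH c Z j t y) y := by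
    refine h1.congr_deriv ?_
    unfold phaseH gTwo eTwo
    have hc0 : c ≠ 0 := by linarith
    have e1 : (1 - y ^ c / Z) ^ (1 / c - 2)
        = (1 - y ^ c / Z) ^ (1 / c - 3) * (1 - y ^ c / Z) := by
      rw [← Real.rpow_add_one h.ne']; congr 1; ring
    have e2 : (1 - y ^ c / Z) ^ (1 / c - 2 - 1) = (1 - y ^ c / Z) ^ (1 / c - 3) := by
      congr 1; ring
    have e5 : y ^ c = y ^ (c - 1) * y := by
      rw [← Real.rpow_add_one hy.ne']; congr 1; ring
    rw [e1, e2]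
    generalize (1 - y ^ c / Z) ^ (1 / c - 3) = A
    rw [e5]
    generalize y ^ (c - 1) = B
    field_simp
    ring
  refine h2.congr_of_eventuallyEq ?_
  filter_upwards [lt_mem_nhds hy] with x hx using sq_mul_phase2 j t hx

end Derivatives

end PrimeSquarefree

namespace PrimeSquarefree

open Finset
open ArithmeticFunction (vonMangoldt)

/-- Functions on `[0, 1/4]` with values in `[1, 3]` and all difference quotients at least `1`. -/
structure SteepWeight (e : ℝ → ℝ) : Prop where
  one_le : ∀ v, 0 ≤ v → v ≤ 1 / 4 → 1 ≤ e v
  le_three : ∀ v, 0 ≤ v → v ≤ 1 / 4 → e v ≤ 3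
  sub_le : ∀ v v', 0 ≤ v → v ≤ v' → v' ≤ 1 / 4 → v' - v ≤ e v' - e v

theorem steepWeight_eOne {c : ℝ} (hc : 1 < c) : SteepWeight (eOne (1 / c)) := by
  have h0 : 0 ≤ 1 / c := by positivity
  have h1 : 1 / c ≤ 1 := by rw [div_le_one (by linarith)]; exact hc.le
  exact ⟨fun v a b => (eOne_bounds h0 h1 a b).1, fun v a b => (eOne_bounds h0 h1 a b).2,
    fun v v' a b d => eOne_sub h1 a b d⟩

theorem steepWeight_eTwo {c : ℝ} (hc : 1 < c) : SteepWeight (eTwo (1 / c)) := by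
  have h0 : 0 ≤ 1 / c := by positivity
  have h1 : 1 / c ≤ 1 := by rw [div_le_one (by linarith)]; exact hc.le
  exact ⟨fun v a b => (eTwo_bounds h0 h1 a b).1, fun v a b => (eTwo_bounds h0 h1 a b).2,
    fun v v' a b d => eTwo_sub h0 h1 a b d⟩

theorem rpow_div_bounds {c Z P y : ℝ} (hc : 1 < c) (hP : 1 ≤ P) (hZ : 4 * (2 * P) ^ c ≤ Z)
    (hy : y ∈ Set.Ioc P (2 * P)) : 0 ≤ y ^ c / Z ∧ y ^ c / Z ≤ 1 / 4 := by
  have h2 : 0 < (2 * P) ^ c := Real.rpow_pos_of_pos (by linarith) _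
  have hZ0 : 0 < Z := by linarith
  have hy0 : 0 < y := by linarith [hy.1]
  have h3 : y ^ c ≤ (2 * P) ^ c := Real.rpow_le_rpow hy0.le hy.2 (by linarith)
  refine ⟨by positivity, ?_⟩
  rw [div_le_iff₀ hZ0]
  linarith

theorem rpow_mul_sub_le {c x y : ℝ} (hc : 1 ≤ c) (hx : 0 < x) (hxy : x ≤ y) :
    x ^ (c - 1) * (y - x) ≤ y ^ c - x ^ c := by
  have hy : 0 < y := by linarith
  have e1 : x ^ c = x ^ (c - 1) * x := by rw [← Real.rpow_add_one hx.ne']; congr 1; ring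
  have e2 : y ^ c = y ^ (c - 1) * y := by rw [← Real.rpow_add_one hy.ne']; congr 1; ring
  have h := Real.rpow_le_rpow hx.le hxy (by linarith : 0 ≤ c - 1)
  rw [e1, e2]
  nlinarith

theorem SteepWeight.ordConnected_cell {e : ℝ → ℝ} (he : SteepWeight e) {c Z P : ℝ} (hc : 1 < c)
    (hP : 1 ≤ P) (hZ : 4 * (2 * P) ^ c ≤ Z) (b t a s : ℝ) :
    {y : ℝ | y ∈ Set.Ioc P (2 * P) ∧ a ≤ s * (b - t * e (y ^ c / Z))}.OrdConnected := by
  have hZ0 : 0 < Z := by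
    have h2 : 0 < (2 * P) ^ c := Real.rpow_pos_of_pos (by linarith) _
    linarith
  refine ⟨fun x hx z hz y hy => ?_⟩
  have hyI : y ∈ Set.Ioc P (2 * P) := ⟨hx.1.1.trans_le hy.1, hy.2.trans hz.1.2⟩
  refine ⟨hyI, ?_⟩
  have hx0 : 0 < x := by linarith [hx.1.1]
  have mono : ∀ {p q : ℝ}, p ∈ Set.Ioc P (2 * P) → q ∈ Set.Ioc P (2 * P) → p ≤ q →
      e (p ^ c / Z) ≤ e (q ^ c / Z) := by
    intro p q hp hq hpq
    have hp0 : 0 < p := by linarith [hp.1]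
    have h1 : p ^ c / Z ≤ q ^ c / Z := by
      have := Real.rpow_le_rpow hp0.le hpq (by linarith : 0 ≤ c)
      gcongr
    have := he.sub_le _ _ (rpow_div_bounds hc hP hZ hp).1 h1 (rpow_div_bounds hc hP hZ hq).2
    linarith
  have m1 := mono hx.1 hyI hy.1
  have m2 := mono hyI hz.1 hy.2
  have hx2 := hx.2
  have hz2 := hz.2
  rcases le_total 0 (s * t) with h | h <;> nlinarith

theorem SteepWeight.card_small {e : ℝ → ℝ} (he : SteepWeight e) {c Z P j t ρ : ℝ} (hc : 1 < c)
    (hP : 1 ≤ P) (hZ : 4 * (2 * P) ^ c ≤ Z) (hj : j = 0 ∨ j = 1) (hρ : 0 < ρ) (hρ8 : ρ ≤ 1 / 8)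
    (T : Finset ℕ) (hT : ∀ n ∈ T, (n : ℝ) ∈ Set.Ioc P (2 * P) ∧
      |j * c - t * e ((n : ℝ) ^ c / Z)| < ρ * (j + |t|)) :
    (T.card : ℝ) ≤ 10 * ρ * (Z * P / P ^ c) + 1 := by
  have hP0 : 0 < P := by linarith
  have hZ0 : 0 < Z := by
    have h2 : 0 < (2 * P) ^ c := Real.rpow_pos_of_pos (by linarith) _
    linarith
  have hPc : 0 < P ^ c := Real.rpow_pos_of_pos hP0 _
  have hPc1 : 0 < P ^ (c - 1) := Real.rpow_pos_of_pos hP0 _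
  have hrhs : 0 ≤ 10 * ρ * (Z * P / P ^ c) + 1 := by positivity
  rcases T.eq_empty_or_nonempty with rfl | ⟨n₀, hn₀⟩
  · simpa using hrhs
  have htau : j + |t| ≤ 5 * |t| := by
    rcases hj with rfl | rfl
    · linarith [abs_nonneg t]
    · by_contra hlt
      push Not at hlt
      obtain ⟨hI, h1⟩ := hT n₀ hn₀
      have hb := rpow_div_bounds hc hP hZ hI
      have e1 := he.one_le _ hb.1 hb.2
      have e3 := he.le_three _ hb.1 hb.2
      have h2 : |t * e ((n₀ : ℝ) ^ c / Z)| ≤ 3 / 4 := by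
        rw [abs_mul, abs_of_nonneg (by linarith : 0 ≤ e ((n₀ : ℝ) ^ c / Z))]
        nlinarith [abs_nonneg t]
      have h3 := (abs_le.1 h2).2
      have h4 := (abs_lt.1 h1).2
      nlinarith [abs_nonneg t]
  have hsp := card_le_of_spacing T (lam := P ^ (c - 1) / Z) (D := 10 * ρ) (by positivity)
    (by positivity) (by
      intro n hn n' hn' hnn
      obtain ⟨hI, h1⟩ := hT n hn
      obtain ⟨hI', h1'⟩ := hT n' hn'
      have hnn' : (n : ℝ) ≤ n' := by exact_mod_cast hnn
      have hn0 : (0 : ℝ) < n := by linarith [hI.1]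
      have hb := rpow_div_bounds hc hP hZ hI
      have hb' := rpow_div_bounds hc hP hZ hI'
      have hg := rpow_mul_sub_le hc.le hn0 hnn'
      have hPn : P ^ (c - 1) ≤ (n : ℝ) ^ (c - 1) :=
        Real.rpow_le_rpow hP0.le hI.1.le (by linarith)
      have hd : P ^ (c - 1) / Z * ((n' : ℝ) - n) ≤ (n' : ℝ) ^ c / Z - (n : ℝ) ^ c / Z := by
        rw [div_mul_eq_mul_div, ← sub_div]
        gcongr
        nlinarith
      refine hd.trans ?_
      have hle : (n : ℝ) ^ c / Z ≤ (n' : ℝ) ^ c / Z := by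
        have := Real.rpow_le_rpow hn0.le hnn' (by linarith : 0 ≤ c)
        gcongr
      have hs := he.sub_le _ _ hb.1 hle hb'.2
      refine hs.trans ?_
      have ht0 : 0 < |t| := by
        rcases (abs_nonneg t).eq_or_lt with h | h
        · rw [← h] at htau h1
          have : j = 0 := by rcases hj with h | h <;> linarith
          rw [this] at h1
          have := abs_nonneg (0 * c - t * e ((n : ℝ) ^ c / Z))
          linarith
        · exact h
      have key : |t| * (e ((n' : ℝ) ^ c / Z) - e ((n : ℝ) ^ c / Z)) ≤ |t| * (10 * ρ) := by
        have h0 : 0 ≤ e ((n' : ℝ) ^ c / Z) - e ((n : ℝ) ^ c / Z) := by linarith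
        calc |t| * (e ((n' : ℝ) ^ c / Z) - e ((n : ℝ) ^ c / Z))
            = |t * (e ((n' : ℝ) ^ c / Z) - e ((n : ℝ) ^ c / Z))| := by
              rw [abs_mul, abs_of_nonneg h0]
          _ = |(j * c - t * e ((n : ℝ) ^ c / Z)) - (j * c - t * e ((n' : ℝ) ^ c / Z))| := by
              congr 1; ring
          _ ≤ _ := abs_sub _ _
          _ ≤ 2 * (ρ * (j + |t|)) := by linarith
          _ ≤ 2 * (ρ * (5 * |t|)) := by gcongr
          _ = _ := by ring
      exact le_of_mul_le_mul_left key ht0)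
  refine hsp.trans (le_of_eq ?_)
  have e5 : P ^ c = P ^ (c - 1) * P := by
    rw [← Real.rpow_add_one hP0.ne']; congr 1; ring
  rw [e5]
  field_simp

theorem phaseOn_cell {c Z P j t ρ X : ℝ} (hc : 1 < c) (hc2 : c ≤ 1.1) (hP : 1 ≤ P)
    (hZ : 4 * (2 * P) ^ c ≤ Z) (hj : j = 0 ∨ j = 1) (hτ : 0 < j + |t|) (hX : 1 ≤ X)
    (hρ : ρ = X ^ (-0.039 : ℝ)) (hQ : X ^ (-0.0001 : ℝ) * Z ≤ (c - 1) * P ^ c) {s₁ s₂ : ℝ}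
    (hs₁ : s₁ = 1 ∨ s₁ = -1) (hs₂ : s₂ = 1 ∨ s₂ = -1) :
    PhaseOn {y | (y ∈ Set.Ioc P (2 * P) ∧ ρ * (j + |t|) ≤ s₁ * gOne c Z j t y) ∧
        (y ∈ Set.Ioc P (2 * P) ∧ ρ * (j + |t|) ≤ s₂ * gTwo c Z j t y)}
      (phase c Z j t) (phase1 c Z j t) (phase2 c Z j t) (phaseH c Z j t) P
      (X ^ (-0.0391 : ℝ) * ((j + |t|) * Z)) ((j + |t|) * Z) := by
  have hP0 : 0 < P := by linarith
  have hX0 : 0 < X := by linarith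
  have hZ0 : 0 < Z := by
    have h2 : 0 < (2 * P) ^ c := Real.rpow_pos_of_pos (by linarith) _
    linarith
  have hj0 : 0 ≤ j := by rcases hj with rfl | rfl <;> norm_num
  have hXp : 0 < X ^ (-0.0391 : ℝ) := Real.rpow_pos_of_pos hX0 _
  have hρ0 : 0 < ρ := hρ ▸ Real.rpow_pos_of_pos hX0 _
  set τ := j + |t| with hτdef
  have base : ∀ {y : ℝ}, y ∈ Set.Ioc P (2 * P) → 0 < y ∧ 0 < 1 - y ^ c / Z := by
    intro y hy
    have hb := rpow_div_bounds hc hP hZ hy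
    exact ⟨by linarith [hy.1], by linarith⟩
  have habs : ∀ {e : ℝ → ℝ}, SteepWeight e → ∀ {y : ℝ}, y ∈ Set.Ioc P (2 * P) → ∀ {s : ℝ},
      (s = 1 ∨ s = -1) → s * (j * c - t * e (y ^ c / Z)) ≤ 3 * τ := by
    intro e he y hy s hs
    have hb := rpow_div_bounds hc hP hZ hy
    have e1 := he.one_le _ hb.1 hb.2
    have e3 := he.le_three _ hb.1 hb.2
    have h1 : |t * e (y ^ c / Z)| ≤ 3 * |t| := by
      rw [abs_mul, abs_of_nonneg (by linarith : 0 ≤ e (y ^ c / Z))]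
      nlinarith [abs_nonneg t]
    have h2 := abs_le.1 h1
    rcases hs with rfl | rfl <;> nlinarith
  have hlow : ∀ {y : ℝ}, y ∈ Set.Ioc P (2 * P) →
      X ^ (-0.0391 : ℝ) * (τ * Z) ≤ (c - 1) * y ^ c * (ρ * τ) := by
    intro y hy
    have h1 : P ^ c ≤ y ^ c := Real.rpow_le_rpow hP0.le hy.1.le (by linarith)
    have h2 : X ^ (-0.0391 : ℝ) = X ^ (-0.0001 : ℝ) * ρ := by
      rw [hρ, ← Real.rpow_add hX0]; norm_num
    calc X ^ (-0.0391 : ℝ) * (τ * Z) = (X ^ (-0.0001 : ℝ) * Z) * (ρ * τ) := by rw [h2]; ring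
      _ ≤ ((c - 1) * P ^ c) * (ρ * τ) := by gcongr
      _ ≤ _ := by
        have : 0 ≤ c - 1 := by linarith
        gcongr
  have hZy : ∀ {y : ℝ}, y ∈ Set.Ioc P (2 * P) → 0 < y ^ c ∧ y ^ c ≤ Z / 4 := by
    intro y hy
    have hb := rpow_div_bounds hc hP hZ hy
    refine ⟨Real.rpow_pos_of_pos (base hy).1 _, ?_⟩
    have := hb.2
    rw [div_le_iff₀ hZ0] at this
    linarith
  refine ⟨?_, hP, fun y hy => hy.1.1, by positivity, ?_, ?_, ?_, ?_, ⟨s₁, hs₁, ?_⟩, ⟨s₂, hs₂, ?_⟩⟩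
  · exact ((steepWeight_eOne hc).ordConnected_cell hc hP hZ (j * c) t (ρ * τ) s₁).inter
      ((steepWeight_eTwo hc).ordConnected_cell hc hP hZ (j * c) t (ρ * τ) s₂)
  · have h1 : X ^ (-0.0391 : ℝ) ≤ 1 :=
      Real.rpow_le_one_of_one_le_of_nonpos hX (by norm_num)
    exact mul_le_of_le_one_left (by positivity) h1
  · intro y hy
    exact hasDerivAt_phase j t hc hZ0 (base hy.1.1).1 (base hy.1.1).2
  · intro y hy
    exact hasDerivAt_phase1 j t hc hZ0 (base hy.1.1).1 (base hy.1.1).2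
  · intro y hy
    exact hasDerivAt_sq_mul_phase2 j t hc hZ0 (base hy.1.1).1 (base hy.1.1).2
  · rintro y ⟨⟨hy, h1⟩, -⟩
    obtain ⟨hw0, hw⟩ := hZy hy
    have hc' : 0 ≤ (c - 1) * y ^ c := mul_nonneg (by linarith) hw0.le
    have h3 : s₁ * gOne c Z j t y ≤ 3 * τ := habs (steepWeight_eOne hc) hy hs₁
    have e : s₁ * (y ^ 2 * phase2 c Z j t y) = (c - 1) * y ^ c * (s₁ * gOne c Z j t y) := by
      rw [sq_mul_phase2 j t (base hy).1]; ring
    rw [e]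
    refine ⟨(hlow hy).trans (mul_le_mul_of_nonneg_left h1 hc'),
      (mul_le_mul_of_nonneg_left h3 hc').trans ?_⟩
    have : (c - 1) * y ^ c ≤ 0.1 * (Z / 4) := by
      apply mul_le_mul (by linarith) hw hw0.le (by norm_num)
    nlinarith
  · rintro y ⟨-, ⟨hy, h1⟩⟩
    obtain ⟨hw0, hw⟩ := hZy hy
    have hc' : 0 ≤ (c - 1) * y ^ c := mul_nonneg (by linarith) hw0.le
    have hc₂ : (c - 1) * y ^ c ≤ (c - 1) * c * y ^ c := by nlinarith
    have h3 : s₂ * gTwo c Z j t y ≤ 3 * τ := habs (steepWeight_eTwo hc) hy hs₂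
    have e : s₂ * (y * phaseH c Z j t y) = (c - 1) * c * y ^ c * (s₂ * gTwo c Z j t y) := by
      rw [mul_phaseH j t (base hy).1]; ring
    rw [e]
    refine ⟨(hlow hy).trans ((mul_le_mul_of_nonneg_left h1 hc').trans
      (mul_le_mul_of_nonneg_right hc₂ (le_trans (by positivity) h1))),
      (mul_le_mul_of_nonneg_left h3 (hc'.trans hc₂)).trans ?_⟩
    have : (c - 1) * c * y ^ c ≤ 0.11 * (Z / 4) := by
      apply mul_le_mul (by nlinarith) hw hw0.le (by norm_num)
    nlinarith

end PrimeSquarefree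

namespace PrimeSquarefree

open Finset
open ArithmeticFunction (vonMangoldt)

theorem mem_Ioc_floor {P : ℝ} (hP : 0 ≤ P) (n : ℕ) :
    n ∈ Ioc ⌊P⌋₊ ⌊2 * P⌋₊ ↔ (n : ℝ) ∈ Set.Ioc P (2 * P) := by
  rw [mem_Ioc, Set.mem_Ioc, Nat.floor_lt hP, Nat.le_floor_iff (by linarith)]

theorem card_Ioc_floor_le {P : ℝ} (hP : 0 ≤ P) :
    ((Ioc ⌊P⌋₊ ⌊2 * P⌋₊).card : ℝ) ≤ P + 1 := by
  rw [Nat.card_Ioc]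
  have h1 : ⌊P⌋₊ ≤ ⌊2 * P⌋₊ := Nat.floor_le_floor (by linarith)
  rw [Nat.cast_sub h1]
  have h2 := Nat.floor_le (by linarith : 0 ≤ 2 * P)
  have h3 := Nat.lt_floor_add_one P
  linarith

theorem norm_sum_vonMangoldt_ex_le {P : ℝ} (T : Finset ℕ)
    (hT : ∀ n ∈ T, (n : ℝ) ∈ Set.Ioc P (2 * P)) (hP : 1 ≤ P) (F : ℕ → ℝ) :
    ‖∑ n ∈ T, ((vonMangoldt n : ℝ) : ℂ) * ex (F n)‖ ≤ T.card * Real.log (2 * P) := by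
  refine (norm_sum_le _ _).trans ?_
  rw [← nsmul_eq_mul]
  refine sum_le_card_nsmul _ _ _ fun n hn => ?_
  have h := hT n hn
  have hn0 : (0 : ℝ) < n := by linarith [h.1]
  rw [norm_mul, norm_ex, mul_one, Complex.norm_real, Real.norm_of_nonneg
    ArithmeticFunction.vonMangoldt_nonneg]
  exact ArithmeticFunction.vonMangoldt_le_log.trans (Real.log_le_log hn0 h.2)

theorem sum_four_cells (I : Finset ℕ) (f : ℕ → ℂ) (g h : ℕ → ℝ) {a : ℝ} (ha : 0 < a) :
    ‖∑ n ∈ I, f n‖ ≤ ‖∑ n ∈ I.filter (fun n => a ≤ 1 * g n ∧ a ≤ 1 * h n), f n‖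
      + ‖∑ n ∈ I.filter (fun n => a ≤ 1 * g n ∧ a ≤ -1 * h n), f n‖
      + ‖∑ n ∈ I.filter (fun n => a ≤ -1 * g n ∧ a ≤ 1 * h n), f n‖
      + ‖∑ n ∈ I.filter (fun n => a ≤ -1 * g n ∧ a ≤ -1 * h n), f n‖
      + ‖∑ n ∈ I.filter (fun n => |g n| < a ∨ |h n| < a), f n‖ := by
  have e : ∑ n ∈ I, f n = ∑ n ∈ I.filter (fun n => a ≤ 1 * g n ∧ a ≤ 1 * h n), f n
      + ∑ n ∈ I.filter (fun n => a ≤ 1 * g n ∧ a ≤ -1 * h n), f n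
      + ∑ n ∈ I.filter (fun n => a ≤ -1 * g n ∧ a ≤ 1 * h n), f n
      + ∑ n ∈ I.filter (fun n => a ≤ -1 * g n ∧ a ≤ -1 * h n), f n
      + ∑ n ∈ I.filter (fun n => |g n| < a ∨ |h n| < a), f n := by
    simp only [sum_filter, ← sum_add_distrib]
    refine sum_congr rfl fun n _ => ?_
    have key : ∀ x : ℝ, (a ≤ 1 * x ∧ ¬ a ≤ -1 * x ∧ ¬ |x| < a) ∨
        (¬ a ≤ 1 * x ∧ a ≤ -1 * x ∧ ¬ |x| < a) ∨ (¬ a ≤ 1 * x ∧ ¬ a ≤ -1 * x ∧ |x| < a) := by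
      intro x
      rcases le_or_gt a |x| with h1 | h1
      · rcases le_or_gt 0 x with h2 | h2
        · rw [abs_of_nonneg h2] at *
          exact Or.inl ⟨by linarith, by linarith, by linarith⟩
        · rw [abs_of_neg h2] at *
          exact Or.inr (Or.inl ⟨by linarith, by linarith, by linarith⟩)
      · have := abs_lt.1 h1
        exact Or.inr (Or.inr ⟨by linarith, by linarith, h1⟩)
    rcases key (g n) with ⟨a1, a2, a3⟩ | ⟨a1, a2, a3⟩ | ⟨a1, a2, a3⟩ <;>
      rcases key (h n) with ⟨b1, b2, b3⟩ | ⟨b1, b2, b3⟩ | ⟨b1, b2, b3⟩ <;>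
      simp only [a1, a2, a3, b1, b2, b3, and_self, and_true, and_false, or_self, or_true, or_false,
        if_true, if_false, add_zero, zero_add]
  rw [e]
  refine (norm_add_le _ _).trans (add_le_add_left ?_ _)
  refine (norm_add_le _ _).trans (add_le_add_left ?_ _)
  refine (norm_add_le _ _).trans (add_le_add_left ?_ _)
  exact norm_add_le _ _

theorem norm_sum_phase_le {c Z P j t X : ℝ} (hc : 1 < c) (hc2 : c ≤ 1.1)
    (hZ : 4 * (2 * P) ^ c ≤ Z) (hj : j = 0 ∨ j = 1) (hX : 1 ≤ X)
    (hη : 10000 ≤ X ^ (0.0001 : ℝ)) (hL : Real.log (2 * P) + 6 ≤ X ^ (0.0001 : ℝ)) (hPX : P ≤ X)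
    (hXP : X ^ (0.9999 : ℝ) ≤ P) (hQ : X ^ (-0.0001 : ℝ) * Z ≤ (c - 1) * P ^ c)
    (hZX : Z ≤ X ^ (1.0385 : ℝ)) (hT : X ^ (0.999 : ℝ) ≤ (j + |t|) * Z) :
    ‖∑ n ∈ Ioc ⌊P⌋₊ ⌊2 * P⌋₊, ((vonMangoldt n : ℝ) : ℂ) * ex (phase c Z j t n)‖
      ≤ X ^ (0.9616 : ℝ) * √(1 + |t|) := by
  have hX0 : 0 < X := by linarith
  have hm : ∀ a b : ℝ, X ^ a * X ^ b = X ^ (a + b) := fun a b => (Real.rpow_add hX0 a b).symm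
  have hle : ∀ {a b : ℝ}, a ≤ b → X ^ a ≤ X ^ b := fun hab =>
    Real.rpow_le_rpow_of_exponent_le hX hab
  have hpos : ∀ a : ℝ, 0 < X ^ a := fun a => Real.rpow_pos_of_pos hX0 a
  have hbump : ∀ {a b : ℝ} {C : ℝ}, C ≤ 10000 → a + 0.0001 ≤ b → C * X ^ a ≤ X ^ b := by
    intro a b C hC hab
    calc C * X ^ a ≤ X ^ (0.0001 : ℝ) * X ^ a := by
          have := hpos a
          gcongr
          linarith
      _ = X ^ (0.0001 + a) := hm _ _
      _ ≤ _ := hle (by linarith)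
  have hfl : ∀ a : ℝ, 0.0001 ≤ a → 10000 ≤ X ^ a := fun a ha => hη.trans (hle ha)
  have hP : 1 ≤ P := by linarith [hfl 0.9999 (by norm_num)]
  have hP0 : 0 < P := by linarith
  have hPc : 0 < P ^ c := Real.rpow_pos_of_pos hP0 _
  have hZ0 : 0 < Z := by
    have h2 : 0 < (2 * P) ^ c := Real.rpow_pos_of_pos (by linarith) _
    linarith
  have hL0 : 0 ≤ Real.log (2 * P) := Real.log_nonneg (by linarith)
  have ht0 := abs_nonneg t
  set s := √(1 + |t|) with hs
  have hs2 : s ^ 2 = 1 + |t| := Real.sq_sqrt (by linarith)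
  have hs1 : 1 ≤ s := by rw [hs]; exact Real.one_le_sqrt.2 (by linarith)
  set I := Ioc ⌊P⌋₊ ⌊2 * P⌋₊ with hI
  have hImem : ∀ n, n ∈ I ↔ (n : ℝ) ∈ Set.Ioc P (2 * P) := mem_Ioc_floor hP0.le
  rcases le_or_gt s (X ^ (0.05 : ℝ)) with hsX | hsX
  swap
  · calc _ ≤ (I.card : ℝ) * Real.log (2 * P) :=
          norm_sum_vonMangoldt_ex_le I (fun n hn => (hImem n).1 hn) hP _
      _ ≤ (2 * X ^ (1 : ℝ)) * X ^ (0.0001 : ℝ) := by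
          have := card_Ioc_floor_le hP0.le
          rw [Real.rpow_one]
          gcongr <;> linarith
      _ = 2 * X ^ (1 + 0.0001 : ℝ) := by rw [mul_assoc, hm]
      _ ≤ X ^ (0.9616 + 0.05 : ℝ) := hbump (by norm_num) (by norm_num)
      _ = X ^ (0.9616 : ℝ) * X ^ (0.05 : ℝ) := (hm _ _).symm
      _ ≤ _ := by have := hpos 0.9616; gcongr
  have hτ0 : 0 < j + |t| := by
    have := (hpos 0.999).trans_le hT
    exact pos_of_mul_pos_left this hZ0.le
  set ρ := X ^ (-0.039 : ℝ) with hρ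
  have hρ0 : 0 < ρ := hpos _
  have hρ8 : ρ ≤ 1 / 8 := by
    rw [hρ, Real.rpow_neg hX0.le, ← one_div]
    exact one_div_le_one_div_of_le (by norm_num) (by linarith [hfl 0.039 (by norm_num)])
  set τ := j + |t| with hτ
  have hT2 : τ * Z ≤ X ^ (1.0385 : ℝ) * s ^ 2 := by
    rw [hs2, mul_comm]
    have : τ ≤ 1 + |t| := by rw [hτ]; rcases hj with h | h <;> linarith
    gcongr
  have cell : ∀ {s₁ s₂ : ℝ}, (s₁ = 1 ∨ s₁ = -1) → (s₂ = 1 ∨ s₂ = -1) →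
      ‖∑ n ∈ I.filter (fun n : ℕ => ρ * τ ≤ s₁ * gOne c Z j t n ∧ ρ * τ ≤ s₂ * gTwo c Z j t n),
        ((vonMangoldt n : ℝ) : ℂ) * ex (phase c Z j t n)‖ ≤ X ^ (0.9614 : ℝ) * s := by
    intro s₁ s₂ hs₁ hs₂
    refine (phaseOn_cell hc hc2 hP hZ hj hτ0 hX hρ hQ hs₁ hs₂).vonMangoldt_sum_pow _ ?_ hX hη hL
      hPX hXP hT hT2 hs1 hsX
    intro n
    rw [mem_filter, hImem]
    simp only [Set.mem_ofPred_eq]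
    tauto
  have hZP : Z * P / P ^ c ≤ X ^ (1.0001 : ℝ) := by
    rw [div_le_iff₀ hPc]
    have h1 : Z ≤ X ^ (0.0001 : ℝ) * P ^ c := by
      calc Z = X ^ (0.0001 : ℝ) * (X ^ (-0.0001 : ℝ) * Z) := by
            rw [← mul_assoc, hm]; norm_num
        _ ≤ X ^ (0.0001 : ℝ) * ((c - 1) * P ^ c) := by
            have := hpos 0.0001
            gcongr
        _ ≤ _ := by
            have := hpos 0.0001
            gcongr
            nlinarith
    calc Z * P ≤ (X ^ (0.0001 : ℝ) * P ^ c) * X ^ (1 : ℝ) := by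
          rw [Real.rpow_one]
          have := hpos 0.0001
          gcongr
      _ = (X ^ (0.0001 : ℝ) * X ^ (1 : ℝ)) * P ^ c := by ring
      _ = _ := by rw [hm]; norm_num
  have small : ∀ {e : ℝ → ℝ}, SteepWeight e →
      ((I.filter (fun n : ℕ => |j * c - t * e ((n : ℝ) ^ c / Z)| < ρ * τ)).card : ℝ)
        ≤ X ^ (0.9612 : ℝ) := by
    intro e he
    refine (he.card_small (t := t) hc hP hZ hj hρ0 hρ8 _ (fun n hn => ?_)).trans ?_
    · exact ⟨(hImem n).1 (mem_filter.1 hn).1, (mem_filter.1 hn).2⟩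
    · calc 10 * ρ * (Z * P / P ^ c) + 1 ≤ 10 * ρ * X ^ (1.0001 : ℝ) + X ^ (0.9611 : ℝ) := by
            have := hfl 0.9611 (by norm_num)
            gcongr
            linarith
        _ = 11 * X ^ (0.9611 : ℝ) := by rw [mul_assoc, hm]; norm_num; ring
        _ ≤ _ := hbump (by norm_num) (by norm_num)
  have bad : ‖∑ n ∈ I.filter (fun n : ℕ => |gOne c Z j t n| < ρ * τ ∨ |gTwo c Z j t n| < ρ * τ),
        ((vonMangoldt n : ℝ) : ℂ) * ex (phase c Z j t n)‖ ≤ X ^ (0.9614 : ℝ) * s := by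
    calc _ ≤ ((I.filter (fun n : ℕ => |gOne c Z j t n| < ρ * τ ∨
              |gTwo c Z j t n| < ρ * τ)).card : ℝ) * Real.log (2 * P) :=
          norm_sum_vonMangoldt_ex_le _ (fun n hn => (hImem n).1 (mem_filter.1 hn).1) hP _
      _ ≤ (X ^ (0.9612 : ℝ) + X ^ (0.9612 : ℝ)) * X ^ (0.0001 : ℝ) := by
          have h1 := small (steepWeight_eOne hc)
          have h2 := small (steepWeight_eTwo hc)
          have := hpos 0.9612
          gcongr
          · rw [filter_or]
            refine le_trans ?_ (add_le_add h1 h2)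
            exact_mod_cast card_union_le _ _
          · linarith
      _ = 2 * X ^ (0.9613 : ℝ) := by rw [← two_mul, mul_assoc, hm]; norm_num
      _ ≤ X ^ (0.9614 : ℝ) := hbump (by norm_num) (by norm_num)
      _ ≤ _ := le_mul_of_one_le_right (hpos _).le hs1
  refine (sum_four_cells I _ (fun n => gOne c Z j t n) (fun n => gTwo c Z j t n)
    (mul_pos hρ0 hτ0)).trans ?_
  have c1 := cell (Or.inl rfl) (Or.inl rfl)
  have c2 := cell (Or.inl rfl) (Or.inr rfl)
  have c3 := cell (Or.inr rfl) (Or.inl rfl)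
  have c4 := cell (Or.inr rfl) (Or.inr rfl)
  have h5 : 5 * X ^ (0.9614 : ℝ) * s ≤ X ^ (0.9616 : ℝ) * s :=
    mul_le_mul_of_nonneg_right (hbump (by norm_num) (by norm_num)) (by linarith)
  linarith only [c1, c2, c3, c4, h5, bad]

end PrimeSquarefree

namespace PrimeSquarefree

open Finset
open ArithmeticFunction (vonMangoldt)

theorem log_centralBinom_eq (n : ℕ) :
    Real.log n.centralBinom = ∑ p ∈ (range (2 * n + 1)).filter Nat.Prime,
      (n.centralBinom.factorization p : ℝ) * Real.log p := by
  conv_lhs => rw [← Nat.prod_pow_factorization_centralBinom n]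
  rw [Nat.cast_prod, Real.log_prod, sum_filter]
  · refine sum_congr rfl fun p _ => ?_
    split_ifs with hp
    · rw [Nat.cast_pow, Real.log_pow]
    · rw [Nat.factorization_eq_zero_of_not_prime _ hp]
      simp
  · intro p _
    by_cases hp : p.Prime
    · exact_mod_cast (pow_pos hp.pos _).ne'
    · rw [Nat.factorization_eq_zero_of_not_prime _ hp]
      simp

theorem factorization_centralBinom_mul_log_le {n p : ℕ} (hn : 2 < n) (hp : p.Prime) :
    (n.centralBinom.factorization p : ℝ) * Real.log p ≤
      (if p ≤ Nat.sqrt (2 * n) then Real.log (2 * n) else 0)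
      + (if p ≤ 2 * n / 3 then Real.log p else 0)
      + (if n < p ∧ p ≤ 2 * n then Real.log p else 0) := by
  have hp1 : (1 : ℝ) ≤ p := by exact_mod_cast hp.one_le
  have hlp : 0 ≤ Real.log p := Real.log_nonneg hp1
  have hl2 : 0 ≤ Real.log (2 * n) := Real.log_nonneg (by exact_mod_cast (by omega : 1 ≤ 2 * n))
  have n1 : 0 ≤ (if p ≤ 2 * n / 3 then Real.log p else 0) := by split_ifs <;> simp [hlp]
  have n2 : 0 ≤ (if n < p ∧ p ≤ 2 * n then Real.log p else 0) := by split_ifs <;> simp [hlp]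
  rcases le_or_gt p (Nat.sqrt (2 * n)) with h | h
  · rw [if_pos h]
    have h1 : p ^ n.centralBinom.factorization p ≤ 2 * n :=
      Nat.pow_factorization_choose_le (by omega)
    have h2 : Real.log ((p : ℝ) ^ n.centralBinom.factorization p) ≤ Real.log (2 * n) := by
      apply Real.log_le_log (by positivity)
      exact_mod_cast h1
    rw [Real.log_pow] at h2
    linarith
  · rw [if_neg (by omega)]
    have h1 : n.centralBinom.factorization p ≤ 1 :=
      Nat.factorization_choose_le_one (by rw [sq]; exact Nat.sqrt_lt.1 h)
    have h1' : (n.centralBinom.factorization p : ℝ) * Real.log p ≤ Real.log p := by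
      have : (n.centralBinom.factorization p : ℝ) ≤ 1 := by exact_mod_cast h1
      nlinarith
    by_cases a : p ≤ 2 * n / 3
    · rw [if_pos a] at *; linarith
    by_cases b : n < p ∧ p ≤ 2 * n
    · rw [if_pos b] at *; linarith
    · have : n.centralBinom.factorization p = 0 := by
        rcases le_or_gt p n with b1 | b1
        · exact Nat.factorization_centralBinom_of_two_mul_self_lt_three_mul hn b1 (by omega)
        · exact Nat.factorization_centralBinom_eq_zero_of_two_mul_lt (by omega)
      rw [this]
      simp only [Nat.cast_zero, zero_mul]
      linarith

theorem sum_log_primes_ge {n : ℕ} (hn : 2 < n) :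
    n * Real.log 4 / 3 - (√(2 * n) + 2) * Real.log (2 * n) ≤
      ∑ p ∈ (Ioc n (2 * n)).filter Nat.Prime, Real.log p := by
  have hn0 : (0 : ℝ) < n := by exact_mod_cast (by omega : 0 < n)
  have hl2 : 0 ≤ Real.log (2 * n) := Real.log_nonneg (by exact_mod_cast (by omega : 1 ≤ 2 * n))
  have h1 : n * Real.log 4 ≤ Real.log (2 * n) + Real.log n.centralBinom := by
    have h := Nat.four_pow_le_two_mul_self_mul_centralBinom n (by omega)
    have hc : (0 : ℝ) < n.centralBinom := by exact_mod_cast Nat.centralBinom_pos n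
    rw [← Real.log_pow, ← Real.log_mul (by positivity) hc.ne']
    apply Real.log_le_log (by positivity)
    exact_mod_cast h
  have h2 : Real.log n.centralBinom ≤ (√(2 * n) + 1) * Real.log (2 * n)
      + Real.log 4 * (2 * n / 3) + ∑ p ∈ (Ioc n (2 * n)).filter Nat.Prime, Real.log p := by
    rw [log_centralBinom_eq]
    refine (sum_le_sum fun p hp =>
      factorization_centralBinom_mul_log_le hn (mem_filter.1 hp).2).trans ?_
    rw [sum_add_distrib, sum_add_distrib]
    refine add_le_add (add_le_add ?_ ?_) (le_of_eq ?_)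
    · rw [← sum_filter, sum_const, nsmul_eq_mul]
      refine mul_le_mul_of_nonneg_right ?_ hl2
      have hsub : ((range (2 * n + 1)).filter Nat.Prime).filter (fun p => p ≤ Nat.sqrt (2 * n))
          ⊆ range (Nat.sqrt (2 * n) + 1) := by
        intro p hp
        rw [mem_range]
        have := (mem_filter.1 hp).2
        omega
      have hc := card_le_card hsub
      rw [card_range] at hc
      have hs := Real.nat_sqrt_le_real_sqrt (a := 2 * n)
      push_cast at hs
      have : ((((range (2 * n + 1)).filter Nat.Prime).filter
        (fun p => p ≤ Nat.sqrt (2 * n))).card : ℝ) ≤ Nat.sqrt (2 * n) + 1 := by exact_mod_cast hc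
      linarith
    · rw [← sum_filter]
      refine le_trans (le_of_eq ?_) (Chebyshev.theta_le_log4_mul_x (by positivity))
      rw [Chebyshev.theta_eq_sum_Icc]
      refine sum_congr ?_ fun _ _ => rfl
      have hf : ⌊(2 * n / 3 : ℝ)⌋₊ = 2 * n / 3 := by
        have := Nat.floor_div_eq_div (K := ℝ) (2 * n) 3
        push_cast at this
        exact this
      rw [hf]
      ext p
      simp only [mem_filter, mem_range, mem_Icc]
      constructor
      · rintro ⟨⟨a, b⟩, d⟩; exact ⟨⟨by omega, d⟩, b⟩
      · rintro ⟨⟨a, b⟩, d⟩; exact ⟨⟨by omega, d⟩, b⟩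
    · rw [← sum_filter]
      refine sum_congr ?_ fun _ _ => rfl
      ext p
      simp only [mem_filter, mem_range, mem_Ioc]
      constructor
      · rintro ⟨⟨a, b⟩, d⟩; exact ⟨d, b⟩
      · rintro ⟨d, b⟩; exact ⟨⟨by omega, b⟩, d⟩
  linarith

/-- Lower bound of Chebyshev type for the von Mangoldt function on a dyadic interval. -/
theorem sum_vonMangoldt_ge {P : ℝ} (hP : 3 ≤ P) :
    (P - 1) * (4 / 9) - (√(2 * P) + 2) * Real.log (2 * P) ≤
      ∑ n ∈ Ioc ⌊P⌋₊ ⌊2 * P⌋₊, (vonMangoldt n : ℝ) := by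
  have hn : 2 < ⌊P⌋₊ := Nat.lt_of_lt_of_le (by norm_num) (Nat.le_floor (by exact_mod_cast hP) : 3 ≤ ⌊P⌋₊)
  have hn0 : (0 : ℝ) < ⌊P⌋₊ := by exact_mod_cast (by omega : 0 < ⌊P⌋₊)
  have h1 := sum_log_primes_ge hn
  have hfl := Nat.floor_le (by linarith : 0 ≤ P)
  have hlf := Nat.lt_floor_add_one P
  have h2 : 2 * ⌊P⌋₊ ≤ ⌊2 * P⌋₊ := Nat.le_floor (by push_cast; linarith)
  have h3 : ∑ p ∈ (Ioc ⌊P⌋₊ (2 * ⌊P⌋₊)).filter Nat.Prime, Real.log p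
      ≤ ∑ n ∈ Ioc ⌊P⌋₊ ⌊2 * P⌋₊, (vonMangoldt n : ℝ) := by
    calc ∑ p ∈ (Ioc ⌊P⌋₊ (2 * ⌊P⌋₊)).filter Nat.Prime, Real.log p
        = ∑ p ∈ (Ioc ⌊P⌋₊ (2 * ⌊P⌋₊)).filter Nat.Prime, (vonMangoldt p : ℝ) :=
          sum_congr rfl fun p hp =>
            (ArithmeticFunction.vonMangoldt_apply_prime (mem_filter.1 hp).2).symm
      _ ≤ _ := sum_le_sum_of_subset_of_nonneg
          ((filter_subset _ _).trans (Ioc_subset_Ioc_right h2))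
          fun _ _ _ => ArithmeticFunction.vonMangoldt_nonneg
  have h4 : 4 / 3 ≤ Real.log 4 := by
    rw [show (4 : ℝ) = 2 ^ 2 by norm_num, Real.log_pow]
    have := Real.log_two_gt_d9
    push_cast
    linarith
  have h5 : √(2 * ⌊P⌋₊) ≤ √(2 * P) := Real.sqrt_le_sqrt (by linarith)
  have h6 : Real.log (2 * ⌊P⌋₊) ≤ Real.log (2 * P) := Real.log_le_log (by positivity) (by linarith)
  have h7 : 0 ≤ Real.log (2 * P) := Real.log_nonneg (by linarith)
  have h8 : (√(2 * ⌊P⌋₊) + 2) * Real.log (2 * ⌊P⌋₊) ≤ (√(2 * P) + 2) * Real.log (2 * P) := by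
    have h0 : 0 ≤ Real.log (2 * ⌊P⌋₊) :=
      Real.log_nonneg (by exact_mod_cast (by omega : 1 ≤ 2 * ⌊P⌋₊))
    gcongr
  have h9 : (P - 1) * (4 / 9) ≤ ⌊P⌋₊ * Real.log 4 / 3 := by nlinarith
  linarith

theorem sum_vonMangoldt_not_prime_le {P : ℝ} (hP : 1 ≤ P) :
    ∑ n ∈ (Ioc ⌊P⌋₊ ⌊2 * P⌋₊).filter (fun n => ¬ n.Prime), (vonMangoldt n : ℝ)
      ≤ 2 * √(2 * P) * Real.log (2 * P) := by
  refine le_trans ?_ (Chebyshev.psi_sub_theta_le (by linarith : 1 ≤ 2 * P))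
  rw [Chebyshev.psi_sub_theta_eq_sum_not_prime]
  exact sum_le_sum_of_subset_of_nonneg
    (filter_subset_filter _ (Ioc_subset_Ioc_left (Nat.zero_le _)))
    fun _ _ _ => ArithmeticFunction.vonMangoldt_nonneg

end PrimeSquarefree

namespace PrimeSquarefree

open Finset

/-- The triangular window of half-width `δ` around the integers. -/
noncomputable def tri (δ x : ℝ) : ℝ := max 0 (1 - |x - round x| / δ)

/-- The Fourier cosine coefficients of `tri`. -/
noncomputable def triCoeff (δ : ℝ) (k : ℕ) : ℝ :=
  (1 - Real.cos (2 * Real.pi * (k * δ))) / (Real.pi ^ 2 * δ * (k : ℝ) ^ 2)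

theorem tri_nonneg (δ x : ℝ) : 0 ≤ tri δ x := le_max_left _ _

theorem tri_le_one {δ : ℝ} (hδ : 0 < δ) (x : ℝ) : tri δ x ≤ 1 := by
  refine max_le zero_le_one ?_
  have : 0 ≤ |x - round x| / δ := by positivity
  linarith

theorem le_tri {δ : ℝ} (hδ : 0 < δ) (x : ℝ) (l : ℤ) : 1 - |x - l| / δ ≤ tri δ x := by
  refine le_trans ?_ (le_max_right _ _)
  have h := round_le x l
  gcongr

theorem triCoeff_nonneg {δ : ℝ} (hδ : 0 < δ) (k : ℕ) : 0 ≤ triCoeff δ k := by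
  have := Real.cos_le_one (2 * Real.pi * (k * δ))
  unfold triCoeff
  apply div_nonneg (by linarith)
  positivity

theorem triCoeff_le {δ : ℝ} (hδ : 0 < δ) (k : ℕ) : triCoeff δ k ≤ 8 * δ / (1 + k * δ) ^ 2 := by
  rcases Nat.eq_zero_or_pos k with rfl | hk
  · simp [triCoeff]; positivity
  have hk0 : (0 : ℝ) < k := by exact_mod_cast hk
  have hpi := Real.pi_pos
  unfold triCoeff
  rcases le_or_gt (k * δ) 1 with h | h
  · calc (1 - Real.cos (2 * Real.pi * (k * δ))) / (Real.pi ^ 2 * δ * (k : ℝ) ^ 2)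
        ≤ ((2 * Real.pi * (k * δ)) ^ 2 / 2) / (Real.pi ^ 2 * δ * (k : ℝ) ^ 2) := by
          have := Real.one_sub_sq_div_two_le_cos (x := 2 * Real.pi * (k * δ))
          gcongr
          linarith
      _ = 8 * δ / 4 := by field_simp; ring
      _ ≤ _ := by
          have : 0 ≤ k * δ := by positivity
          gcongr
          nlinarith
  · have h3 := Real.pi_gt_three
    calc (1 - Real.cos (2 * Real.pi * (k * δ))) / (Real.pi ^ 2 * δ * (k : ℝ) ^ 2)
        ≤ 2 / (1 * δ * (k : ℝ) ^ 2) := by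
          have := Real.neg_one_le_cos (2 * Real.pi * (k * δ))
          gcongr
          · linarith
          · nlinarith
      _ = 8 * δ / (4 * (k * δ) ^ 2) := by field_simp; ring
      _ ≤ _ := by
          gcongr
          nlinarith

theorem cos_pi_mul_round (x : ℝ) (k : ℕ) :
    Real.cos (2 * Real.pi * (k * |x - round x|)) = Real.cos (2 * Real.pi * (k * x)) := by
  have h : Real.cos (2 * Real.pi * (k * (x - round x))) = Real.cos (2 * Real.pi * (k * x)) := by
    have e : 2 * Real.pi * (k * (x - round x)) =
        2 * Real.pi * (k * x) - ((k * round x : ℤ) : ℝ) * (2 * Real.pi) := by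
      push_cast; ring
    rw [e, Real.cos_sub_int_mul_two_pi]
  rcases abs_choice (x - round x) with e | e
  · rw [e, h]
  · rw [e, ← h, ← Real.cos_neg]; congr 1; ring

theorem hasSum_cos_div_sq {x : ℝ} (hx : x ∈ Set.Icc (0 : ℝ) 1) :
    HasSum (fun n : ℕ => 1 / (n : ℝ) ^ 2 * Real.cos (2 * Real.pi * (n * x)))
      (Real.pi ^ 2 * (x ^ 2 - x + 1 / 6)) := by
  have h := hasSum_one_div_nat_pow_mul_cos (k := 1) one_ne_zero hx
  have e : (Polynomial.map (algebraMap ℚ ℝ) (Polynomial.bernoulli 2)).eval x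
      = x ^ 2 - x + 1 / 6 := by
    simp [Polynomial.bernoulli, sum_range_succ, Polynomial.eval_monomial, Polynomial.map_monomial]
    ring
  simp only [mul_one, e] at h
  convert h using 1
  · ext n; congr 2; ring
  · rw [Nat.factorial_two]
    push_cast
    ring

set_option maxHeartbeats 400000 in
theorem hasSum_tri {δ : ℝ} (hδ : 0 < δ) (hδ2 : δ ≤ 1 / 2) (x : ℝ) :
    HasSum (fun k : ℕ => triCoeff δ k * Real.cos (2 * Real.pi * (k * x))) (tri δ x - δ) := by
  set r := |x - round x| with hr
  have hr0 : 0 ≤ r := abs_nonneg _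
  have hr2 : r ≤ 1 / 2 := abs_sub_round x
  have hpi := Real.pi_pos
  have h1 := hasSum_cos_div_sq (x := r + δ) ⟨by linarith, by linarith⟩
  have h2 := hasSum_cos_div_sq (x := r) ⟨by linarith, by linarith⟩
  have h3 : HasSum (fun n : ℕ => 1 / (n : ℝ) ^ 2 * Real.cos (2 * Real.pi * (n * (r - δ))))
      (Real.pi ^ 2 * (if δ ≤ r then (r - δ) ^ 2 - (r - δ) + 1 / 6
        else (r - δ) ^ 2 + (r - δ) + 1 / 6)) := by
    split_ifs with h
    · exact hasSum_cos_div_sq (x := r - δ) ⟨by linarith, by linarith⟩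
    · convert hasSum_cos_div_sq (x := r - δ + 1) ⟨by linarith, by linarith⟩ using 1
      · ext n
        congr 1
        have e : 2 * Real.pi * (n * (r - δ + 1)) = 2 * Real.pi * (n * (r - δ)) + n * (2 * Real.pi) := by
          ring
        rw [e, Real.cos_add_nat_mul_two_pi]
      · ring
  have h4 := ((h1.add h3).sub (h2.mul_left 2)).mul_left (-1 / (2 * Real.pi ^ 2 * δ))
  have e0 : ∀ n : ℕ, triCoeff δ n * Real.cos (2 * Real.pi * (n * x)) =
      -1 / (2 * Real.pi ^ 2 * δ) * (1 / (n : ℝ) ^ 2 * Real.cos (2 * Real.pi * (n * (r + δ)))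
        + 1 / (n : ℝ) ^ 2 * Real.cos (2 * Real.pi * (n * (r - δ)))
        - 2 * (1 / (n : ℝ) ^ 2 * Real.cos (2 * Real.pi * (n * r)))) := by
    intro n
    rw [← cos_pi_mul_round x n, ← hr]
    have e1 : 2 * Real.pi * (n * (r + δ)) = 2 * Real.pi * (n * r) + 2 * Real.pi * (n * δ) := by ring
    have e2 : 2 * Real.pi * (n * (r - δ)) = 2 * Real.pi * (n * r) - 2 * Real.pi * (n * δ) := by ring
    rw [e1, e2, Real.cos_add, Real.cos_sub]
    unfold triCoeff
    rcases Nat.eq_zero_or_pos n with rfl | hn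
    · simp
    have : (0 : ℝ) < n := by exact_mod_cast hn
    field_simp
    ring
  have e1 : tri δ x - δ = -1 / (2 * Real.pi ^ 2 * δ) * (Real.pi ^ 2 * ((r + δ) ^ 2 - (r + δ) + 1 / 6)
      + Real.pi ^ 2 * (if δ ≤ r then (r - δ) ^ 2 - (r - δ) + 1 / 6
        else (r - δ) ^ 2 + (r - δ) + 1 / 6) - 2 * (Real.pi ^ 2 * (r ^ 2 - r + 1 / 6))) := by
    unfold tri
    rw [← hr]
    split_ifs with h
    · rw [max_eq_left (by rw [sub_nonpos, one_le_div hδ]; exact h)]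
      field_simp
      ring
    · push Not at h
      rw [max_eq_right (by rw [sub_nonneg, div_le_one hδ]; exact h.le)]
      field_simp
      ring
  simp only [e0]
  rw [e1]
  exact h4

theorem sum_triCoeff_mul_sqrt_le {δ : ℝ} (hδ : 0 < δ) (K : ℕ) :
    ∑ k ∈ range K, triCoeff δ k * √(1 + k * δ) ≤ 16 := by
  have key : ∀ K : ℕ, ∑ k ∈ range (K + 1), triCoeff δ k * √(1 + k * δ)
      ≤ 16 * (1 - 1 / √(1 + K * δ)) := by
    intro K
    induction K with
    | zero => simp [triCoeff]
    | succ K ih =>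
      rw [sum_range_succ]
      have ha2 : √(1 + K * δ) ^ 2 = 1 + K * δ := Real.sq_sqrt (by positivity)
      have hb2 : √(1 + (K + 1 : ℕ) * δ) ^ 2 = 1 + (K + 1 : ℕ) * δ := Real.sq_sqrt (by positivity)
      have ha0 : 0 < √(1 + K * δ) := Real.sqrt_pos.2 (by positivity)
      have hb0 : 0 < √(1 + (K + 1 : ℕ) * δ) := Real.sqrt_pos.2 (by positivity)
      have hab : √(1 + K * δ) ≤ √(1 + (K + 1 : ℕ) * δ) := by
        apply Real.sqrt_le_sqrt
        push_cast
        nlinarith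
      have ht := triCoeff_le hδ (K + 1)
      rw [← hb2] at ht
      set a := √(1 + K * δ)
      set b := √(1 + (K + 1 : ℕ) * δ)
      have hd : b ^ 2 - a ^ 2 = δ := by rw [ha2, hb2]; push_cast; ring
      have h1 : triCoeff δ (K + 1) * b ≤ 16 * (1 / a - 1 / b) := by
        calc triCoeff δ (K + 1) * b ≤ 8 * δ / (b ^ 2) ^ 2 * b := by gcongr
          _ = 8 * δ / b ^ 3 := by field_simp
          _ = 8 * (b - a) * (a + b) / b ^ 3 := by rw [← hd]; ring
          _ ≤ 8 * (b - a) * (b + b) / b ^ 3 := by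
            have : 0 ≤ b - a := by linarith
            gcongr
          _ = 16 * (b - a) / (b * b) := by field_simp; ring
          _ ≤ 16 * (b - a) / (a * b) := by
            have : 0 ≤ b - a := by linarith
            gcongr
          _ = _ := by field_simp
      linarith
  have hnn : ∀ k, 0 ≤ triCoeff δ k * √(1 + k * δ) := fun k =>
    mul_nonneg (triCoeff_nonneg hδ k) (Real.sqrt_nonneg _)
  calc _ ≤ ∑ k ∈ range (K + 1), triCoeff δ k * √(1 + k * δ) := by
        rw [sum_range_succ]; linarith [hnn K]
    _ ≤ _ := key K
    _ ≤ 16 := by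
        have : 0 ≤ 1 / √(1 + K * δ) := by positivity
        linarith

/-- A weighted sum of windows differs from its mean by the weighted exponential sums. -/
theorem abs_sum_tri_sub_le {δ B : ℝ} (hδ : 0 < δ) (hδ2 : δ ≤ 1 / 2) (S : Finset ℕ) (a x : ℕ → ℝ)
    (h : ∀ k : ℕ, 1 ≤ k →
      |∑ n ∈ S, a n * Real.cos (2 * Real.pi * (k * x n))| ≤ B * √(1 + k * δ)) :
    |∑ n ∈ S, a n * tri δ (x n) - δ * ∑ n ∈ S, a n| ≤ 16 * B := by
  have hB : 0 ≤ B := by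
    have h1 := (abs_nonneg _).trans (h 1 le_rfl)
    exact nonneg_of_mul_nonneg_left h1 (Real.sqrt_pos.2 (by positivity))
  have hs : HasSum (fun k : ℕ => ∑ n ∈ S, a n * (triCoeff δ k * Real.cos (2 * Real.pi * (k * x n))))
      (∑ n ∈ S, a n * (tri δ (x n) - δ)) :=
    hasSum_sum fun n _ => (hasSum_tri hδ hδ2 (x n)).mul_left (a n)
  have e : ∑ n ∈ S, a n * tri δ (x n) - δ * ∑ n ∈ S, a n = ∑ n ∈ S, a n * (tri δ (x n) - δ) := by
    rw [mul_sum, ← sum_sub_distrib]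
    exact sum_congr rfl fun n _ => by ring
  rw [e]
  have ht := (continuous_abs.tendsto _).comp hs.tendsto_sum_nat
  refine le_of_tendsto' ht fun K => ?_
  refine (abs_sum_le_sum_abs _ _).trans ?_
  calc ∑ k ∈ range K, |∑ n ∈ S, a n * (triCoeff δ k * Real.cos (2 * Real.pi * (k * x n)))|
      ≤ ∑ k ∈ range K, B * (triCoeff δ k * √(1 + k * δ)) := by
        refine sum_le_sum fun k _ => ?_
        have e1 : ∑ n ∈ S, a n * (triCoeff δ k * Real.cos (2 * Real.pi * (k * x n)))
            = triCoeff δ k * ∑ n ∈ S, a n * Real.cos (2 * Real.pi * (k * x n)) := by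
          rw [mul_sum]
          exact sum_congr rfl fun n _ => by ring
        rw [e1, abs_mul, abs_of_nonneg (triCoeff_nonneg hδ k)]
        rcases Nat.eq_zero_or_pos k with rfl | hk
        · simp [triCoeff]
        · have := h k hk
          have := triCoeff_nonneg hδ k
          calc _ ≤ triCoeff δ k * (B * √(1 + k * δ)) := by gcongr
            _ = _ := by ring
    _ = B * ∑ k ∈ range K, triCoeff δ k * √(1 + k * δ) := by rw [mul_sum]
    _ ≤ B * 16 := by
        have := sum_triCoeff_mul_sqrt_le hδ K
        gcongr
    _ = _ := by ring

end PrimeSquarefree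

namespace PrimeSquarefree

open Finset
open ArithmeticFunction (vonMangoldt)

theorem phase_zero_mul (c Z k t y : ℝ) : phase c Z 0 (k * t) y = k * phase c Z 0 t y := by
  unfold phase; ring

theorem phase_one_eq (c Z t y : ℝ) : phase c Z 1 t y = y ^ c + phase c Z 0 t y := by
  unfold phase; ring

theorem phase_zero_neg (c Z t y : ℝ) : phase c Z 0 (-t) y = -phase c Z 0 t y := by
  unfold phase; ring

theorem norm_sum_ex_phase_zero_le {c Z P t : ℝ} (hc : 1 < c) (hc2 : c ≤ 1.1) (hP : 1 ≤ P)
    (hZ : 4 * (2 * P) ^ c ≤ Z) (ht : 0 < t) :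
    ‖∑ n ∈ Ioc ⌊P⌋₊ ⌊2 * P⌋₊, ex (phase c Z 0 t n)‖ ≤
      180 * (P * √(t * ((c - 1) * P ^ (c - 2))) + 1 / √(t * ((c - 1) * P ^ (c - 2)))) := by
  have hP0 : 0 < P := by linarith
  have hZ0 : 0 < Z := by
    have : 0 < (2 * P) ^ c := by positivity
    linarith
  have hc1 : 0 < c - 1 := by linarith
  set a := t * ((c - 1) * P ^ (c - 2)) with ha
  have ha0 : 0 < a := by positivity
  have hcard := card_Ioc_floor_le hP0.le
  have hs0 : 0 < √a := Real.sqrt_pos.2 ha0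
  have hss : √a * √a = a := Real.mul_self_sqrt ha0.le
  rcases le_or_gt a 1 with h1 | h1
  · have hv := vdc (J := Set.Ioc P (2 * P)) Set.ordConnected_Ioc (phase c Z 0 t) (phase1 c Z 0 t)
      (phase2 c Z 0 t)
      (fun y hy => by
        have := rpow_div_bounds hc hP hZ hy
        exact hasDerivAt_phase 0 t hc hZ0 (by linarith [hy.1]) (by linarith))
      (fun y hy => by
        have := rpow_div_bounds hc hP hZ hy
        exact hasDerivAt_phase1 0 t hc hZ0 (by linarith [hy.1]) (by linarith))
      (lam := a / 2) (Lam := 3 * a) (s := -1) (Or.inr rfl) (by linarith) (by linarith)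
      (fun y hy => by
        have hb := rpow_div_bounds hc hP hZ hy
        have he := eOne_bounds (γ := 1 / c) (by positivity)
          (by rw [div_le_one (by linarith)]; exact hc.le) hb.1 hb.2
        have hy0 : 0 < y := by linarith [hy.1]
        have h2 : P ^ (c - 2) / 2 ≤ y ^ (c - 2) := by
          calc P ^ (c - 2) / 2 = (2 : ℝ) ^ (-1 : ℝ) * P ^ (c - 2) := by
                rw [Real.rpow_neg_one]; ring
            _ ≤ (2 : ℝ) ^ (c - 2) * P ^ (c - 2) := by
                gcongr
                · norm_num
                · linarith
            _ = (2 * P) ^ (c - 2) := by rw [Real.mul_rpow (by norm_num) hP0.le]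
            _ ≤ y ^ (c - 2) := Real.rpow_le_rpow_of_nonpos hy0 hy.2 (by linarith)
        calc a / 2 = t * ((c - 1) * (P ^ (c - 2) / 2)) * 1 := by rw [ha]; ring
          _ ≤ t * ((c - 1) * y ^ (c - 2)) * eOne (1 / c) (y ^ c / Z) := by gcongr; exact he.1
          _ = -1 * phase2 c Z 0 t y := by unfold phase2 gOne; ring)
      (fun y hy => by
        have hb := rpow_div_bounds hc hP hZ hy
        have he := eOne_bounds (γ := 1 / c) (by positivity)
          (by rw [div_le_one (by linarith)]; exact hc.le) hb.1 hb.2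
        have hy0 : 0 < y := by linarith [hy.1]
        have h0 : 0 ≤ eOne (1 / c) (y ^ c / Z) := by linarith [he.1]
        have h2 : y ^ (c - 2) ≤ P ^ (c - 2) :=
          Real.rpow_le_rpow_of_nonpos hP0 hy.1.le (by linarith)
        calc -1 * phase2 c Z 0 t y
            = t * ((c - 1) * y ^ (c - 2)) * eOne (1 / c) (y ^ c / Z) := by
              unfold phase2 gOne; ring
          _ ≤ t * ((c - 1) * P ^ (c - 2)) * 3 := by gcongr; exact he.2
          _ = 3 * a := by rw [ha]; ring)
      (Ioc ⌊P⌋₊ ⌊2 * P⌋₊) (mem_Ioc_floor hP0.le)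
    refine hv.trans ?_
    have hsa1 : √a ≤ 1 := Real.sqrt_le_one.2 h1
    have h2 : 1 / √(a / 2) + 1 ≤ 5 / 2 / √a := by
      have h3 : √a * (2 / 3) ≤ √(a / 2) := by
        apply Real.le_sqrt_of_sq_le
        nlinarith
      calc 1 / √(a / 2) + 1 ≤ 1 / (√a * (2 / 3)) + 1 / √a := by
            gcongr
            rw [le_div_iff₀ hs0]; linarith
        _ = _ := by field_simp; norm_num
    calc 12 * (((Ioc ⌊P⌋₊ ⌊2 * P⌋₊).card : ℝ) * (3 * a) + 1) * (1 / √(a / 2) + 1)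
        ≤ 12 * ((2 * P) * (3 * a) + 1) * (5 / 2 / √a) := by
          gcongr
          linarith
      _ = 180 * (P * (√a * √a / √a)) + 30 * (1 / √a) := by rw [hss]; ring
      _ = 180 * (P * √a) + 30 * (1 / √a) := by rw [mul_div_assoc, div_self hs0.ne', mul_one]
      _ ≤ _ := by
          have : 0 < 1 / √a := by positivity
          linarith
  · have hsa1 : 1 ≤ √a := Real.one_le_sqrt.2 h1.le
    calc _ ≤ ∑ n ∈ Ioc ⌊P⌋₊ ⌊2 * P⌋₊, ‖ex (phase c Z 0 t n)‖ := norm_sum_le _ _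
      _ = ((Ioc ⌊P⌋₊ ⌊2 * P⌋₊).card : ℝ) := by simp only [norm_ex]; simp
      _ ≤ P + 1 := hcard
      _ ≤ 180 * (P * 1 + 0) := by linarith
      _ ≤ _ := by
        have : 0 < 1 / √a := by positivity
        gcongr

/-- Equidistribution of a smooth sequence in short windows. -/
theorem sum_tri_phase_le {c Z P t δ : ℝ} (hc : 1 < c) (hc2 : c ≤ 1.1) (hP : 1 ≤ P)
    (hZ : 4 * (2 * P) ^ c ≤ Z) (ht : 0 < t) (hδ : 0 < δ) (hδ2 : δ ≤ 1 / 2) :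
    ∑ n ∈ Ioc ⌊P⌋₊ ⌊2 * P⌋₊, tri δ (phase c Z 0 t n) ≤ δ * (P + 1) +
      2880 * (P * √(t * ((c - 1) * P ^ (c - 2)) / δ) + 1 / √(t * ((c - 1) * P ^ (c - 2)))) := by
  have hP0 : 0 < P := by linarith
  have hc1 : 0 < c - 1 := by linarith
  set b := t * ((c - 1) * P ^ (c - 2)) with hb
  have hb0 : 0 < b := by positivity
  have h := abs_sum_tri_sub_le (B := 180 * (P * √(b / δ) + 1 / √b)) hδ hδ2 (Ioc ⌊P⌋₊ ⌊2 * P⌋₊)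
    (fun _ => 1) (fun n => phase c Z 0 t n) (fun k hk => by
      have hk1 : (1 : ℝ) ≤ k := by exact_mod_cast hk
      have hk0 : (0 : ℝ) < k := by linarith
      have h1 := norm_sum_ex_phase_zero_le hc hc2 hP hZ (mul_pos hk0 ht)
      rw [mul_assoc, ← hb] at h1
      have h2 := (Complex.abs_re_le_norm _).trans h1
      simp only [Complex.re_sum, ex_re, phase_zero_mul] at h2
      simp only [one_mul]
      refine h2.trans ?_
      have hq1 : 1 ≤ √(1 + k * δ) := Real.one_le_sqrt.2 (by nlinarith)
      have h3 : √(k * b) ≤ √(b / δ) * √(1 + k * δ) := by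
        rw [← Real.sqrt_mul (by positivity)]
        apply Real.sqrt_le_sqrt
        have e : b / δ * (1 + k * δ) = b / δ + k * b := by field_simp
        rw [e]
        have : 0 < b / δ := by positivity
        linarith
      have h4 : 1 / √(k * b) ≤ 1 / √b := by
        have : 0 < √b := Real.sqrt_pos.2 hb0
        gcongr
        nlinarith
      have h5 : 0 < 1 / √b := by
        have : 0 < √b := Real.sqrt_pos.2 hb0
        positivity
      calc 180 * (P * √(k * b) + 1 / √(k * b))
          ≤ 180 * (P * (√(b / δ) * √(1 + k * δ)) + 1 / √b * √(1 + k * δ)) := by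
            gcongr
            nlinarith
        _ = _ := by ring)
  simp only [one_mul, sum_const, nsmul_eq_mul, mul_one] at h
  have h1 := (abs_le.1 h).2
  have h2 := mul_le_mul_of_nonneg_left (card_Ioc_floor_le hP0.le) hδ.le
  linarith

end PrimeSquarefree

namespace PrimeSquarefree

open Finset
open ArithmeticFunction (vonMangoldt)

/-- The size relations between the parameters under which the exponential sums are estimated. -/
structure Admissible (c Z P X : ℝ) : Prop where
  one_lt : 1 < c
  le_c : c ≤ 1.1
  four_mul_le : 4 * (2 * P) ^ c ≤ Z
  one_le : 1 ≤ X
  large : 10000 ≤ X ^ (0.0001 : ℝ)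
  log_le : Real.log (2 * P) + 6 ≤ X ^ (0.0001 : ℝ)
  le_X : P ≤ X
  X_le : X ^ (0.9999 : ℝ) ≤ P
  Q_le : X ^ (-0.0001 : ℝ) * Z ≤ (c - 1) * P ^ c
  Z_le : Z ≤ X ^ (1.0385 : ℝ)
  le_Z : X ^ (0.999 : ℝ) ≤ Z

namespace Admissible

variable {c Z P X : ℝ}

theorem one_le_P (h : Admissible c Z P X) : 1 ≤ P :=
  (Real.one_le_rpow h.one_le (by norm_num)).trans h.X_le

theorem abs_sum_cos_le (h : Admissible c Z P X) {j t : ℝ} (hj : j = 0 ∨ j = 1)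
    (hT : X ^ (0.999 : ℝ) ≤ (j + |t|) * Z) :
    |∑ n ∈ Ioc ⌊P⌋₊ ⌊2 * P⌋₊, vonMangoldt n * Real.cos (2 * Real.pi * phase c Z j t n)|
      ≤ X ^ (0.9616 : ℝ) * √(1 + |t|) := by
  have h1 := norm_sum_phase_le h.one_lt h.le_c h.four_mul_le hj h.one_le h.large h.log_le h.le_X
    h.X_le h.Q_le h.Z_le hT
  have h2 := (Complex.abs_re_le_norm _).trans h1
  simpa only [Complex.re_sum, Complex.re_ofReal_mul, ex_re] using h2

theorem abs_sum_cos_rpow_le (h : Admissible c Z P X) :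
    |∑ n ∈ Ioc ⌊P⌋₊ ⌊2 * P⌋₊, vonMangoldt n * Real.cos (2 * Real.pi * (n : ℝ) ^ c)|
      ≤ X ^ (0.9616 : ℝ) := by
  have h1 := h.abs_sum_cos_le (j := 1) (t := 0) (Or.inr rfl) (by simpa using h.le_Z)
  simpa [phase] using h1

theorem abs_sum_cos_mul_le (h : Admissible c Z P X) {t : ℝ} (ht : 0 ≤ t) :
    |∑ n ∈ Ioc ⌊P⌋₊ ⌊2 * P⌋₊, vonMangoldt n * (Real.cos (2 * Real.pi * (n : ℝ) ^ c) *
      Real.cos (2 * Real.pi * phase c Z 0 t n))| ≤ X ^ (0.9616 : ℝ) * √(1 + t) := by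
  have hZ0 : 0 ≤ Z := by
    have := h.le_Z
    have : 0 ≤ X ^ (0.999 : ℝ) := Real.rpow_nonneg (by linarith [h.one_le]) _
    linarith
  have hT : X ^ (0.999 : ℝ) ≤ (1 + |t|) * Z := by
    have := h.le_Z
    have := abs_nonneg t
    nlinarith
  have h1 := h.abs_sum_cos_le (j := 1) (t := t) (Or.inr rfl) hT
  have h2 := h.abs_sum_cos_le (j := 1) (t := -t) (Or.inr rfl) (by rwa [abs_neg])
  rw [abs_neg] at h2
  rw [abs_of_nonneg ht] at h1 h2
  have e : ∑ n ∈ Ioc ⌊P⌋₊ ⌊2 * P⌋₊, vonMangoldt n * (Real.cos (2 * Real.pi * (n : ℝ) ^ c) *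
      Real.cos (2 * Real.pi * phase c Z 0 t n)) =
      1 / 2 * (∑ n ∈ Ioc ⌊P⌋₊ ⌊2 * P⌋₊, vonMangoldt n * Real.cos (2 * Real.pi * phase c Z 1 t n)
      + ∑ n ∈ Ioc ⌊P⌋₊ ⌊2 * P⌋₊, vonMangoldt n * Real.cos (2 * Real.pi * phase c Z 1 (-t) n)) := by
    rw [← sum_add_distrib, mul_sum]
    refine sum_congr rfl fun n _ => ?_
    simp only [phase_one_eq, phase_zero_neg, mul_add, mul_neg, Real.cos_add, Real.cos_neg,
      Real.sin_neg]
    ring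
  rw [e, abs_mul, abs_of_nonneg (by norm_num : (0 : ℝ) ≤ 1 / 2)]
  have h3 := abs_add_le
    (∑ n ∈ Ioc ⌊P⌋₊ ⌊2 * P⌋₊, vonMangoldt n * Real.cos (2 * Real.pi * phase c Z 1 t n))
    (∑ n ∈ Ioc ⌊P⌋₊ ⌊2 * P⌋₊, vonMangoldt n * Real.cos (2 * Real.pi * phase c Z 1 (-t) n))
  linarith

theorem sqrt_one_add_le {δ s : ℝ} (hδ : 0 ≤ δ) (hs : s ≤ 100 * δ) :
    √(1 + s) ≤ 10 * √(1 + δ) := by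
  rw [Real.sqrt_le_left (by positivity), mul_pow, Real.sq_sqrt (by linarith)]
  linarith

theorem abs_sum_tri_sub_le (h : Admissible c Z P X) {δ : ℝ} (hδ : 0 < δ) (hδ2 : δ ≤ 1 / 2)
    (hT : X ^ (0.999 : ℝ) ≤ 100 * δ * Z) :
    |∑ n ∈ Ioc ⌊P⌋₊ ⌊2 * P⌋₊, vonMangoldt n * tri δ (phase c Z 0 (100 * δ) n)
      - δ * ∑ n ∈ Ioc ⌊P⌋₊ ⌊2 * P⌋₊, vonMangoldt n| ≤ 160 * X ^ (0.9616 : ℝ) := by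
  have hX0 : 0 ≤ X := by linarith [h.one_le]
  have h1 := PrimeSquarefree.abs_sum_tri_sub_le (B := 10 * X ^ (0.9616 : ℝ)) hδ hδ2
    (Ioc ⌊P⌋₊ ⌊2 * P⌋₊) (fun n => vonMangoldt n) (fun n => phase c Z 0 (100 * δ) n) (fun k hk => by
      have hk1 : (1 : ℝ) ≤ k := by exact_mod_cast hk
      have ht : 0 ≤ k * (100 * δ) := by positivity
      have h2 := h.abs_sum_cos_le (j := 0) (t := k * (100 * δ)) (Or.inl rfl) (by
        have hZ0 : 0 ≤ 100 * δ * Z := le_trans (Real.rpow_nonneg hX0 _) hT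
        rw [zero_add, abs_of_nonneg ht]
        nlinarith)
      rw [abs_of_nonneg ht] at h2
      simp only [phase_zero_mul c Z (k : ℝ)] at h2
      refine h2.trans ?_
      have h3 := sqrt_one_add_le (δ := k * δ) (s := k * (100 * δ)) (by positivity)
        (le_of_eq (by ring))
      calc _ ≤ X ^ (0.9616 : ℝ) * (10 * √(1 + k * δ)) := by gcongr
        _ = _ := by ring)
  linarith

theorem abs_sum_weight_tri_sub_le (h : Admissible c Z P X) {δ : ℝ} (hδ : 0 < δ) (hδ2 : δ ≤ 1 / 2)
    (hT : X ^ (0.999 : ℝ) ≤ 100 * δ * Z) :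
    |∑ n ∈ Ioc ⌊P⌋₊ ⌊2 * P⌋₊, vonMangoldt n * (1 - Real.cos (2 * Real.pi * (n : ℝ) ^ c)) *
        tri δ (phase c Z 0 (100 * δ) n)
      - δ * ∑ n ∈ Ioc ⌊P⌋₊ ⌊2 * P⌋₊, vonMangoldt n * (1 - Real.cos (2 * Real.pi * (n : ℝ) ^ c))|
      ≤ 320 * X ^ (0.9616 : ℝ) := by
  have hX0 : 0 ≤ X := by linarith [h.one_le]
  have h1 := PrimeSquarefree.abs_sum_tri_sub_le (B := 20 * X ^ (0.9616 : ℝ)) hδ hδ2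
    (Ioc ⌊P⌋₊ ⌊2 * P⌋₊) (fun n => vonMangoldt n * (1 - Real.cos (2 * Real.pi * (n : ℝ) ^ c)))
    (fun n => phase c Z 0 (100 * δ) n) (fun k hk => by
      have hk1 : (1 : ℝ) ≤ k := by exact_mod_cast hk
      have ht : 0 ≤ k * (100 * δ) := by positivity
      have h2 := h.abs_sum_cos_le (j := 0) (t := k * (100 * δ)) (Or.inl rfl) (by
        have hZ0 : 0 ≤ 100 * δ * Z := le_trans (Real.rpow_nonneg hX0 _) hT
        rw [zero_add, abs_of_nonneg ht]
        nlinarith)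
      have h4 := h.abs_sum_cos_mul_le ht
      rw [abs_of_nonneg ht] at h2
      simp only [phase_zero_mul c Z (k : ℝ)] at h2 h4
      have h3 := sqrt_one_add_le (δ := k * δ) (s := k * (100 * δ)) (by positivity)
        (le_of_eq (by ring))
      have e : ∑ n ∈ Ioc ⌊P⌋₊ ⌊2 * P⌋₊, vonMangoldt n *
          (1 - Real.cos (2 * Real.pi * (n : ℝ) ^ c)) *
          Real.cos (2 * Real.pi * (k * phase c Z 0 (100 * δ) n)) =
          ∑ n ∈ Ioc ⌊P⌋₊ ⌊2 * P⌋₊, vonMangoldt n *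
            Real.cos (2 * Real.pi * (k * phase c Z 0 (100 * δ) n)) -
          ∑ n ∈ Ioc ⌊P⌋₊ ⌊2 * P⌋₊, vonMangoldt n * (Real.cos (2 * Real.pi * (n : ℝ) ^ c) *
            Real.cos (2 * Real.pi * (k * phase c Z 0 (100 * δ) n))) := by
        rw [← sum_sub_distrib]
        exact sum_congr rfl fun n _ => by ring
      rw [e]
      refine (abs_sub _ _).trans ((add_le_add h2 h4).trans ?_)
      calc _ = 2 * (X ^ (0.9616 : ℝ) * √(1 + k * (100 * δ))) := by ring
        _ ≤ 2 * (X ^ (0.9616 : ℝ) * (10 * √(1 + k * δ))) := by gcongr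
        _ = _ := by ring)
  linarith

theorem abs_sum_weight_sub_le (h : Admissible c Z P X) :
    |∑ n ∈ Ioc ⌊P⌋₊ ⌊2 * P⌋₊, vonMangoldt n * (1 - Real.cos (2 * Real.pi * (n : ℝ) ^ c)) -
      ∑ n ∈ Ioc ⌊P⌋₊ ⌊2 * P⌋₊, vonMangoldt n| ≤ X ^ (0.9616 : ℝ) := by
  rw [← sum_sub_distrib]
  have e : ∑ n ∈ Ioc ⌊P⌋₊ ⌊2 * P⌋₊, (vonMangoldt n *
      (1 - Real.cos (2 * Real.pi * (n : ℝ) ^ c)) - vonMangoldt n) =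
      -∑ n ∈ Ioc ⌊P⌋₊ ⌊2 * P⌋₊, vonMangoldt n * Real.cos (2 * Real.pi * (n : ℝ) ^ c) := by
    rw [← sum_neg_distrib]
    exact sum_congr rfl fun n _ => by ring
  rw [e, abs_neg]
  exact h.abs_sum_cos_rpow_le

end Admissible

end PrimeSquarefree

namespace PrimeSquarefree

open Finset
open ArithmeticFunction (vonMangoldt)

theorem phase_zero_rpow {c Z y : ℝ} (hZ : 0 < Z) (h : 0 ≤ 1 - y ^ c / Z) :
    phase c Z 0 (Z ^ (1 / c - 1)) y = (Z - y ^ c) ^ (1 / c) := by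
  have e : Z - y ^ c = Z * (1 - y ^ c / Z) := by field_simp
  unfold phase
  rw [e, Real.mul_rpow hZ.le h, ← Real.rpow_add_one hZ.ne', sub_add_cancel]
  ring

theorem rpow_sub_rpow_le {c x y : ℝ} (hc : 1 ≤ c) (hx : 0 ≤ x) (hy : 0 < y) :
    y ^ c - x ^ c ≤ c * y ^ (c - 1) * (y - x) := by
  have h := one_add_mul_self_le_rpow_one_add (s := x / y - 1)
    (by have := div_nonneg hx hy.le; linarith) hc
  rw [add_sub_cancel, Real.div_rpow hx hy.le] at h
  have hyc : 0 < y ^ c := Real.rpow_pos_of_pos hy c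
  rw [le_div_iff₀ hyc] at h
  have e : y ^ c = y ^ (c - 1) * y := by rw [← Real.rpow_add_one hy.ne']; congr 1; ring
  have e2 : c * y ^ (c - 1) * (y - x) = -(c * (x / y - 1) * y ^ c) := by
    rw [e]; field_simp; ring
  linarith

theorem abs_rpow_sub_rpow_lt {c Z x y : ℝ} (hc : 1 < c) (hc2 : c ≤ 1.1) (hZ : 1 ≤ Z) (hx : 0 < x)
    (hy : 0 < y) (hxZ : x ≤ Z ^ (1 / c)) (h : |x - y| < Z ^ (1 / c - 1) / 100) :
    |x ^ c - y ^ c| < 1 / 40 := by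
  have hZ0 : 0 < Z := by linarith
  have hc0 : 0 < c := by linarith
  have hB : ∀ z : ℝ, 0 ≤ z → z ≤ 2 * Z ^ (1 / c) →
      c * z ^ (c - 1) * (Z ^ (1 / c - 1) / 100) ≤ 22 / 1000 := by
    intro z hz hzz
    have h1 : z ^ (c - 1) ≤ 2 * Z ^ (1 - 1 / c) := by
      calc z ^ (c - 1) ≤ (2 * Z ^ (1 / c)) ^ (c - 1) := by gcongr
        _ = 2 ^ (c - 1) * Z ^ (1 - 1 / c) := by
          rw [Real.mul_rpow (by norm_num) (by positivity), ← Real.rpow_mul hZ0.le]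
          congr 2
          field_simp
        _ ≤ 2 ^ (1 : ℝ) * Z ^ (1 - 1 / c) := by
          gcongr
          · norm_num
          · linarith
        _ = _ := by rw [Real.rpow_one]
    calc c * z ^ (c - 1) * (Z ^ (1 / c - 1) / 100)
        ≤ 1.1 * (2 * Z ^ (1 - 1 / c)) * (Z ^ (1 / c - 1) / 100) := by gcongr
      _ = 22 / 1000 * (Z ^ (1 - 1 / c) * Z ^ (1 / c - 1)) := by ring
      _ = 22 / 1000 := by
        rw [← Real.rpow_add hZ0, sub_add_sub_cancel, sub_self, Real.rpow_zero, mul_one]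
  have hb1 : Z ^ (1 / c - 1) ≤ 1 := Real.rpow_le_one_of_one_le_of_nonpos hZ (by
    rw [sub_nonpos, div_le_one hc0]; exact hc.le)
  have hz1 : 1 ≤ Z ^ (1 / c) := Real.one_le_rpow hZ (by positivity)
  rw [abs_lt] at h
  rw [abs_lt]
  constructor
  · rcases le_total x y with hxy | hxy
    · have h1 := rpow_sub_rpow_le hc.le hx.le hy
      have h2 := hB y hy.le (by linarith)
      have h3 : c * y ^ (c - 1) * (y - x) ≤ c * y ^ (c - 1) * (Z ^ (1 / c - 1) / 100) := by
        gcongr; linarith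
      linarith
    · have := Real.rpow_le_rpow hy.le hxy hc0.le
      linarith
  · rcases le_total y x with hxy | hxy
    · have h1 := rpow_sub_rpow_le hc.le hy.le hx
      have h2 := hB x hx.le (by linarith)
      have h3 : c * x ^ (c - 1) * (x - y) ≤ c * x ^ (c - 1) * (Z ^ (1 / c - 1) / 100) := by
        gcongr; linarith
      linarith
    · have := Real.rpow_le_rpow hx.le hxy hc0.le
      linarith

theorem floor_add_floor_eq {u v : ℝ} {N : ℤ} (h : |v - (N + 39 / 40 - u)| < 1 / 40)
    (hu : Int.fract u < 19 / 20) : ⌊u⌋ + ⌊v⌋ = N := by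
  have e : ⌊v⌋ = N - ⌊u⌋ := by
    rw [Int.floor_eq_iff]
    have := Int.floor_add_fract u
    have := Int.fract_nonneg u
    rw [abs_lt] at h
    push_cast
    constructor <;> linarith
  rw [e]; ring

theorem one_sub_cos_le {u : ℝ} (hu : 19 / 20 ≤ Int.fract u) :
    1 - Real.cos (2 * Real.pi * u) ≤ 1 / 20 := by
  have e : 2 * Real.pi * u = ((⌊u⌋ + 1 : ℤ) : ℝ) * (2 * Real.pi) -
      2 * Real.pi * (1 - Int.fract u) := by
    have := Int.floor_add_fract u
    push_cast
    rw [Int.fract]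
    ring
  rw [e, Real.cos_int_mul_two_pi_sub]
  have h1 := Real.one_sub_sq_div_two_le_cos (x := 2 * Real.pi * (1 - Int.fract u))
  have h2 := Int.fract_lt_one u
  have h3 := Real.pi_lt_d2
  have h4 := Real.pi_gt_three
  have h5 : 2 * Real.pi * (1 - Int.fract u) ≤ 2 * 3.15 * (1 / 20) := by
    have : 1 - Int.fract u ≤ 1 / 20 := by linarith
    gcongr
  have h6 : 0 ≤ 2 * Real.pi * (1 - Int.fract u) := by
    have : 0 ≤ 1 - Int.fract u := by linarith
    positivity
  nlinarith

/-- Few integers can be matched injectively with multiples of large squares. -/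
theorem card_le_of_sq_dvd {S : Finset ℕ} {l : ℕ → ℕ} {Q M : ℕ} (hQ : Q ≠ 0)
    (hl : Set.InjOn l S) (hM : ∀ n ∈ S, 1 ≤ l n ∧ l n ≤ M)
    (h : ∀ n ∈ S, ∃ d, Q < d ∧ d ^ 2 ∣ l n) : (S.card : ℝ) ≤ M / Q := by
  have h1 : S.image l ⊆ (Ioc Q M).biUnion fun d => (Ioc 0 M).filter (d ^ 2 ∣ ·) := by
    intro m hm
    obtain ⟨n, hn, rfl⟩ := mem_image.1 hm
    obtain ⟨d, hd, hdl⟩ := h n hn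
    obtain ⟨h2, h3⟩ := hM n hn
    have h4 := Nat.le_of_dvd h2 hdl
    rw [mem_biUnion]
    refine ⟨d, mem_Ioc.2 ⟨hd, ?_⟩, mem_filter.2 ⟨mem_Ioc.2 ⟨h2, h3⟩, hdl⟩⟩
    nlinarith
  have h2 : (S.card : ℝ) ≤ ∑ d ∈ Ioc Q M, (M : ℝ) * ((d : ℝ) ^ 2)⁻¹ := by
    calc (S.card : ℝ) = ((S.image l).card : ℝ) := by rw [card_image_of_injOn hl]
      _ ≤ (((Ioc Q M).biUnion fun d => (Ioc 0 M).filter (d ^ 2 ∣ ·)).card : ℝ) := by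
        exact_mod_cast card_le_card h1
      _ ≤ ((∑ d ∈ Ioc Q M, ((Ioc 0 M).filter (d ^ 2 ∣ ·)).card : ℕ) : ℝ) := by
        exact_mod_cast card_biUnion_le
      _ ≤ _ := by
        push_cast
        refine sum_le_sum fun d _ => ?_
        rw [Nat.Ioc_filter_dvd_card_eq_div, ← div_eq_mul_inv]
        exact_mod_cast Nat.cast_div_le (α := ℝ) (m := M) (n := d ^ 2)
  refine h2.trans ?_
  rw [← mul_sum]
  rcases le_or_gt Q M with hQM | hQM
  · have h3 := sum_Ioc_inv_sq_le_sub (α := ℝ) hQ hQM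
    have h4 : (0 : ℝ) ≤ (M : ℝ)⁻¹ := by positivity
    rw [div_eq_mul_inv]
    gcongr
    linarith
  · rw [Ioc_eq_empty (by omega), sum_empty, mul_zero]
    positivity

end PrimeSquarefree

namespace PrimeSquarefree

open Finset
open ArithmeticFunction (vonMangoldt)

theorem exists_sq_dvd_of_not_squarefree {l : ℕ} (h : ¬ Squarefree l) : ∃ d, 2 ≤ d ∧ d ^ 2 ∣ l := by
  rw [Nat.squarefree_iff_prime_squarefree] at h
  push Not at h
  obtain ⟨p, hp, hd⟩ := h
  exact ⟨p, hp.two_le, by rwa [sq]⟩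

theorem tri_le_tri_div {δ x : ℝ} (hδ : 0 < δ) {d : ℕ} (hd : 0 < d) (hdl : (d : ℤ) ^ 2 ∣ round x) :
    tri δ x ≤ tri (δ / (d : ℝ) ^ 2) (x / (d : ℝ) ^ 2) := by
  have hd0 : (0 : ℝ) < d := by exact_mod_cast hd
  obtain ⟨m, hm⟩ := hdl
  refine max_le (tri_nonneg _ _) ?_
  refine le_trans (le_of_eq ?_) (le_tri (by positivity) _ m)
  have e : x / (d : ℝ) ^ 2 - m = (x - round x) / (d : ℝ) ^ 2 := by
    rw [hm]; push_cast; field_simp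
  rw [e, abs_div, abs_of_pos (by positivity : (0 : ℝ) < (d : ℝ) ^ 2)]
  field_simp

theorem abs_sub_round_lt_of_tri_pos {δ x : ℝ} (hδ : 0 < δ) (h : 0 < tri δ x) :
    |x - round x| < δ := by
  by_contra! hc
  have h1 : 1 - |x - round x| / δ ≤ 0 := by
    rw [sub_nonpos, one_le_div hδ]; exact hc
  have : tri δ x = 0 := max_eq_left h1
  linarith

/-- Comparison of the sifted window sum with the count `G` of the wanted representations. -/
theorem sum_sifted_le {c Z P β δ : ℝ} {N : ℤ} (hc : 1 < c) (hc2 : c ≤ 1.1) (hP : 1 ≤ P)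
    (hZ : 4 * (2 * P) ^ c ≤ Z) (hN : Z = N + 39 / 40) (hβ : β = Z ^ (1 / c - 1))
    (hδ : δ = β / 100) {Q : ℕ} (hQ : Q ≠ 0) (G : ℕ → ℝ) (hG0 : ∀ n, 0 ≤ G n)
    (hG : ∀ n ∈ Ioc ⌊P⌋₊ ⌊2 * P⌋₊, ∀ l : ℕ, Squarefree l →
      ⌊(n : ℝ) ^ c⌋ + ⌊(l : ℝ) ^ c⌋ = N → Real.log n ≤ G n) :
    ∑ n ∈ Ioc ⌊P⌋₊ ⌊2 * P⌋₊, vonMangoldt n * (1 - Real.cos (2 * Real.pi * (n : ℝ) ^ c)) *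
        (tri δ (phase c Z 0 β n) - ∑ d ∈ Ioc 1 Q, tri (δ / (d : ℝ) ^ 2)
          (phase c Z 0 β n / (d : ℝ) ^ 2)) ≤
      2 * ∑ n ∈ (Ioc ⌊P⌋₊ ⌊2 * P⌋₊).filter Nat.Prime, G n +
      2 * ∑ n ∈ (Ioc ⌊P⌋₊ ⌊2 * P⌋₊).filter (fun n => ¬ n.Prime), vonMangoldt n +
      1 / 20 * ∑ n ∈ Ioc ⌊P⌋₊ ⌊2 * P⌋₊, vonMangoldt n * tri δ (phase c Z 0 β n) +
      2 * Real.log (2 * P) * (2 * Z ^ (1 / c) / Q) := by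
  classical
  have hP0 : 0 < P := by linarith
  have hc0 : 0 < c := by linarith
  have hZ8 : 8 ≤ Z := by
    have h1 : (2 : ℝ) ≤ (2 * P) ^ c := by
      calc (2 : ℝ) ≤ 2 * P := by linarith
        _ = (2 * P) ^ (1 : ℝ) := (Real.rpow_one _).symm
        _ ≤ (2 * P) ^ c := Real.rpow_le_rpow_of_exponent_le (by linarith) hc.le
    linarith
  have hZ0 : 0 < Z := by linarith
  have hβ0 : 0 < β := by rw [hβ]; positivity
  have hβ1 : β ≤ 1 := by
    rw [hβ]
    exact Real.rpow_le_one_of_one_le_of_nonpos (by linarith) (by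
      rw [sub_nonpos, div_le_one hc0]; exact hc.le)
  have hδ0 : 0 < δ := by rw [hδ]; positivity
  have hδ2 : δ ≤ 1 / 100 := by rw [hδ]; linarith
  set I := Ioc ⌊P⌋₊ ⌊2 * P⌋₊ with hI
  set Y : ℕ → ℝ := fun n => phase c Z 0 β n with hY
  have hlogP : 0 ≤ Real.log (2 * P) := Real.log_nonneg (by linarith)
  have hmem : ∀ n ∈ I, (n : ℝ) ∈ Set.Ioc P (2 * P) := fun n hn => (mem_Ioc_floor hP0.le n).1 hn
  have hpos : ∀ n ∈ I, 0 ≤ (n : ℝ) ^ c ∧ (n : ℝ) ^ c ≤ Z / 4 := by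
    intro n hn
    have h := rpow_div_bounds hc hP hZ (hmem n hn)
    rw [div_le_iff₀ hZ0] at h
    exact ⟨by positivity, by linarith⟩
  have hYeq : ∀ n ∈ I, Y n = (Z - (n : ℝ) ^ c) ^ (1 / c) := by
    intro n hn
    have h := rpow_div_bounds hc hP hZ (hmem n hn)
    simp only [hY, hβ]
    exact phase_zero_rpow hZ0 (by linarith)
  have hY1 : ∀ n ∈ I, 1 ≤ Y n := by
    intro n hn
    rw [hYeq n hn]
    exact Real.one_le_rpow (by linarith [hpos n hn]) (by positivity)
  have hYc : ∀ n ∈ I, Y n ^ c = Z - (n : ℝ) ^ c := by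
    intro n hn
    rw [hYeq n hn, ← Real.rpow_mul (by linarith [hpos n hn]), one_div, inv_mul_cancel₀ hc0.ne',
      Real.rpow_one]
  have hYZ : ∀ n ∈ I, Y n ≤ Z ^ (1 / c) := by
    intro n hn
    rw [hYeq n hn]
    have := hpos n hn
    gcongr <;> linarith
  set l : ℕ → ℕ := fun n => (round (Y n)).toNat with hl
  have hl1 : ∀ n ∈ I, 1 ≤ round (Y n) := by
    intro n hn
    have h1 := abs_le.1 (abs_sub_round (Y n))
    have h2 := hY1 n hn
    have h3 : (0 : ℝ) < round (Y n) := by linarith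
    have : 0 < round (Y n) := by exact_mod_cast h3
    omega
  have hlZ : ∀ n ∈ I, ((l n : ℕ) : ℤ) = round (Y n) := by
    intro n hn
    have := hl1 n hn
    simp only [hl]
    omega
  have hlR : ∀ n ∈ I, ((l n : ℕ) : ℝ) = round (Y n) := by
    intro n hn
    rw [← hlZ n hn]; simp
  have hkey : ∀ n ∈ I, 0 < tri δ (Y n) →
      |((l n : ℕ) : ℝ) ^ c - (N + 39 / 40 - (n : ℝ) ^ c)| < 1 / 40 := by
    intro n hn ht
    have h1 := abs_sub_round_lt_of_tri_pos hδ0 ht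
    rw [← hlR n hn, hδ, hβ] at h1
    have hlpos : (0 : ℝ) < l n := by
      rw [hlR n hn]
      exact_mod_cast hl1 n hn
    have h2 := abs_rpow_sub_rpow_lt hc hc2 (by linarith) (by linarith [hY1 n hn]) hlpos
      (hYZ n hn) h1
    rw [hYc n hn, abs_sub_comm, hN] at h2
    exact h2
  set L := I.filter (fun n => 0 < tri δ (Y n) ∧ ∃ d, Q < d ∧ d ^ 2 ∣ l n) with hLdef
  have hLcard : (L.card : ℝ) ≤ 2 * Z ^ (1 / c) / Q := by
    have h0 : 1 ≤ Z ^ (1 / c) := Real.one_le_rpow (by linarith) (by positivity)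
    have h1 := card_le_of_sq_dvd (S := L) (l := l) (Q := Q) (M := ⌊2 * Z ^ (1 / c)⌋₊) hQ
      (by
        have key : ∀ n ∈ L, ∀ n' ∈ L, n < n' → l n ≠ l n' := by
          intro n hn n' hn' hlt he
          obtain ⟨hnI, ht, -⟩ := mem_filter.1 hn
          obtain ⟨hnI', ht', -⟩ := mem_filter.1 hn'
          have h1 := abs_lt.1 (hkey n hnI ht)
          have h2 := abs_lt.1 (hkey n' hnI' ht')
          rw [he] at h1
          have hn1 : (1 : ℝ) ≤ n := by linarith [(hmem n hnI).1]
          have hlt' : (n : ℝ) + 1 ≤ n' := by exact_mod_cast hlt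
          have h3 := rpow_mul_sub_le hc.le (by linarith) (by linarith : (n : ℝ) ≤ n')
          have h4 : (1 : ℝ) ≤ (n : ℝ) ^ (c - 1) := Real.one_le_rpow hn1 (by linarith)
          nlinarith
        intro n hn n' hn' he
        by_contra hne
        rcases Nat.lt_or_gt_of_ne hne with h | h
        · exact key n hn n' hn' h he
        · exact key n' hn' n hn h he.symm)
      (by
        intro n hn
        obtain ⟨hnI, ht, -⟩ := mem_filter.1 hn
        have h1 := hl1 n hnI
        have h2 := hlZ n hnI
        refine ⟨by omega, Nat.le_floor ?_⟩
        rw [hlR n hnI]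
        have h3 := abs_le.1 (abs_sub_round (Y n))
        linarith [hYZ n hnI])
      (fun n hn => (mem_filter.1 hn).2.2)
    refine h1.trans ?_
    gcongr
    exact Nat.floor_le (by positivity)
  have hpt : ∀ n ∈ I, vonMangoldt n * (1 - Real.cos (2 * Real.pi * (n : ℝ) ^ c)) *
        (tri δ (Y n) - ∑ d ∈ Ioc 1 Q, tri (δ / (d : ℝ) ^ 2) (Y n / (d : ℝ) ^ 2)) ≤
      2 * (if n.Prime then G n else 0) + 2 * (if ¬ n.Prime then vonMangoldt n else 0) +
      1 / 20 * (vonMangoldt n * tri δ (Y n)) +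
      2 * Real.log (2 * P) * (if 0 < tri δ (Y n) ∧ ∃ d, Q < d ∧ d ^ 2 ∣ l n then 1 else 0) := by
    intro n hn
    have hΛ : (0 : ℝ) ≤ vonMangoldt n := ArithmeticFunction.vonMangoldt_nonneg
    have hΛlog : vonMangoldt n ≤ Real.log n := ArithmeticFunction.vonMangoldt_le_log
    have hn1 := hmem n hn
    have hlog : Real.log n ≤ Real.log (2 * P) := Real.log_le_log (by linarith [hn1.1]) hn1.2
    have hw0 : 0 ≤ 1 - Real.cos (2 * Real.pi * (n : ℝ) ^ c) := by
      linarith [Real.cos_le_one (2 * Real.pi * (n : ℝ) ^ c)]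
    have hw2 : 1 - Real.cos (2 * Real.pi * (n : ℝ) ^ c) ≤ 2 := by
      linarith [Real.neg_one_le_cos (2 * Real.pi * (n : ℝ) ^ c)]
    have ht0 := tri_nonneg δ (Y n)
    have ht1 := tri_le_one hδ0 (Y n)
    have hs0 : 0 ≤ ∑ d ∈ Ioc 1 Q, tri (δ / (d : ℝ) ^ 2) (Y n / (d : ℝ) ^ 2) :=
      sum_nonneg fun d _ => tri_nonneg _ _
    have hr1 : 0 ≤ 2 * (if n.Prime then G n else 0) := by
      split_ifs
      · linarith [hG0 n]
      · simp
    have hr2 : 0 ≤ 2 * (if ¬ n.Prime then (vonMangoldt n : ℝ) else 0) := by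
      split_ifs <;> simp [hΛ]
    have hr3 : 0 ≤ 1 / 20 * (vonMangoldt n * tri δ (Y n)) := by positivity
    have hr4 : 0 ≤ 2 * Real.log (2 * P) *
        (if 0 < tri δ (Y n) ∧ ∃ d, Q < d ∧ d ^ 2 ∣ l n then (1 : ℝ) else 0) := by
      split_ifs <;> simp [hlogP]
    set w := 1 - Real.cos (2 * Real.pi * (n : ℝ) ^ c) with hw
    set s := ∑ d ∈ Ioc 1 Q, tri (δ / (d : ℝ) ^ 2) (Y n / (d : ℝ) ^ 2) with hs
    have hΛw : 0 ≤ vonMangoldt n * w := mul_nonneg hΛ hw0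
    have hup : vonMangoldt n * w * (tri δ (Y n) - s) ≤ vonMangoldt n * w * tri δ (Y n) :=
      mul_le_mul_of_nonneg_left (by linarith) hΛw
    have hup2 : vonMangoldt n * w * tri δ (Y n) ≤ vonMangoldt n * 2 * 1 := by gcongr
    rcases ht0.eq_or_lt with ht | ht
    · have h1 : vonMangoldt n * w * tri δ (Y n) = 0 := by rw [← ht, mul_zero]
      linarith
    by_cases hsf : Squarefree (l n)
    · rcases lt_or_ge (Int.fract ((n : ℝ) ^ c)) (19 / 20) with hf | hf
      · by_cases hp : n.Prime
        · have h1 := hG n hn (l n) hsf (floor_add_floor_eq (hkey n hn ht) hf)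
          rw [if_pos hp] at hr1 ⊢
          linarith
        · rw [if_pos hp] at hr2 ⊢
          linarith
      · have h1 := one_sub_cos_le hf
        rw [← hw] at h1
        have h2 : vonMangoldt n * w * tri δ (Y n) ≤ vonMangoldt n * (1 / 20) * tri δ (Y n) := by
          gcongr
        linarith
    · obtain ⟨d, hd2, hd⟩ := exists_sq_dvd_of_not_squarefree hsf
      rcases le_or_gt d Q with hdQ | hdQ
      · have h1 : tri δ (Y n) ≤ tri (δ / (d : ℝ) ^ 2) (Y n / (d : ℝ) ^ 2) := by
          refine tri_le_tri_div hδ0 (by omega) ?_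
          rw [← hlZ n hn]
          exact_mod_cast hd
        have h2 : tri (δ / (d : ℝ) ^ 2) (Y n / (d : ℝ) ^ 2) ≤ s :=
          single_le_sum (f := fun d : ℕ => tri (δ / (d : ℝ) ^ 2) (Y n / (d : ℝ) ^ 2))
            (fun d _ => tri_nonneg _ _) (mem_Ioc.2 ⟨by omega, hdQ⟩)
        have h3 : vonMangoldt n * w * (tri δ (Y n) - s) ≤ 0 :=
          mul_nonpos_of_nonneg_of_nonpos hΛw (by linarith)
        linarith
      · have h1 : 0 < tri δ (Y n) ∧ ∃ d, Q < d ∧ d ^ 2 ∣ l n := ⟨ht, d, hdQ, hd⟩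
        rw [if_pos h1]
        linarith
  refine (sum_le_sum hpt).trans ?_
  rw [sum_add_distrib, sum_add_distrib, sum_add_distrib, ← mul_sum, ← mul_sum, ← mul_sum,
    ← mul_sum, ← sum_filter, ← sum_filter, ← sum_filter, ← hLdef, sum_const, nsmul_eq_mul, mul_one]
  gcongr

end PrimeSquarefree

namespace PrimeSquarefree

open Finset
open ArithmeticFunction (vonMangoldt)

theorem sum_Ioc_one_inv_sq_le (Q : ℕ) : ∑ d ∈ Ioc 1 Q, ((d : ℝ) ^ 2)⁻¹ ≤ 3 / 4 := by
  rcases le_or_gt Q 1 with h | h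
  · rw [Ioc_eq_empty (by omega), sum_empty]; norm_num
  · rw [← sum_Ioc_consecutive _ (by norm_num : 1 ≤ 2) h]
    have h1 := sum_Ioc_inv_sq_le_sub (α := ℝ) two_ne_zero h
    have h2 : (0 : ℝ) ≤ (Q : ℝ)⁻¹ := by positivity
    have e : ∑ d ∈ Ioc (1 : ℕ) 2, ((d : ℝ) ^ 2)⁻¹ = 1 / 4 := by
      rw [show Ioc (1 : ℕ) 2 = {2} from rfl, sum_singleton]; norm_num
    rw [e]
    push_cast at h1
    linarith

namespace Admissible

variable {c Z P X : ℝ}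

theorem mean_lower_bound (h : Admissible c Z P X) {β : ℝ} (hT : X ^ (0.999 : ℝ) ≤ β * Z)
    (hβ : 0 < β) : X ^ (-1.1 : ℝ) ≤ β * ((c - 1) * P ^ (c - 2)) := by
  have hX1 := h.one_le
  have hX0 : 0 < X := by linarith
  have hP0 : 0 < P := by linarith [h.one_le_P]
  have e : P ^ c = P ^ (c - 2) * P ^ 2 := by
    rw [← Real.rpow_natCast, ← Real.rpow_add hP0]; congr 1; norm_num
  have h1 : X ^ (-1.1 : ℝ) * X ^ 2 ≤ X ^ (-0.0001 : ℝ) * X ^ (0.999 : ℝ) := by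
    rw [← Real.rpow_natCast, ← Real.rpow_add hX0, ← Real.rpow_add hX0]
    exact Real.rpow_le_rpow_of_exponent_le hX1 (by norm_num)
  have h2 : X ^ (-1.1 : ℝ) * X ^ 2 ≤ β * ((c - 1) * P ^ (c - 2)) * P ^ 2 := by
    calc X ^ (-1.1 : ℝ) * X ^ 2 ≤ X ^ (-0.0001 : ℝ) * (β * Z) := by
          refine h1.trans ?_
          gcongr
      _ = β * (X ^ (-0.0001 : ℝ) * Z) := by ring
      _ ≤ β * ((c - 1) * P ^ c) := mul_le_mul_of_nonneg_left h.Q_le hβ.le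
      _ = _ := by rw [e]; ring
  have h3 : β * ((c - 1) * P ^ (c - 2)) * P ^ 2 ≤ β * ((c - 1) * P ^ (c - 2)) * X ^ 2 := by
    have := h.one_lt
    have : 0 ≤ c - 1 := by linarith
    have := h.le_X
    gcongr
  exact le_of_mul_le_mul_right (h2.trans h3) (by positivity)

theorem sum_weight_tri_le (h : Admissible c Z P X) {δ : ℝ} (hδ : 0 < δ) (hδ2 : δ ≤ 1 / 2)
    (hT : X ^ (0.999 : ℝ) ≤ 100 * δ * Z) {d Q : ℕ} (hd : 1 ≤ d) (hdQ : d ≤ Q) :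
    ∑ n ∈ Ioc ⌊P⌋₊ ⌊2 * P⌋₊, vonMangoldt n * (1 - Real.cos (2 * Real.pi * (n : ℝ) ^ c)) *
      tri (δ / (d : ℝ) ^ 2) (phase c Z 0 (100 * (δ / (d : ℝ) ^ 2)) n) ≤
    2 * Real.log (2 * P) * (δ * (P + 1) * ((d : ℝ) ^ 2)⁻¹ + 31680 * (Q * X ^ (0.55 : ℝ))) := by
  have hX1 := h.one_le
  have hX0 : 0 < X := by linarith
  have hP1 := h.one_le_P
  have hP0 : 0 < P := by linarith
  have hd1 : (1 : ℝ) ≤ d := by exact_mod_cast hd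
  have hd0 : (0 : ℝ) < d := by linarith
  have hQd : (d : ℝ) ≤ Q := by exact_mod_cast hdQ
  have hc := h.one_lt
  have hc0 : 0 < c - 1 := by linarith
  have hlogP : 0 ≤ Real.log (2 * P) := Real.log_nonneg (by linarith)
  have hδd : δ / (d : ℝ) ^ 2 ≤ δ := div_le_self hδ.le (by nlinarith)
  have h1 := sum_tri_phase_le h.one_lt h.le_c hP1 h.four_mul_le (t := 100 * (δ / (d : ℝ) ^ 2))
    (δ := δ / (d : ℝ) ^ 2) (by positivity) (by positivity) (by linarith)
  have h2 : ∑ n ∈ Ioc ⌊P⌋₊ ⌊2 * P⌋₊, vonMangoldt n * (1 - Real.cos (2 * Real.pi * (n : ℝ) ^ c)) *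
      tri (δ / (d : ℝ) ^ 2) (phase c Z 0 (100 * (δ / (d : ℝ) ^ 2)) n) ≤
      2 * Real.log (2 * P) * ∑ n ∈ Ioc ⌊P⌋₊ ⌊2 * P⌋₊,
        tri (δ / (d : ℝ) ^ 2) (phase c Z 0 (100 * (δ / (d : ℝ) ^ 2)) n) := by
    rw [mul_sum]
    refine sum_le_sum fun n hn => ?_
    have hn1 := (mem_Ioc_floor hP0.le n).1 hn
    have hΛ : (0 : ℝ) ≤ vonMangoldt n := ArithmeticFunction.vonMangoldt_nonneg
    have hΛlog : vonMangoldt n ≤ Real.log n := ArithmeticFunction.vonMangoldt_le_log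
    have hlog : Real.log n ≤ Real.log (2 * P) := Real.log_le_log (by linarith [hn1.1]) hn1.2
    have hw0 : 0 ≤ 1 - Real.cos (2 * Real.pi * (n : ℝ) ^ c) := by
      linarith [Real.cos_le_one (2 * Real.pi * (n : ℝ) ^ c)]
    have hw2 : 1 - Real.cos (2 * Real.pi * (n : ℝ) ^ c) ≤ 2 := by
      linarith [Real.neg_one_le_cos (2 * Real.pi * (n : ℝ) ^ c)]
    refine mul_le_mul_of_nonneg_right ?_ (tri_nonneg _ _)
    nlinarith
  refine h2.trans (mul_le_mul_of_nonneg_left (h1.trans ?_) (by linarith))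
  have hb := h.mean_lower_bound hT (by positivity)
  have e1 : 100 * (δ / (d : ℝ) ^ 2) * ((c - 1) * P ^ (c - 2)) / (δ / (d : ℝ) ^ 2) =
      100 * ((c - 1) * P ^ (c - 2)) := by field_simp
  have h3 : P * √(100 * ((c - 1) * P ^ (c - 2))) ≤ 10 * X ^ (0.55 : ℝ) := by
    have e : P ^ c = P ^ 2 * P ^ (c - 2) := by
      rw [← Real.rpow_natCast, ← Real.rpow_add hP0]; congr 1; norm_num
    have h4 : P ^ c ≤ X ^ (1.1 : ℝ) :=
      (Real.rpow_le_rpow_of_exponent_le hP1 h.le_c).trans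
        (Real.rpow_le_rpow hP0.le h.le_X (by norm_num))
    have e2 : (X ^ (0.55 : ℝ)) ^ 2 = X ^ (1.1 : ℝ) := by
      rw [← Real.rpow_natCast, ← Real.rpow_mul hX0.le]; norm_num
    refine le_of_sq_le_sq ?_ (by positivity)
    rw [mul_pow, Real.sq_sqrt (by positivity), mul_pow, e2]
    have hc2 := h.le_c
    have : P ^ 2 * (100 * ((c - 1) * P ^ (c - 2))) = 100 * (c - 1) * P ^ c := by rw [e]; ring
    rw [this]
    have : 0 < P ^ c := by positivity
    nlinarith
  have h4 : 1 / √(100 * (δ / (d : ℝ) ^ 2) * ((c - 1) * P ^ (c - 2))) ≤ Q * X ^ (0.55 : ℝ) := by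
    have h5 : X ^ (-0.55 : ℝ) / d ≤ √(100 * (δ / (d : ℝ) ^ 2) * ((c - 1) * P ^ (c - 2))) := by
      apply Real.le_sqrt_of_sq_le
      have e2 : (X ^ (-0.55 : ℝ)) ^ 2 = X ^ (-1.1 : ℝ) := by
        rw [← Real.rpow_natCast, ← Real.rpow_mul hX0.le]; norm_num
      rw [div_pow, e2]
      calc _ ≤ 100 * δ * ((c - 1) * P ^ (c - 2)) / (d : ℝ) ^ 2 := by gcongr
        _ = _ := by ring
    calc _ ≤ 1 / (X ^ (-0.55 : ℝ) / d) := by gcongr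
      _ = d * X ^ (0.55 : ℝ) := by
        rw [Real.rpow_neg hX0.le]; field_simp
      _ ≤ _ := by gcongr
  have h5 : (1 : ℝ) ≤ Q := by linarith
  rw [e1]
  have h6 : 0 < X ^ (0.55 : ℝ) := by positivity
  have e3 : δ / (d : ℝ) ^ 2 * (P + 1) = δ * (P + 1) * ((d : ℝ) ^ 2)⁻¹ := by ring
  rw [e3]
  nlinarith

theorem sum_sifted_ge (h : Admissible c Z P X) {δ : ℝ} (hδ : 0 < δ) (hδ2 : δ ≤ 1 / 2)
    {Q₀ Q : ℕ} (hQ₀ : 1 ≤ Q₀) (hQQ : Q₀ ≤ Q) (hT : X ^ (0.999 : ℝ) ≤ 100 * (δ / (Q₀ : ℝ) ^ 2) * Z)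
    (hQ : (Q : ℝ) ≤ X ^ (0.039 : ℝ)) :
    1 / 4 * (δ * ∑ n ∈ Ioc ⌊P⌋₊ ⌊2 * P⌋₊,
        vonMangoldt n * (1 - Real.cos (2 * Real.pi * (n : ℝ) ^ c))) -
      320 * (1 + Q₀) * X ^ (0.9616 : ℝ) -
      2 * Real.log (2 * P) * (δ * (P + 1) / Q₀ + 31680 * X ^ (0.63 : ℝ)) ≤
    ∑ n ∈ Ioc ⌊P⌋₊ ⌊2 * P⌋₊, vonMangoldt n * (1 - Real.cos (2 * Real.pi * (n : ℝ) ^ c)) *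
        (tri δ (phase c Z 0 (100 * δ) n) - ∑ d ∈ Ioc 1 Q, tri (δ / (d : ℝ) ^ 2)
          (phase c Z 0 (100 * δ) n / (d : ℝ) ^ 2)) := by
  have hX1 := h.one_le
  have hX0 : 0 < X := by linarith
  have hP1 := h.one_le_P
  have hP0 : 0 < P := by linarith
  have hlogP : 0 ≤ Real.log (2 * P) := Real.log_nonneg (by linarith)
  have hZ0 : 0 < Z := lt_of_lt_of_le (by positivity) h.le_Z
  set w : ℕ → ℝ := fun n => vonMangoldt n * (1 - Real.cos (2 * Real.pi * (n : ℝ) ^ c)) with hw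
  have hw0 : ∀ n, 0 ≤ w n := fun n => mul_nonneg ArithmeticFunction.vonMangoldt_nonneg
    (by linarith [Real.cos_le_one (2 * Real.pi * (n : ℝ) ^ c)])
  set A := ∑ n ∈ Ioc ⌊P⌋₊ ⌊2 * P⌋₊, w n with hA
  have hA0 : 0 ≤ A := sum_nonneg fun n _ => hw0 n
  have e : ∀ (d : ℕ) (n : ℕ), phase c Z 0 (100 * δ) n / (d : ℝ) ^ 2 =
      phase c Z 0 (100 * (δ / (d : ℝ) ^ 2)) n := by
    intro d n
    unfold phase; ring
  set S : ℕ → ℝ := fun d => ∑ n ∈ Ioc ⌊P⌋₊ ⌊2 * P⌋₊, w n *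
    tri (δ / (d : ℝ) ^ 2) (phase c Z 0 (100 * (δ / (d : ℝ) ^ 2)) n) with hS
  have hTd : ∀ d : ℕ, 1 ≤ d → d ≤ Q₀ → X ^ (0.999 : ℝ) ≤ 100 * (δ / (d : ℝ) ^ 2) * Z := by
    intro d hd hdQ
    have hd0 : (0 : ℝ) < d := by exact_mod_cast hd
    refine hT.trans ?_
    gcongr
  have hsmall : ∀ d : ℕ, 1 ≤ d → d ≤ Q₀ →
      |S d - δ / (d : ℝ) ^ 2 * A| ≤ 320 * X ^ (0.9616 : ℝ) := by
    intro d hd hdQ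
    have hd1 : (1 : ℝ) ≤ d := by exact_mod_cast hd
    have hδd : δ / (d : ℝ) ^ 2 ≤ δ := div_le_self hδ.le (by nlinarith)
    exact h.abs_sum_weight_tri_sub_le (by positivity) (by linarith) (hTd d hd hdQ)
  have hT1 : X ^ (0.999 : ℝ) ≤ 100 * δ * Z := by
    simpa using hTd 1 le_rfl hQ₀
  have etot : ∑ n ∈ Ioc ⌊P⌋₊ ⌊2 * P⌋₊, w n *
        (tri δ (phase c Z 0 (100 * δ) n) - ∑ d ∈ Ioc 1 Q, tri (δ / (d : ℝ) ^ 2)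
          (phase c Z 0 (100 * δ) n / (d : ℝ) ^ 2)) =
      S 1 - (∑ d ∈ Ioc 1 Q₀, S d + ∑ d ∈ Ioc Q₀ Q, S d) := by
    rw [sum_Ioc_consecutive _ hQ₀ hQQ]
    simp only [hS, Nat.cast_one, one_pow, div_one, mul_sub, sum_sub_distrib, e]
    congr 1
    rw [sum_comm]
    exact sum_congr rfl fun n _ => by rw [mul_sum]
  have h1 := (abs_le.1 (hsmall 1 le_rfl hQ₀)).1
  rw [Nat.cast_one, one_pow, div_one] at h1
  have h2 : ∑ d ∈ Ioc 1 Q₀, S d ≤ 3 / 4 * (δ * A) + 320 * Q₀ * X ^ (0.9616 : ℝ) := by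
    calc ∑ d ∈ Ioc 1 Q₀, S d
        ≤ ∑ d ∈ Ioc 1 Q₀, (((d : ℝ) ^ 2)⁻¹ * (δ * A) + 320 * X ^ (0.9616 : ℝ)) := by
          refine sum_le_sum fun d hd => ?_
          rw [mem_Ioc] at hd
          have h3 := (abs_le.1 (hsmall d hd.1.le hd.2)).2
          have : δ / (d : ℝ) ^ 2 * A = ((d : ℝ) ^ 2)⁻¹ * (δ * A) := by ring
          linarith
      _ = (∑ d ∈ Ioc 1 Q₀, ((d : ℝ) ^ 2)⁻¹) * (δ * A) +
          ((Q₀ - 1 : ℕ) : ℝ) * (320 * X ^ (0.9616 : ℝ)) := by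
          rw [sum_add_distrib, sum_mul, sum_const, nsmul_eq_mul, Nat.card_Ioc]
      _ ≤ 3 / 4 * (δ * A) + (Q₀ : ℝ) * (320 * X ^ (0.9616 : ℝ)) := by
          have h3 := sum_Ioc_one_inv_sq_le Q₀
          gcongr
          omega
      _ = _ := by ring
  have h3 : ∑ d ∈ Ioc Q₀ Q, S d ≤
      2 * Real.log (2 * P) * (δ * (P + 1) / Q₀ + 31680 * X ^ (0.63 : ℝ)) := by
    calc ∑ d ∈ Ioc Q₀ Q, S d ≤ ∑ d ∈ Ioc Q₀ Q, 2 * Real.log (2 * P) *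
          (δ * (P + 1) * ((d : ℝ) ^ 2)⁻¹ + 31680 * (Q * X ^ (0.55 : ℝ))) := by
          refine sum_le_sum fun d hd => ?_
          rw [mem_Ioc] at hd
          exact h.sum_weight_tri_le hδ hδ2 hT1 (by omega) hd.2
      _ = 2 * Real.log (2 * P) * (δ * (P + 1) * (∑ d ∈ Ioc Q₀ Q, ((d : ℝ) ^ 2)⁻¹) +
          ((Q - Q₀ : ℕ) : ℝ) * (31680 * (Q * X ^ (0.55 : ℝ)))) := by
          rw [← mul_sum, sum_add_distrib, ← mul_sum, sum_const, nsmul_eq_mul, Nat.card_Ioc]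
      _ ≤ _ := by
          have h4 := sum_Ioc_inv_sq_le_sub (α := ℝ) (by omega : Q₀ ≠ 0) hQQ
          have h5 : (0 : ℝ) ≤ (Q : ℝ)⁻¹ := by positivity
          have h6 : ((Q - Q₀ : ℕ) : ℝ) ≤ X ^ (0.039 : ℝ) :=
            le_trans (by exact_mod_cast Nat.sub_le _ _) hQ
          have h7 : X ^ (0.039 : ℝ) * (X ^ (0.039 : ℝ) * X ^ (0.55 : ℝ)) ≤ X ^ (0.63 : ℝ) := by
            rw [← Real.rpow_add hX0, ← Real.rpow_add hX0]
            exact Real.rpow_le_rpow_of_exponent_le hX1 (by norm_num)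
          refine mul_le_mul_of_nonneg_left ?_ (by linarith)
          refine add_le_add ?_ ?_
          · rw [div_eq_mul_inv]
            gcongr
            linarith
          · calc _ ≤ X ^ (0.039 : ℝ) * (31680 * (X ^ (0.039 : ℝ) * X ^ (0.55 : ℝ))) := by gcongr
              _ = 31680 * (X ^ (0.039 : ℝ) * (X ^ (0.039 : ℝ) * X ^ (0.55 : ℝ))) := by ring
              _ ≤ _ := by gcongr
  rw [etot]
  linarith

end Admissible

end PrimeSquarefree

namespace PrimeSquarefree

open Finset
open ArithmeticFunction (vonMangoldt)

/-- The sifted comparison with all the errors collected, before the final choice of sizes. -/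
theorem Admissible.two_mul_sum_ge {c Z P X β δ : ℝ} (h : Admissible c Z P X) {N : ℤ}
    (hN : Z = N + 39 / 40) (hβ : β = Z ^ (1 / c - 1)) (hδ : δ = β / 100) (hδ0 : 0 < δ)
    (hδ2 : δ ≤ 1 / 2) (hP3 : 3 ≤ P) {Q₀ Q : ℕ} (hQ₀ : 1 ≤ Q₀) (hQQ : Q₀ ≤ Q)
    (hT : X ^ (0.999 : ℝ) ≤ 100 * (δ / (Q₀ : ℝ) ^ 2) * Z) (hQ : (Q : ℝ) ≤ X ^ (0.039 : ℝ))
    (G : ℕ → ℝ) (hG0 : ∀ n, 0 ≤ G n)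
    (hG : ∀ n ∈ Ioc ⌊P⌋₊ ⌊2 * P⌋₊, ∀ l : ℕ, Squarefree l →
      ⌊(n : ℝ) ^ c⌋ + ⌊(l : ℝ) ^ c⌋ = N → Real.log n ≤ G n) :
    1 / 5 * (δ * ((P - 1) * (4 / 9) - (√(2 * P) + 2) * Real.log (2 * P))) -
      (320 * Q₀ + 330) * X ^ (0.9616 : ℝ) -
      2 * Real.log (2 * P) * (δ * (P + 1) / Q₀ + 31680 * X ^ (0.63 : ℝ) + 2 * Z ^ (1 / c) / Q +
        2 * √(2 * P)) ≤
    2 * ∑ n ∈ (Ioc ⌊P⌋₊ ⌊2 * P⌋₊).filter Nat.Prime, G n := by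
  have hβδ : β = 100 * δ := by rw [hδ]; ring
  have hQ0' : (1 : ℝ) ≤ Q₀ := by exact_mod_cast hQ₀
  have hX0 : 0 < X := by linarith [h.one_le]
  have hZ0 : 0 < Z := lt_of_lt_of_le (by positivity) h.le_Z
  have h1 := h.sum_sifted_ge hδ0 hδ2 hQ₀ hQQ hT hQ
  have h2 := sum_sifted_le h.one_lt h.le_c h.one_le_P h.four_mul_le hN hβ hδ
    (by omega : Q ≠ 0) G hG0 hG
  rw [hβδ] at h2
  have hT1 : X ^ (0.999 : ℝ) ≤ 100 * δ * Z := by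
    refine hT.trans ?_
    have : δ / (Q₀ : ℝ) ^ 2 ≤ δ := div_le_self hδ0.le (by nlinarith)
    gcongr
  have h3 := (abs_le.1 (h.abs_sum_tri_sub_le hδ0 hδ2 hT1)).2
  have h4 := (abs_le.1 h.abs_sum_weight_sub_le).1
  have h5 := sum_vonMangoldt_ge hP3
  have h6 := sum_vonMangoldt_not_prime_le (by linarith : 1 ≤ P)
  set A := ∑ n ∈ Ioc ⌊P⌋₊ ⌊2 * P⌋₊, vonMangoldt n
  set Aw := ∑ n ∈ Ioc ⌊P⌋₊ ⌊2 * P⌋₊, vonMangoldt n * (1 - Real.cos (2 * Real.pi * (n : ℝ) ^ c))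
  have hE : 0 < X ^ (0.9616 : ℝ) := by positivity
  have h7 : δ * (A - X ^ (0.9616 : ℝ)) ≤ δ * Aw := by gcongr; linarith
  have h8 : δ * ((P - 1) * (4 / 9) - (√(2 * P) + 2) * Real.log (2 * P)) ≤ δ * A := by gcongr
  have h9 : δ * X ^ (0.9616 : ℝ) ≤ 1 / 2 * X ^ (0.9616 : ℝ) := by gcongr
  nlinarith

end PrimeSquarefree

namespace PrimeSquarefree

open Finset
open ArithmeticFunction (vonMangoldt)

/-- The largeness conditions on `X` that the argument needs. -/
structure LargeFor (c X : ℝ) : Prop where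
  one_lt : 1 < c
  lt_c : c < 82 / 79
  le_pow : 10 ^ 15 ≤ X ^ (0.00001 : ℝ)
  le_mul : 10 ^ 15 ≤ (c - 1) * X ^ (0.00001 : ℝ)
  log_le : Real.log (2 * X) + 6 ≤ X ^ (0.00001 : ℝ)
  one_le : 1 ≤ X

namespace LargeFor

variable {c X : ℝ}

theorem ge_pow (h : LargeFor c X) {a : ℝ} (ha : 0.00001 ≤ a) : 10 ^ 15 ≤ X ^ a :=
  h.le_pow.trans (Real.rpow_le_rpow_of_exponent_le h.one_le ha)

theorem large (h : LargeFor c X) : 10 ^ 15 ≤ X := by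
  have := h.ge_pow (a := 1) (by norm_num)
  rwa [Real.rpow_one] at this

theorem rpow_le (h : LargeFor c X) {a b : ℝ} (hab : a ≤ b) : X ^ a ≤ X ^ b :=
  Real.rpow_le_rpow_of_exponent_le h.one_le hab

theorem log_P_le (h : LargeFor c X) :
    Real.log (2 * (((10 : ℝ) ^ 9)⁻¹ * X)) + 6 ≤ X ^ (0.00001 : ℝ) := by
  refine le_trans ?_ h.log_le
  have := h.one_le
  have h1 : Real.log (2 * (((10 : ℝ) ^ 9)⁻¹ * X)) ≤ Real.log (2 * X) := by
    apply Real.log_le_log (by positivity)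
    nlinarith
  linarith

theorem admissible (h : LargeFor c X) {Z : ℝ} (hZ1 : X ^ c ≤ Z) (hZ2 : Z ≤ 2 * X ^ c) :
    Admissible c Z (((10 : ℝ) ^ 9)⁻¹ * X) X := by
  have hX1 := h.one_le
  have hX0 : 0 < X := by linarith
  have hc := h.one_lt
  have hc2 := h.lt_c
  have hXc : 0 < X ^ c := by positivity
  refine ⟨hc, by norm_num; linarith, ?_, hX1, ?_, ?_, by nlinarith, ?_, ?_, ?_, ?_⟩
  · calc 4 * (2 * (((10 : ℝ) ^ 9)⁻¹ * X)) ^ c = 4 * ((2 * ((10 : ℝ) ^ 9)⁻¹) ^ c * X ^ c) := by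
          rw [← mul_assoc 2, Real.mul_rpow (by positivity) hX0.le]
      _ ≤ 4 * ((2 * ((10 : ℝ) ^ 9)⁻¹) ^ (1 : ℝ) * X ^ c) := by
          have := Real.rpow_le_rpow_of_exponent_ge (x := 2 * ((10 : ℝ) ^ 9)⁻¹) (by positivity)
            (by norm_num) hc.le
          gcongr
      _ ≤ 1 * X ^ c := by
          rw [Real.rpow_one, ← mul_assoc]
          gcongr
          norm_num
      _ ≤ Z := by linarith
  · exact le_trans (by norm_num) (h.ge_pow (a := 0.0001) (by norm_num))
  · exact h.log_P_le.trans (h.rpow_le (by norm_num))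
  · have e : X = X ^ (0.9999 : ℝ) * X ^ (0.0001 : ℝ) := by
      rw [← Real.rpow_add hX0]; norm_num
    have h1 := h.ge_pow (a := 0.0001) (by norm_num)
    have h2 : 0 < X ^ (0.9999 : ℝ) := by positivity
    calc X ^ (0.9999 : ℝ) = ((10 : ℝ) ^ 9)⁻¹ * (X ^ (0.9999 : ℝ) * 10 ^ 9) := by field_simp
      _ ≤ ((10 : ℝ) ^ 9)⁻¹ * (X ^ (0.9999 : ℝ) * X ^ (0.0001 : ℝ)) := by
        gcongr
        linarith
      _ = _ := by rw [← e]
  · have h1 : ((10 : ℝ) ^ 9)⁻¹ ^ (2 : ℝ) ≤ ((10 : ℝ) ^ 9)⁻¹ ^ c :=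
      Real.rpow_le_rpow_of_exponent_ge (by positivity) (by norm_num) (by linarith)
    have e2 : ((10 : ℝ) ^ 9)⁻¹ ^ (2 : ℝ) = ((10 : ℝ) ^ 18)⁻¹ := by
      rw [Real.rpow_two]; norm_num
    rw [e2] at h1
    have h3 : 2 * 10 ^ 18 ≤ (c - 1) * X ^ (0.0001 : ℝ) := by
      have e : X ^ (0.0001 : ℝ) = X ^ (0.00001 : ℝ) * X ^ (0.00009 : ℝ) := by
        rw [← Real.rpow_add hX0]; norm_num
      have h4 := h.ge_pow (a := 0.00009) (by norm_num)
      have h5 := h.le_mul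
      rw [e, ← mul_assoc]
      calc (2 : ℝ) * 10 ^ 18 ≤ 10 ^ 15 * 10 ^ 15 := by norm_num
        _ ≤ _ := by gcongr
    have e3 : X ^ (-0.0001 : ℝ) * X ^ (0.0001 : ℝ) = 1 := by
      rw [← Real.rpow_add hX0]; norm_num
    have h6 : 0 < X ^ (-0.0001 : ℝ) := by positivity
    rw [Real.mul_rpow (by positivity) hX0.le]
    calc X ^ (-0.0001 : ℝ) * Z ≤ X ^ (-0.0001 : ℝ) * (2 * X ^ c) := by gcongr
      _ = X ^ (-0.0001 : ℝ) * (2 * 10 ^ 18) * (((10 : ℝ) ^ 18)⁻¹ * X ^ c) := by field_simp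
      _ ≤ X ^ (-0.0001 : ℝ) * ((c - 1) * X ^ (0.0001 : ℝ)) * (((10 : ℝ) ^ 18)⁻¹ * X ^ c) := by
          gcongr
      _ = (c - 1) * (((10 : ℝ) ^ 18)⁻¹ * X ^ c) * (X ^ (-0.0001 : ℝ) * X ^ (0.0001 : ℝ)) := by
          ring
      _ ≤ _ := by
          rw [e3, mul_one]
          have : 0 ≤ c - 1 := by linarith
          gcongr
  · calc Z ≤ 2 * X ^ c := hZ2
      _ ≤ X ^ (0.0005 : ℝ) * X ^ (1.038 : ℝ) := by
        have := h.ge_pow (a := 0.0005) (by norm_num)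
        have := h.rpow_le (a := c) (b := 1.038) (by norm_num; linarith)
        gcongr
        linarith
      _ = _ := by rw [← Real.rpow_add hX0]; norm_num
  · exact (h.rpow_le (by norm_num; linarith)).trans hZ1

theorem half_le_floor {y : ℝ} (hy : 2 ≤ y) : y / 2 ≤ (⌊y⌋₊ : ℝ) := by
  have := Nat.lt_floor_add_one y
  linarith

theorem combine {T B δ P s L q E D W V S : ℝ} (hB : B ≤ T / 10 ^ 30) (hT : 0 < T)
    (hP : T * (5 / 10 ^ 12) ≤ δ * P) (h1 : δ * (s * L) ≤ B) (h2 : δ * L ≤ B) (h3 : δ ≤ B)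
    (h4 : q * E ≤ B) (h5 : E ≤ B) (h6 : L * D ≤ T / 10 ^ 15) (h7 : L * W ≤ B)
    (h8 : L * V ≤ 8 * B) (h9 : L * s ≤ B)
    (h : 1 / 5 * (δ * ((P - 1) * (4 / 9) - (s + 2) * L)) - (320 * q + 330) * E -
      2 * L * (D + 31680 * W + V + 2 * s) ≤ 2 * S) : ((10 : ℝ) ^ 14)⁻¹ * T ≤ S := by
  have e : 1 / 5 * (δ * ((P - 1) * (4 / 9) - (s + 2) * L)) - (320 * q + 330) * E -
      2 * L * (D + 31680 * W + V + 2 * s) = 4 / 45 * (δ * P) - 4 / 45 * δ - 1 / 5 * (δ * (s * L))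
      - 2 / 5 * (δ * L) - 320 * (q * E) - 330 * E - 2 * (L * D) - 63360 * (L * W) - 2 * (L * V)
      - 4 * (L * s) := by ring
  rw [e] at h
  have hT1 : T * (4 / 9 / 10 ^ 12) - T / 10 ^ 17 - T / 10 ^ 14 ≥ 2 * (T / 10 ^ 14) := by
    linarith
  have hB1 : 70000 * B ≤ T / 10 ^ 17 := by linarith
  have hD1 : 2 * (L * D) ≤ T / 10 ^ 14 := by linarith
  rw [inv_mul_eq_div]
  linarith

set_option maxHeartbeats 1000000 in
theorem sum_ge (h : LargeFor c X) {N : ℕ} (hX : X = (N : ℝ) ^ (1 / c))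
    (G : ℕ → ℝ) (hG0 : ∀ n, 0 ≤ G n)
    (hG : ∀ n ∈ Ioc ⌊((10 : ℝ) ^ 9)⁻¹ * X⌋₊ ⌊2 * (((10 : ℝ) ^ 9)⁻¹ * X)⌋₊, ∀ l : ℕ,
      Squarefree l → ⌊(n : ℝ) ^ c⌋ + ⌊(l : ℝ) ^ c⌋ = (N : ℤ) → Real.log n ≤ G n) :
    ((10 : ℝ) ^ 14)⁻¹ * X ^ (2 - c) ≤
      ∑ n ∈ (Ioc ⌊((10 : ℝ) ^ 9)⁻¹ * X⌋₊ ⌊2 * (((10 : ℝ) ^ 9)⁻¹ * X)⌋₊).filter Nat.Prime,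
        G n := by
  have hX1 := h.one_le
  have hX0 : 0 < X := by linarith
  have hXl := h.large
  have hc := h.one_lt
  have hc2 := h.lt_c
  have hc0 : 0 < c := by linarith
  have hXN : X ^ c = N := by
    rw [hX, ← Real.rpow_mul (by positivity), one_div, inv_mul_cancel₀ hc0.ne', Real.rpow_one]
  have hXc1 : 1 ≤ X ^ c := Real.one_le_rpow hX1 hc0.le
  set Z : ℝ := N + 39 / 40 with hZ
  have hZ1 : X ^ c ≤ Z := by rw [hXN]; linarith
  have hZ2 : Z ≤ 2 * X ^ c := by rw [hXN] at hXc1 ⊢; linarith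
  have hZ0 : 0 < Z := by linarith
  have had := h.admissible hZ1 hZ2
  set P := ((10 : ℝ) ^ 9)⁻¹ * X with hP
  set K := X ^ (0.00001 : ℝ) with hK
  have hKl : 10 ^ 15 ≤ K := h.le_pow
  set β := Z ^ (1 / c - 1) with hβ
  have hγ1 : 1 / c ≤ 1 := by rw [div_le_one hc0]; exact hc.le
  have hγ0 : 0 < 1 / c := by positivity
  have eX : (X ^ c) ^ (1 / c) = X := by
    rw [← Real.rpow_mul hX0.le, mul_one_div, div_self hc0.ne', Real.rpow_one]
  have eX1 : (X ^ c) ^ (1 / c - 1) = X ^ (1 - c) := by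
    rw [← Real.rpow_mul hX0.le]; congr 1; field_simp
  have hZγ1 : X ≤ Z ^ (1 / c) := by
    calc X = (X ^ c) ^ (1 / c) := eX.symm
      _ ≤ Z ^ (1 / c) := by gcongr
  have hZγ2 : Z ^ (1 / c) ≤ 2 * X := by
    calc Z ^ (1 / c) ≤ (2 * X ^ c) ^ (1 / c) := by gcongr
      _ = 2 ^ (1 / c) * X := by rw [Real.mul_rpow (by norm_num) (by positivity), eX]
      _ ≤ 2 ^ (1 : ℝ) * X := by gcongr; norm_num
      _ = 2 * X := by rw [Real.rpow_one]
  have hβZ : β * Z = Z ^ (1 / c) := by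
    rw [hβ, ← Real.rpow_add_one hZ0.ne', sub_add_cancel]
  have hβ1 : β ≤ X ^ (1 - c) := by
    rw [← eX1]
    exact Real.rpow_le_rpow_of_nonpos (by positivity) hZ1 (by linarith)
  have hβ2 : X ^ (1 - c) / 2 ≤ β := by
    calc X ^ (1 - c) / 2 = 2 ^ (-1 : ℝ) * X ^ (1 - c) := by rw [Real.rpow_neg_one]; ring
      _ ≤ 2 ^ (1 / c - 1) * X ^ (1 - c) := by
        gcongr
        · norm_num
        · linarith
      _ = (2 * X ^ c) ^ (1 / c - 1) := by rw [Real.mul_rpow (by norm_num) (by positivity), eX1]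
      _ ≤ β := Real.rpow_le_rpow_of_nonpos hZ0 hZ2 (by linarith)
  have hX1c : X ^ (1 - c) ≤ 1 := Real.rpow_le_one_of_one_le_of_nonpos hX1 (by linarith)
  have hX1c0 : 0 < X ^ (1 - c) := by positivity
  set δ := β / 100 with hδ
  have hδ0 : 0 < δ := by positivity
  have hδ1 : δ ≤ X ^ (1 - c) / 100 := by rw [hδ]; gcongr
  have hδ2 : X ^ (1 - c) / 200 ≤ δ := by rw [hδ]; linarith
  have hT1 : X ^ (1 - c) * X = X ^ (2 - c) := by
    rw [← Real.rpow_add_one hX0.ne']; congr 1; ring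
  set T := X ^ (2 - c) with hT
  have hQ₀l := h.ge_pow (a := 0.0001) (by norm_num)
  have hQl := h.ge_pow (a := 0.039) (by norm_num)
  set Q₀ := ⌊X ^ (0.0001 : ℝ)⌋₊ with hQ₀
  set Q := ⌊X ^ (0.039 : ℝ)⌋₊ with hQ
  have hQ₀1 : (Q₀ : ℝ) ≤ X ^ (0.0001 : ℝ) := Nat.floor_le (by positivity)
  have hQ₀2 : X ^ (0.0001 : ℝ) / 2 ≤ Q₀ := half_le_floor (by linarith)
  have hQ1 : (Q : ℝ) ≤ X ^ (0.039 : ℝ) := Nat.floor_le (by positivity)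
  have hQ2 : X ^ (0.039 : ℝ) / 2 ≤ Q := half_le_floor (by linarith)
  have hQ₀pos : (0 : ℝ) < Q₀ := by linarith
  have hQpos : (0 : ℝ) < Q := by linarith
  have hQQ : Q₀ ≤ Q := Nat.floor_mono (h.rpow_le (by norm_num))
  have hTcond : X ^ (0.999 : ℝ) ≤ 100 * (δ / (Q₀ : ℝ) ^ 2) * Z := by
    have e : 100 * (δ / (Q₀ : ℝ) ^ 2) * Z = Z ^ (1 / c) / (Q₀ : ℝ) ^ 2 := by
      rw [← hβZ, hδ]; ring
    rw [e, le_div_iff₀ (by positivity)]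
    calc X ^ (0.999 : ℝ) * (Q₀ : ℝ) ^ 2 ≤ X ^ (0.999 : ℝ) * (X ^ (0.0001 : ℝ)) ^ 2 := by gcongr
      _ = X ^ (0.9992 : ℝ) := by
        rw [← Real.rpow_natCast (X ^ (0.0001 : ℝ)), ← Real.rpow_mul hX0.le, ← Real.rpow_add hX0]
        norm_num
      _ ≤ X ^ (1 : ℝ) := h.rpow_le (by norm_num)
      _ = X := Real.rpow_one X
      _ ≤ _ := hZγ1
  have hP3 : 3 ≤ P := by rw [hP]; linarith
  have hmain := had.two_mul_sum_ge (N := N) (by rw [hZ]; simp) hβ hδ hδ0 (by linarith) hP3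
    (by exact_mod_cast hQ₀pos) hQQ hTcond hQ1 G hG0 hG
  have hL0 : 0 ≤ Real.log (2 * P) := Real.log_nonneg (by linarith)
  have hLK : Real.log (2 * P) ≤ K := by
    have hlp : Real.log (2 * P) + 6 ≤ K := h.log_P_le
    linarith
  have hPX : P = ((10 : ℝ) ^ 9)⁻¹ * X := hP
  set L := Real.log (2 * P) with hL
  set B := X ^ (0.9618 : ℝ) with hB
  have hB0 : 0 < B := by positivity
  have hBT : B * K * K ≤ T := by
    rw [hB, hK, ← Real.rpow_add hX0, ← Real.rpow_add hX0]
    exact h.rpow_le (by norm_num; linarith only [hc2])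
  have hsq : √(2 * P) ≤ X ^ (0.5 : ℝ) := by
    rw [show (0.5 : ℝ) = 1 / 2 by norm_num, ← Real.sqrt_eq_rpow]
    apply Real.sqrt_le_sqrt
    rw [hPX]; linarith
  have hKmul : ∀ a : ℝ, a ≤ 0.9617 → K * X ^ a ≤ B := by
    intro a ha
    rw [hK, hB, ← Real.rpow_add hX0]
    exact h.rpow_le (by norm_num at ha ⊢; linarith only [ha])
  have hE1 : X ^ (0.9616 : ℝ) ≤ B := h.rpow_le (by norm_num)
  have hE2 : Q₀ * X ^ (0.9616 : ℝ) ≤ B := by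
    calc _ ≤ X ^ (0.0001 : ℝ) * X ^ (0.9616 : ℝ) := by gcongr
      _ = X ^ (0.9617 : ℝ) := by rw [← Real.rpow_add hX0]; norm_num
      _ ≤ B := h.rpow_le (by norm_num)
  have hE3 : L * X ^ (0.63 : ℝ) ≤ B :=
    (mul_le_mul_of_nonneg_right hLK (by positivity)).trans (hKmul _ (by norm_num))
  have hE4 : L * (Z ^ (1 / c) / Q) ≤ 4 * B := by
    calc L * (Z ^ (1 / c) / Q) ≤ K * (2 * X / (X ^ (0.039 : ℝ) / 2)) := by gcongr
      _ = 4 * (K * (X ^ (1 : ℝ) / X ^ (0.039 : ℝ))) := by rw [Real.rpow_one]; ring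
      _ = 4 * (K * X ^ (0.961 : ℝ)) := by rw [← Real.rpow_sub hX0]; norm_num
      _ ≤ 4 * B := by linarith only [hKmul 0.961 (by norm_num)]
  have hE5 : L * √(2 * P) ≤ B :=
    (mul_le_mul hLK hsq (by positivity) (by positivity)).trans (hKmul _ (by norm_num))
  have hE6 : L ≤ B := by
    have := hKmul 0 (by norm_num)
    rw [Real.rpow_zero, mul_one] at this
    linarith only [this, hLK]
  have hB1 : 1 ≤ B := Real.one_le_rpow hX1 (by norm_num)
  have hE7 : L * (δ * (P + 1) / Q₀) * K ≤ T := by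
    have e : K ^ 10 = X ^ (0.0001 : ℝ) := by
      rw [hK, ← Real.rpow_natCast, ← Real.rpow_mul hX0.le]; norm_num
    have hKK : K ^ 2 ≤ X ^ (0.0001 : ℝ) := by
      rw [← e]
      exact pow_le_pow_right₀ (by linarith) (by norm_num)
    calc L * (δ * (P + 1) / Q₀) * K
        ≤ K * (X ^ (1 - c) / 100 * X / (X ^ (0.0001 : ℝ) / 2)) * K := by
          gcongr
          rw [hPX]; linarith
      _ = T * (K ^ 2 / X ^ (0.0001 : ℝ)) / 50 := by rw [← hT1]; ring
      _ ≤ T * 1 / 50 := by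
          have : 0 < T := by positivity
          gcongr
          rw [div_le_one (by positivity)]
          exact hKK
      _ ≤ T := by
          have : 0 < T := by positivity
          linarith only [this]
  have hT0 : 0 < T := by positivity
  have hK0 : 0 < K := by linarith
  have hBsmall : B ≤ T / 10 ^ 30 := by
    rw [le_div_iff₀ (by positivity)]
    calc B * 10 ^ 30 = B * 10 ^ 15 * 10 ^ 15 := by ring
      _ ≤ B * K * K := by gcongr
      _ ≤ T := hBT
  have hE7small : L * (δ * (P + 1) / Q₀) ≤ T / 10 ^ 15 := by
    have h0 : 0 ≤ L * (δ * (P + 1) / Q₀) := by positivity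
    rw [le_div_iff₀ (by positivity)]
    calc _ ≤ L * (δ * (P + 1) / Q₀) * K := by gcongr
      _ ≤ T := hE7
  have hδP : T * (5 / 10 ^ 12) ≤ δ * P := by
    calc T * (5 / 10 ^ 12) = X ^ (1 - c) / 200 * (((10 : ℝ) ^ 9)⁻¹ * X) := by rw [← hT1]; ring
      _ ≤ δ * (((10 : ℝ) ^ 9)⁻¹ * X) := by gcongr
      _ = δ * P := by rw [hPX]
  have hδl : δ * (√(2 * P) * L) ≤ B := by
    have h0 : 0 ≤ √(2 * P) * L := by positivity
    have : δ * (√(2 * P) * L) ≤ 1 * (√(2 * P) * L) := by gcongr; linarith only [hδ1, hX1c]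
    linarith only [this, hE5]
  have hδL : δ * L ≤ B := by
    have : δ * L ≤ 1 * L := by gcongr; linarith only [hδ1, hX1c]
    linarith only [this, hE6]
  have hδB : δ ≤ B := by linarith only [hδ1, hX1c, hB1]
  have hV : L * (2 * Z ^ (1 / c) / Q) = 2 * (L * (Z ^ (1 / c) / Q)) := by ring
  refine combine hBsmall hT0 hδP ?_ hδL hδB hE2 hE1 hE7small hE3
    (by linarith only [hV, hE4]) hE5 hmain
  linarith only [hδl]

end LargeFor

end PrimeSquarefree

namespace PrimeSquarefree

open Finset Filter

theorem eventually_largeFor {c : ℝ} (hc1 : 1 < c) (hc2 : c < 82 / 79) :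
    ∀ᶠ X : ℝ in atTop, LargeFor c X := by
  have hpow : Tendsto (fun X : ℝ => X ^ (0.00001 : ℝ)) atTop atTop :=
    tendsto_rpow_atTop (by norm_num)
  have hlog : ∀ᶠ X : ℝ in atTop, Real.log X ≤ 1 / 2 * X ^ (0.00001 : ℝ) := by
    have := (isLittleO_log_rpow_atTop (r := 0.00001) (by norm_num)).bound
      (show (0 : ℝ) < 1 / 2 by norm_num)
    filter_upwards [this, eventually_ge_atTop 1] with X h h1
    rw [Real.norm_of_nonneg (Real.log_nonneg h1), Real.norm_of_nonneg (by positivity)] at h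
    exact h
  filter_upwards [hpow.eventually_ge_atTop (10 ^ 15),
    hpow.eventually_ge_atTop (10 ^ 15 / (c - 1)), hlog, eventually_ge_atTop 1] with X h1 h2 h3 h4
  refine ⟨hc1, hc2, h1, ?_, ?_, h4⟩
  · rwa [div_le_iff₀' (by linarith)] at h2
  · rw [Real.log_mul (by norm_num) (by linarith)]
    have := Real.log_two_lt_d9
    linarith

theorem eventually_largeFor_rpow {c : ℝ} (hc1 : 1 < c) (hc2 : c < 82 / 79) :
    ∀ᶠ N : ℕ in atTop, LargeFor c ((N : ℝ) ^ (1 / c)) :=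
  ((tendsto_rpow_atTop (show 0 < 1 / c by positivity)).comp
    tendsto_natCast_atTop_atTop).eventually (eventually_largeFor hc1 hc2)

theorem primesIn_eq {c : ℝ} (hc : 1 < c) {N : ℕ} (hN : 1 ≤ N) :
    primesIn c N = (Ioc ⌊PP c N⌋₊ ⌊2 * PP c N⌋₊).filter Nat.Prime := by
  have hP0 : 0 ≤ PP c N := by unfold PP; positivity
  have hN1 : (1 : ℝ) ≤ N := by exact_mod_cast hN
  have hPN : 2 * PP c N ≤ N := by
    have : (N : ℝ) ^ (1 / c) ≤ (N : ℝ) ^ (1 : ℝ) := by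
      gcongr
      rw [div_le_one (by linarith)]
      exact hc.le
    rw [Real.rpow_one] at this
    unfold PP
    linarith
  ext p
  simp only [primesIn, mem_filter, mem_range, mem_Ioc, Nat.floor_lt hP0,
    Nat.le_floor_iff (mul_nonneg zero_le_two hP0)]
  constructor
  · rintro ⟨-, h1, h2, h3⟩
    exact ⟨⟨h2, h3⟩, h1⟩
  · rintro ⟨⟨h2, h3⟩, h1⟩
    refine ⟨?_, h1, h2, h3⟩
    have : (p : ℝ) ≤ N := h3.trans hPN
    exact Nat.lt_succ_of_le (by exact_mod_cast this)

theorem hasFiniteSupport_floor_rpow {c : ℝ} (hc : 1 < c) (a N : ℤ) (f : ℕ → ℝ) :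
    (Function.support fun m : ℕ => if a + ⌊(m : ℝ) ^ c⌋ = N then f m else 0).Finite := by
  refine (Set.finite_Iic ⌊((N - a + 1 : ℤ) : ℝ)⌋₊).subset fun m hm => ?_
  have h : a + ⌊(m : ℝ) ^ c⌋ = N := by
    by_contra h
    exact hm (if_neg h)
  have h1 : (m : ℝ) ^ c < ((N - a + 1 : ℤ) : ℝ) := by
    have := Int.lt_floor_add_one ((m : ℝ) ^ c)
    rw [show ⌊(m : ℝ) ^ c⌋ = N - a by lia] at this
    push_cast at this ⊢
    exact this
  rw [Set.mem_Iic]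
  apply Nat.le_floor
  rcases Nat.eq_zero_or_pos m with rfl | hm0
  · refine le_trans ?_ h1.le
    push_cast
    positivity
  · have hm1 : (1 : ℝ) ≤ m := by exact_mod_cast hm0
    calc (m : ℝ) = (m : ℝ) ^ (1 : ℝ) := (Real.rpow_one _).symm
      _ ≤ (m : ℝ) ^ c := Real.rpow_le_rpow_of_exponent_le hm1 hc.le
      _ ≤ _ := h1.le

theorem log_le_tsum {c : ℝ} (hc : 1 < c) {N : ℤ} {n l : ℕ} (hl : Squarefree l)
    (h : ⌊(n : ℝ) ^ c⌋ + ⌊(l : ℝ) ^ c⌋ = N) :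
    Real.log n ≤ ∑' m : ℕ, if ⌊(n : ℝ) ^ c⌋ + ⌊(m : ℝ) ^ c⌋ = N then
      ((ArithmeticFunction.moebius m : ℤ) : ℝ) ^ 2 * Real.log n else 0 := by
  have hs : Summable fun m : ℕ => if ⌊(n : ℝ) ^ c⌋ + ⌊(m : ℝ) ^ c⌋ = N then
      ((ArithmeticFunction.moebius m : ℤ) : ℝ) ^ 2 * Real.log n else 0 :=
    summable_of_hasFiniteSupport (hasFiniteSupport_floor_rpow hc _ _ _)
  refine le_trans (le_of_eq ?_) (hs.le_tsum l fun m _ => ?_)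
  · rw [if_pos h]
    have h2 := ArithmeticFunction.moebius_sq_eq_one_of_squarefree hl
    have h3 : ((ArithmeticFunction.moebius l : ℤ) : ℝ) ^ 2 = 1 := by exact_mod_cast h2
    rw [h3, one_mul]
  · split_ifs
    · have := Real.log_natCast_nonneg n
      positivity
    · exact le_rfl

end PrimeSquarefree

/-- Suppose that `1 < c < 82/79` and `γ = 1/c`.  Then there exist a constant `C > 0`
and `N₀` such that `Γ ≥ C · N^(2γ-1)` for all integers `N ≥ N₀`. -/
theorem Gamma_lower_bound (c : ℝ) (hc1 : 1 < c) (hc2 : c < 82 / 79) :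
    ∃ C : ℝ, 0 < C ∧ ∃ N₀ : ℕ, ∀ N : ℕ, N₀ ≤ N →
      C * (N : ℝ) ^ (2 * (1 / c) - 1) ≤ Γ c N := by
  obtain ⟨N₀, hN₀⟩ := Filter.eventually_atTop.1
    (PrimeSquarefree.eventually_largeFor_rpow hc1 hc2)
  refine ⟨((10 : ℝ) ^ 14)⁻¹, by positivity, max N₀ 1, fun N hN => ?_⟩
  have hpow : (N : ℝ) ^ (2 * (1 / c) - 1) = ((N : ℝ) ^ (1 / c)) ^ (2 - c) := by
    rw [← Real.rpow_mul (Nat.cast_nonneg N)]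
    congr 1
    field_simp
  rw [hpow, Γ, PrimeSquarefree.primesIn_eq hc1 (le_of_max_le_right hN)]
  refine (hN₀ N (le_of_max_le_left hN)).sum_ge rfl _ (fun n => tsum_nonneg fun m => ?_)
    fun n _ l hl h => PrimeSquarefree.log_le_tsum hc1 hl h
  split_ifs
  · have := Real.log_natCast_nonneg n
    positivity
  · exact le_rfl
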